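/- Let H̄=(H0,H1) be a compatible pair of complex Hilbert spaces and 0<θ<1. Then, with the normalisation N_{θ,2}=((2/π)sin(πθ))^{1/2} in both definitions, the K- and J-interpolation spaces coincide: K_{θ,2}(H̄)=J_{θ,2}(H̄) as sets, and ‖φ‖_{K_{θ,2}(H̄)}=‖φ‖_{J_{θ,2}(H̄)} for every φ∈K_{θ,2}(H̄). -/

import Mathlib

open MeasureTheory Set Filter Topology
open scoped ENNReal NNReal

noncomputable section

/-- The measure `dt/t` on `(0,∞)`. -/
def logMeasure : Measure ℝ :=
  (volume.restrict (Set.Ioi (0:ℝ))).withDensity (fun t => ENNReal.ofReal t⁻¹)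

/-- The weighted norm `‖F‖_{θ,q} = (∫₀^∞ (t^{-θ} F(t))^q dt/t)^{1/q}`,
with the essential supremum convention for `q = ∞`. -/
def thetaNormE (θ : ℝ) (q : ℝ≥0∞) (F : ℝ → ℝ≥0∞) : ℝ≥0∞ :=
  if q = ⊤ then essSup (fun t => ENNReal.ofReal (t ^ (-θ)) * F t) logMeasure
  else (∫⁻ t, (ENNReal.ofReal (t ^ (-θ)) * F t) ^ q.toReal ∂logMeasure) ^ (1 / q.toReal)

/-- `g(s) = s/√(1+s²)`. -/
def gfun (s : ℝ) : ℝ := s / Real.sqrt (1 + s ^ 2)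

def gfunE (s : ℝ) : ℝ≥0∞ := ENNReal.ofReal (gfun s)

/-- A compatible pair of complex Banach spaces: `X0` and `X1` are complex Banach
spaces realised as linear subspaces (via injective linear maps) of a common
complex vector space `V`. -/
structure CompatiblePair (V : Type*) [AddCommGroup V] [Module ℂ V]
    (X0 : Type*) [NormedAddCommGroup X0] [NormedSpace ℂ X0] [CompleteSpace X0]
    (X1 : Type*) [NormedAddCommGroup X1] [NormedSpace ℂ X1] [CompleteSpace X1] where
  j0 : X0 →ₗ[ℂ] V
  j1 : X1 →ₗ[ℂ] V
  inj0 : Function.Injective j0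
  inj1 : Function.Injective j1

namespace CompatiblePair

variable {V X0 X1 : Type*} [AddCommGroup V] [Module ℂ V]
  [NormedAddCommGroup X0] [NormedSpace ℂ X0] [CompleteSpace X0]
  [NormedAddCommGroup X1] [NormedSpace ℂ X1] [CompleteSpace X1]
  (P : CompatiblePair V X0 X1)

/-- `Σ(X̄) = X0 + X1` as a subset of `V`. -/
def sigmaSet : Set V := {x | ∃ a b, P.j0 a + P.j1 b = x}

/-- `Δ(X̄) = X0 ∩ X1` as a subset of `V`. -/
def deltaSet : Set V := Set.range P.j0 ∩ Set.range P.j1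

/-- `‖x‖_{Σ(X̄)}` (with value `∞` off `Σ(X̄)`). -/
def normSigmaE (x : V) : ℝ≥0∞ :=
  sInf {r | ∃ a b, P.j0 a + P.j1 b = x ∧ r = ENNReal.ofReal (‖a‖ + ‖b‖)}

/-- `‖x‖_{Δ(X̄)} = max(‖x‖_{X0}, ‖x‖_{X1})` (with value `∞` off `Δ(X̄)`). -/
def normDeltaE (x : V) : ℝ≥0∞ :=
  sInf {r | ∃ a b, P.j0 a = x ∧ P.j1 b = x ∧ r = ENNReal.ofReal (max ‖a‖ ‖b‖)}

/-- `‖x‖_{X0}` for `x` in (the image of) `X0` (with value `∞` otherwise). -/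
def norm0E (x : V) : ℝ≥0∞ := sInf {r | ∃ a, P.j0 a = x ∧ r = ENNReal.ofReal ‖a‖}

/-- `‖x‖_{X1}` for `x` in (the image of) `X1` (with value `∞` otherwise). -/
def norm1E (x : V) : ℝ≥0∞ := sInf {r | ∃ b, P.j1 b = x ∧ r = ENNReal.ofReal ‖b‖}

/-- The K-functional `K(t,x) = inf {(‖a‖_{X0}² + t²‖b‖_{X1}²)^{1/2} : j0 a + j1 b = x}`. -/
def KfunE (t : ℝ) (x : V) : ℝ≥0∞ :=
  sInf {r | ∃ a b, P.j0 a + P.j1 b = x ∧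
    r = ENNReal.ofReal (Real.sqrt (‖a‖ ^ 2 + t ^ 2 * ‖b‖ ^ 2))}

/-- `‖K(·,x)‖_{θ,q}`. -/
def KquasinormE (θ : ℝ) (q : ℝ≥0∞) (x : V) : ℝ≥0∞ := thetaNormE θ q (fun t => P.KfunE t x)

/-- The underlying set of the interpolation space `K_{θ,q}(X̄)`. -/
def Kmem (θ : ℝ) (q : ℝ≥0∞) : Set V := {x | x ∈ P.sigmaSet ∧ P.KquasinormE θ q x < ⊤}

/-- The norm of `K_{θ,q}(X̄)`, with the normalisation `N_{θ,q} = ‖g‖_{θ,q}⁻¹`,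
`g(s) = s/√(1+s²)`. -/
def KnormE (θ : ℝ) (q : ℝ≥0∞) (x : V) : ℝ≥0∞ :=
  (thetaNormE θ q gfunE)⁻¹ * P.KquasinormE θ q x

/-- The norm of `K_{θ,2}(X̄)`, with the explicit normalisation
`N_{θ,2} = ((2/π) sin (πθ))^{1/2}`. -/
def Knorm2E (θ : ℝ) (x : V) : ℝ≥0∞ :=
  ENNReal.ofReal (Real.sqrt (2 / Real.pi * Real.sin (Real.pi * θ))) * P.KquasinormE θ 2 x

/-- The real-valued `K_{θ,2}` norm. -/
def Knorm2R (θ : ℝ) (x : V) : ℝ := (P.Knorm2E θ x).toReal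

/-- `Δ(X̄)` realised as a (normed) submodule of `X0 × X1` (with the max norm):
pairs `(a,b)` with `j0 a = j1 b`. -/
def deltaSub : Submodule ℂ (X0 × X1) where
  carrier := {p | P.j0 p.1 = P.j1 p.2}
  add_mem' := by
    intro p q hp hq
    simp only [Set.mem_setOf_eq] at *
    simp [map_add, hp, hq]
  zero_mem' := by simp
  smul_mem' := by
    intro c p hp
    simp only [Set.mem_setOf_eq] at *
    simp [_root_.map_smul, hp]

/-- The J-functional `J(t,φ) = (‖φ‖_{X0}² + t²‖φ‖_{X1}²)^{1/2}`. -/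
def Jfun (t : ℝ) (p : X0 × X1) : ℝ := Real.sqrt (‖p.1‖ ^ 2 + t ^ 2 * ‖p.2‖ ^ 2)

/-- `f : (0,∞) → Δ(X̄)` is a J-representation of `φ`: it is strongly measurable,
`∫_a^b ‖f(t)‖_Δ dt/t < ∞` for `0<a<b<∞`, `∫₀^∞ ‖f(t)‖_Σ dt/t < ∞`, and
`φ = ∫₀^∞ f(t) dt/t` with convergence in `Σ(X̄)`. -/
structure IsJRep (φ : V) (f : ℝ → P.deltaSub) : Prop where
  meas : AEStronglyMeasurable f (volume.restrict (Set.Ioi (0:ℝ)))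
  locInt : ∀ a b : ℝ, 0 < a → a < b →
    IntegrableOn (fun t => ‖f t‖ / t) (Set.Ioo a b)
  sigmaInt : ∫⁻ t in Set.Ioi (0:ℝ),
      P.normSigmaE (P.j0 ((f t : X0 × X1).1)) * ENNReal.ofReal t⁻¹ < ⊤
  conv : Tendsto (fun ab : ℝ × ℝ =>
      P.normSigmaE (φ - P.j0 (∫ t in Set.Ioo ab.1 ab.2, t⁻¹ • ((f t : X0 × X1).1))))
      ((𝓝[>] (0:ℝ)) ×ˢ atTop) (𝓝 0)

/-- `inf_f ‖J(·,f(·))‖_{θ,q}` over all J-representations of `φ` (`∞` if none). -/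
def JinfE (θ : ℝ) (q : ℝ≥0∞) (φ : V) : ℝ≥0∞ :=
  ⨅ (f : ℝ → P.deltaSub) (_ : P.IsJRep φ f),
    thetaNormE θ q (fun t => ENNReal.ofReal (Jfun t (f t : X0 × X1)))

/-- The underlying set of the interpolation space `J_{θ,q}(X̄)`. -/
def Jmem (θ : ℝ) (q : ℝ≥0∞) : Set V := {φ | P.JinfE θ q φ < ⊤}

/-- The norm of `J_{θ,q}(X̄)` with the normalisation `N_{θ,q*}⁻¹ = ‖g‖_{θ,q*}`,
where `q*` is the conjugate exponent of `q`. -/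
def JnormE (θ : ℝ) (q qstar : ℝ≥0∞) (φ : V) : ℝ≥0∞ :=
  thetaNormE θ qstar gfunE * P.JinfE θ q φ

/-- The norm of `J_{θ,2}(X̄)` with the explicit normalisation
`N_{θ,2}⁻¹ = ((2/π) sin (πθ))^{-1/2}`. -/
def Jnorm2E (θ : ℝ) (φ : V) : ℝ≥0∞ :=
  (ENNReal.ofReal (Real.sqrt (2 / Real.pi * Real.sin (Real.pi * θ))))⁻¹ * P.JinfE θ 2 φ

end CompatiblePair

/-- The constant `N_{θ,2}² = (2/π) sin (πθ)`. -/
def normConst (θ : ℝ) : ℝ := 2 / Real.pi * Real.sin (Real.pi * θ)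

lemma normConst_pos {θ : ℝ} (h0 : 0 < θ) (h1 : θ < 1) : 0 < normConst θ := by
  have : 0 < Real.sin (Real.pi * θ) :=
    Real.sin_pos_of_pos_of_lt_pi (by positivity) (by nlinarith [Real.pi_pos])
  unfold normConst; positivity

lemma normConst_one_sub (θ : ℝ) : normConst (1 - θ) = normConst θ := by
  unfold normConst
  rw [mul_sub, mul_one, Real.sin_pi_sub]

lemma one_div_beta {θ : ℝ} : 1 / ProbabilityTheory.beta θ (1 - θ) = normConst θ / 2 := by
  unfold ProbabilityTheory.beta normConst
  rw [Real.Gamma_mul_Gamma_one_sub]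
  simp
  ring

/-- The distribution function of the Beta distribution with parameters `θ, 1 - θ`. -/
def incBeta (θ v : ℝ) : ℝ := ∫ s in (0:ℝ)..v, ProbabilityTheory.betaPDFReal θ (1 - θ) s


lemma betaPDFReal_nonneg {α β : ℝ} (hα : 0 < α) (hβ : 0 < β) (s : ℝ) :
    0 ≤ ProbabilityTheory.betaPDFReal α β s := by
  by_cases h : 0 < s ∧ s < 1
  · exact (ProbabilityTheory.betaPDFReal_pos h.1 h.2 hα hβ).le
  · simp [ProbabilityTheory.betaPDFReal, h]

lemma integrable_betaPDFReal {α β : ℝ} (hα : 0 < α) (hβ : 0 < β) :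
    Integrable (ProbabilityTheory.betaPDFReal α β) := by
  refine ⟨(ProbabilityTheory.measurable_betaPDFReal α β).aestronglyMeasurable, ?_⟩
  rw [hasFiniteIntegral_iff_ofReal (Eventually.of_forall (betaPDFReal_nonneg hα hβ))]
  have := ProbabilityTheory.lintegral_betaPDF_eq_one hα hβ
  simp only [ProbabilityTheory.betaPDF] at this
  rw [this]
  simp

lemma integral_betaPDFReal {α β : ℝ} (hα : 0 < α) (hβ : 0 < β) :
    ∫ s, ProbabilityTheory.betaPDFReal α β s = 1 := by
  rw [integral_eq_lintegral_of_nonneg_ae (Eventually.of_forall (betaPDFReal_nonneg hα hβ))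
    (ProbabilityTheory.measurable_betaPDFReal α β).aestronglyMeasurable]
  have := ProbabilityTheory.lintegral_betaPDF_eq_one hα hβ
  simp only [ProbabilityTheory.betaPDF] at this
  rw [this]
  simp

lemma continuous_incBeta {θ : ℝ} (h0 : 0 < θ) (h1 : θ < 1) : Continuous (incBeta θ) :=
  intervalIntegral.continuous_primitive (μ := volume)
    (f := ProbabilityTheory.betaPDFReal θ (1 - θ))
    (fun _ _ => (integrable_betaPDFReal h0 (by linarith)).intervalIntegrable) 0

lemma incBeta_zero (θ : ℝ) : incBeta θ 0 = 0 := by simp [incBeta]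

lemma incBeta_one {θ : ℝ} (h0 : 0 < θ) (h1 : θ < 1) : incBeta θ 1 = 1 := by
  have hz : ∀ x, x ∉ Ioc (0:ℝ) 1 → ProbabilityTheory.betaPDFReal θ (1 - θ) x = 0 := by
    intro x hx
    have : ¬ (0 < x ∧ x < 1) := fun h => hx ⟨h.1, h.2.le⟩
    simp [ProbabilityTheory.betaPDFReal, this]
  rw [incBeta, intervalIntegral.integral_of_le zero_le_one,
    setIntegral_eq_integral_of_forall_compl_eq_zero hz]
  exact integral_betaPDFReal h0 (by linarith)

lemma monotone_incBeta {θ : ℝ} (h0 : 0 < θ) (h1 : θ < 1) : Monotone (incBeta θ) := by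
  intro v w hvw
  have hi : ∀ x y, IntervalIntegrable (ProbabilityTheory.betaPDFReal θ (1 - θ)) volume x y :=
    fun _ _ => (integrable_betaPDFReal h0 (by linarith)).intervalIntegrable
  have hsub := intervalIntegral.integral_interval_sub_left (hi 0 w) (hi 0 v)
  rw [← sub_nonneg, incBeta, incBeta, hsub]
  exact intervalIntegral.integral_nonneg hvw
    fun s _ => betaPDFReal_nonneg h0 (by linarith) s

lemma hasDerivAt_incBeta {θ : ℝ} (h0 : 0 < θ) (h1 : θ < 1) {v : ℝ} (hv0 : 0 < v) (hv1 : v < 1) :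
    HasDerivAt (incBeta θ) (normConst θ / 2 * v ^ (θ - 1) * (1 - v) ^ (-θ)) v := by
  have hmem : Ioo (0:ℝ) 1 ∈ 𝓝 v := Ioo_mem_nhds hv0 hv1
  have heq : ∀ᶠ x in 𝓝 v, ProbabilityTheory.betaPDFReal θ (1 - θ) x =
      normConst θ / 2 * x ^ (θ - 1) * (1 - x) ^ (-θ) := by
    filter_upwards [hmem] with x hx
    rw [ProbabilityTheory.betaPDFReal, if_pos ⟨hx.1, hx.2⟩, one_div_beta]
    ring_nf
  have hc : ContinuousAt (fun x : ℝ => normConst θ / 2 * x ^ (θ - 1) * (1 - x) ^ (-θ)) v := by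
    refine (continuousAt_const.mul (Real.continuousAt_rpow_const _ _ (Or.inl hv0.ne'))).mul ?_
    exact (continuousAt_const.sub continuousAt_id).rpow_const (Or.inl (by simp; linarith))
  have := intervalIntegral.integral_hasDerivAt_right (a := 0) (b := v)
    (integrable_betaPDFReal h0 (show 0 < 1 - θ by linarith)).intervalIntegrable
    ((ProbabilityTheory.stronglyMeasurable_betaPDFReal θ (1 - θ)).stronglyMeasurableAtFilter)
    (hc.congr_of_eventuallyEq heq)
  rwa [heq.self_of_nhds] at this

/-- The spectral multiplier of the optimal decomposition at time `t`. -/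
def splitFun (θ t a : ℝ) : ℝ := incBeta θ (t ^ 2 * (1 - a) / (a + t ^ 2 * (1 - a)))

/-- The spectral weight of the interpolation space of exponent `θ`. -/
def interpWeight (θ a : ℝ) : ℝ := a ^ (1 - θ) * (1 - a) ^ θ

lemma weight_pos {t a : ℝ} (ht : 0 < t) (ha : a ∈ Icc (0:ℝ) 1) : 0 < a + t ^ 2 * (1 - a) := by
  have h2 : 0 < t ^ 2 := by positivity
  rcases ha.1.eq_or_lt with h | h
  · rw [← h]; simpa using h2
  · have := mul_nonneg h2.le (sub_nonneg.2 ha.2); linarith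

lemma interpWeight_nonneg {θ a : ℝ} (ha : a ∈ Icc (0:ℝ) 1) : 0 ≤ interpWeight θ a :=
  mul_nonneg (Real.rpow_nonneg ha.1 _) (Real.rpow_nonneg (by linarith [ha.2]) _)

lemma continuous_interpWeight {θ : ℝ} (h0 : 0 < θ) (h1 : θ < 1) :
    Continuous (interpWeight θ) := by
  unfold interpWeight
  exact (Real.continuous_rpow_const (by linarith)).mul
    ((continuous_const.sub continuous_id).rpow_const fun _ => Or.inr h0.le)

lemma continuousOn_splitFun {θ : ℝ} (h0 : 0 < θ) (h1 : θ < 1) {t : ℝ} (ht : 0 < t) :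
    ContinuousOn (splitFun θ t) (Icc 0 1) :=
  (continuous_incBeta h0 h1).comp_continuousOn
    (ContinuousOn.div (by fun_prop) (by fun_prop) fun _ ha => (weight_pos ht ha).ne')

lemma splitFun_mem {θ : ℝ} (h0 : 0 < θ) (h1 : θ < 1) {t a : ℝ} (ht : 0 < t)
    (ha : a ∈ Icc (0:ℝ) 1) : splitFun θ t a ∈ Icc (0:ℝ) 1 := by
  have hw := weight_pos ht ha
  have hb : 0 ≤ t ^ 2 * (1 - a) := mul_nonneg (by positivity) (sub_nonneg.2 ha.2)
  refine ⟨?_, ?_⟩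
  · rw [← incBeta_zero θ]
    exact monotone_incBeta h0 h1 (by positivity)
  · rw [← incBeta_one h0 h1]
    exact monotone_incBeta h0 h1 ((div_le_one hw).2 (by linarith [ha.1]))

lemma hasDerivAt_splitFun {θ : ℝ} (h0 : 0 < θ) (h1 : θ < 1) {t a : ℝ} (ht : 0 < t)
    (ha : a ∈ Ioo (0:ℝ) 1) :
    HasDerivAt (fun t => splitFun θ t a)
      (normConst θ * t ^ (2 * θ - 1) * interpWeight θ a / (a + t ^ 2 * (1 - a))) t := by
  have ha0 : 0 < a := ha.1
  have hb0 : 0 < 1 - a := by linarith [ha.2]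
  set b := 1 - a with hb
  have hw : 0 < a + t ^ 2 * b := by positivity
  have hv : HasDerivAt (fun t : ℝ => t ^ 2 * b / (a + t ^ 2 * b))
      (2 * t * a * b / (a + t ^ 2 * b) ^ 2) t := by
    have h2 : HasDerivAt (fun t : ℝ => t ^ 2 * b) (2 * t * b) t := by
      simpa using (hasDerivAt_pow 2 t).mul_const b
    have := h2.div (h2.const_add a) hw.ne'
    refine this.congr_deriv ?_
    field_simp
    ring
  have hv1 : 1 - t ^ 2 * b / (a + t ^ 2 * b) = a / (a + t ^ 2 * b) := by field_simp; ring
  have hv0 : 0 < t ^ 2 * b / (a + t ^ 2 * b) := by positivity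
  have hlt : t ^ 2 * b / (a + t ^ 2 * b) < 1 := (div_lt_one hw).2 (by linarith)
  refine ((hasDerivAt_incBeta h0 h1 hv0 hlt).comp t hv).congr_deriv ?_
  rw [hv1, Real.div_rpow (by positivity) hw.le, Real.div_rpow ha0.le hw.le,
    Real.mul_rpow (by positivity) hb0.le, ← Real.rpow_natCast t 2, ← Real.rpow_mul ht.le,
    interpWeight, ← hb]
  have e1 : t ^ (2 * θ - 1) = t ^ (((2:ℕ):ℝ) * (θ - 1)) * t := by
    rw [← Real.rpow_add_one ht.ne']; congr 1; push_cast; ring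
  have e2 : a ^ (1 - θ) = a ^ (-θ) * a := by
    rw [← Real.rpow_add_one ha0.ne']; congr 1; ring
  have e3 : b ^ θ = b ^ (θ - 1) * b := by
    rw [← Real.rpow_add_one hb0.ne']; congr 1; ring
  have e4 : (a + t ^ 2 * b) ^ (θ - 1) * (a + t ^ 2 * b) ^ (-θ) = (a + t ^ 2 * b)⁻¹ := by
    rw [← Real.rpow_add hw, ← Real.rpow_neg_one]; congr 1; ring
  have e5 : t ^ ((2:ℕ):ℝ) = t ^ 2 := Real.rpow_natCast t 2
  rw [e1, e2, e3, e5]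
  have hp1 := (Real.rpow_pos_of_pos hw (θ - 1)).ne'
  have hp2 := (Real.rpow_pos_of_pos hw (-θ)).ne'
  have e6 : ∀ X Y : ℝ, X / (a + t ^ 2 * b) ^ (θ - 1) * (Y / (a + t ^ 2 * b) ^ (-θ)) =
      X * Y * (a + t ^ 2 * b) := by
    intro X Y
    rw [div_mul_div_comm, e4, div_inv_eq_mul]
  rw [mul_assoc, mul_assoc]
  rw [show ∀ c X Y Z : ℝ, c * (X * (Y * Z)) = c * ((X * Y) * Z) by intros; ring, e6]
  field_simp

lemma splitFun_zero_right {θ : ℝ} (h0 : 0 < θ) (h1 : θ < 1) {t : ℝ} (ht : 0 < t) :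
    splitFun θ t 0 = 1 := by
  have : t ^ 2 ≠ 0 := by positivity
  simp [splitFun, this, incBeta_one h0 h1]

lemma splitFun_one_right (θ t : ℝ) : splitFun θ t 1 = 0 := by
  simp [splitFun, incBeta_zero]

lemma interpWeight_zero_right {θ : ℝ} (h1 : θ < 1) : interpWeight θ 0 = 0 := by
  simp [interpWeight, Real.zero_rpow (show 1 - θ ≠ 0 by linarith)]

lemma interpWeight_one_right {θ : ℝ} (h0 : 0 < θ) : interpWeight θ 1 = 0 := by
  simp [interpWeight, Real.zero_rpow h0.ne']

lemma continuous_splitFun_left {θ : ℝ} (h0 : 0 < θ) (h1 : θ < 1) {a : ℝ}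
    (ha : a ∈ Ioo (0:ℝ) 1) : Continuous fun t => splitFun θ t a := by
  refine (continuous_incBeta h0 h1).comp
    (Continuous.div (by fun_prop) (by fun_prop) fun t => ne_of_gt ?_)
  have := mul_nonneg (sq_nonneg t) (sub_nonneg.2 ha.2.le)
  linarith [ha.1]

lemma splitFun_zero_left (θ a : ℝ) : splitFun θ 0 a = 0 := by
  simp [splitFun, incBeta_zero]

lemma tendsto_splitFun_atTop {θ : ℝ} (h0 : 0 < θ) (h1 : θ < 1) {a : ℝ} (ha : a < 1) :
    Tendsto (fun t => splitFun θ t a) atTop (𝓝 1) := by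
  rw [← incBeta_one h0 h1]
  refine ((continuous_incBeta h0 h1).tendsto 1).comp ?_
  have hb : 0 < 1 - a := by linarith
  have h : Tendsto (fun t : ℝ => (1 - a) / (a / t ^ 2 + (1 - a))) atTop
      (𝓝 ((1 - a) / (0 + (1 - a)))) := by
    refine tendsto_const_nhds.div (Tendsto.add ?_ tendsto_const_nhds) (by simpa using hb.ne')
    exact tendsto_const_nhds.div_atTop (tendsto_pow_atTop two_ne_zero)
  rw [zero_add, div_self hb.ne'] at h
  refine h.congr' ?_
  filter_upwards [eventually_gt_atTop 0] with t ht
  have h2 : t ^ 2 ≠ 0 := by positivity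
  rw [← mul_div_mul_left _ _ h2, mul_add, mul_div_cancel₀ _ h2]

lemma mul_splitFun_sq_le {θ : ℝ} (h0 : 0 < θ) (h1 : θ < 1) {t a : ℝ} (ht : 0 < t)
    (ha : a ∈ Icc (0:ℝ) 1) :
    a * splitFun θ t a ^ 2 ≤ normConst θ / (2 * θ) * t ^ (2 * θ) * interpWeight θ a := by
  have hN := normConst_pos h0 h1
  have hc := splitFun_mem h0 h1 ht ha
  rcases ha.1.eq_or_lt with h | ha0
  · rw [← h, interpWeight_zero_right h1]; simp
  rcases ha.2.eq_or_lt with h | ha1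
  · rw [h, splitFun_one_right, interpWeight_one_right h0]; simp
  have hw := interpWeight_nonneg (θ := θ) ha
  set M := normConst θ * interpWeight θ a / (2 * θ * a) with hM
  have hd : ∀ x : ℝ, 0 < x → HasDerivAt (fun x => splitFun θ x a - M * x ^ (2 * θ))
      (normConst θ * x ^ (2 * θ - 1) * interpWeight θ a / (a + x ^ 2 * (1 - a)) -
        M * (2 * θ * x ^ (2 * θ - 1))) x := fun x hx =>
    (hasDerivAt_splitFun h0 h1 hx ⟨ha0, ha1⟩).sub
      ((Real.hasDerivAt_rpow_const (Or.inl hx.ne')).const_mul M)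
  have hanti : AntitoneOn (fun x => splitFun θ x a - M * x ^ (2 * θ)) (Ici 0) := by
    refine antitoneOn_of_deriv_nonpos (convex_Ici 0) ?_ ?_ ?_
    · exact ((continuous_splitFun_left h0 h1 ⟨ha0, ha1⟩).sub
        (continuous_const.mul (Real.continuous_rpow_const (by positivity)))).continuousOn
    · intro x hx
      rw [interior_Ici] at hx
      exact (hd x hx).differentiableAt.differentiableWithinAt
    · intro x hx
      rw [interior_Ici] at hx
      have hx : 0 < x := hx
      rw [(hd x hx).deriv, sub_nonpos,
        show M * (2 * θ * x ^ (2 * θ - 1)) = normConst θ * x ^ (2 * θ - 1) * interpWeight θ a / a by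
          rw [hM]; field_simp]
      have hp := Real.rpow_nonneg hx.le (2 * θ - 1)
      refine div_le_div_of_nonneg_left (by positivity) ha0 ?_
      have := mul_nonneg (sq_nonneg x) (sub_nonneg.2 ha1.le)
      linarith
  have := hanti self_mem_Ici (mem_Ici.2 ht.le) ht.le
  simp only [splitFun_zero_left, Real.zero_rpow (show 2 * θ ≠ 0 by positivity), mul_zero,
    sub_zero, tsub_le_iff_right, zero_add] at this
  calc a * splitFun θ t a ^ 2 ≤ a * splitFun θ t a := by
        refine mul_le_mul_of_nonneg_left ?_ ha0.le
        nlinarith [hc.1, hc.2]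
    _ ≤ a * (M * t ^ (2 * θ)) := mul_le_mul_of_nonneg_left this ha0.le
    _ = _ := by rw [hM]; field_simp

lemma mul_one_sub_splitFun_sq_le {θ : ℝ} (h0 : 0 < θ) (h1 : θ < 1) {t a : ℝ} (ht : 0 < t)
    (ha : a ∈ Icc (0:ℝ) 1) :
    (1 - a) * (1 - splitFun θ t a) ^ 2 ≤
      normConst θ / (2 - 2 * θ) * t ^ (2 * θ - 2) * interpWeight θ a := by
  have hN := normConst_pos h0 h1
  have hc := splitFun_mem h0 h1 ht ha
  rcases ha.1.eq_or_lt with h | ha0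
  · rw [← h, splitFun_zero_right h0 h1 ht, interpWeight_zero_right h1]; simp
  rcases ha.2.eq_or_lt with h | ha1
  · rw [h, interpWeight_one_right h0]; simp
  have hw := interpWeight_nonneg (θ := θ) ha
  have hb : 0 < 1 - a := by linarith
  have hθ : 0 < 2 - 2 * θ := by linarith
  set M := normConst θ * interpWeight θ a / ((2 - 2 * θ) * (1 - a)) with hM
  have hMθ : M * (2 - 2 * θ) = normConst θ * interpWeight θ a / (1 - a) := by
    rw [hM, div_mul_eq_mul_div, mul_comm (2 - 2 * θ), mul_div_mul_right _ _ hθ.ne']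
  have hd : ∀ x : ℝ, 0 < x → HasDerivAt (fun x => splitFun θ x a + M * x ^ (2 * θ - 2))
      (normConst θ * x ^ (2 * θ - 1) * interpWeight θ a / (a + x ^ 2 * (1 - a)) +
        M * ((2 * θ - 2) * x ^ (2 * θ - 2 - 1))) x := fun x hx =>
    (hasDerivAt_splitFun h0 h1 hx ⟨ha0, ha1⟩).add
      ((Real.hasDerivAt_rpow_const (Or.inl hx.ne')).const_mul M)
  have hanti : AntitoneOn (fun x => splitFun θ x a + M * x ^ (2 * θ - 2)) (Ioi 0) := by
    refine antitoneOn_of_deriv_nonpos (convex_Ioi 0) ?_ ?_ ?_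
    · exact fun x hx => (hd x hx).continuousAt.continuousWithinAt
    · intro x hx
      rw [interior_Ioi] at hx
      exact (hd x hx).differentiableAt.differentiableWithinAt
    · intro x hx
      rw [interior_Ioi] at hx
      have hx : 0 < x := hx
      have hp := Real.rpow_pos_of_pos hx (2 * θ - 1)
      have e : x ^ (2 * θ - 2 - 1) = x ^ (2 * θ - 1) / x ^ 2 := by
        rw [← Real.rpow_natCast, ← Real.rpow_sub hx]; congr 1; push_cast; ring
      rw [(hd x hx).deriv, e,
        show M * ((2 * θ - 2) * (x ^ (2 * θ - 1) / x ^ 2)) =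
          -(normConst θ * x ^ (2 * θ - 1) * interpWeight θ a / (x ^ 2 * (1 - a))) by
          rw [show 2 * θ - 2 = -(2 - 2 * θ) by ring, neg_mul, mul_neg, ← mul_assoc, hMθ]
          field_simp, ← sub_eq_add_neg, sub_nonpos]
      exact div_le_div_of_nonneg_left (by positivity) (by positivity) (by linarith)
  have hlim : Tendsto (fun x => splitFun θ x a + M * x ^ (2 * θ - 2)) atTop (𝓝 (1 + M * 0)) := by
    refine (tendsto_splitFun_atTop h0 h1 ha1).add (tendsto_const_nhds.mul ?_)
    rw [show 2 * θ - 2 = -(2 - 2 * θ) by ring]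
    exact tendsto_rpow_neg_atTop hθ
  have : 1 + M * 0 ≤ splitFun θ t a + M * t ^ (2 * θ - 2) := by
    refine le_of_tendsto hlim ?_
    filter_upwards [eventually_ge_atTop t] with x hx
    exact hanti ht (mem_Ioi.2 (ht.trans_le hx)) hx
  calc (1 - a) * (1 - splitFun θ t a) ^ 2 ≤ (1 - a) * (1 - splitFun θ t a) := by
        refine mul_le_mul_of_nonneg_left ?_ hb.le
        nlinarith [hc.1, hc.2]
    _ ≤ (1 - a) * (M * t ^ (2 * θ - 2)) := mul_le_mul_of_nonneg_left (by linarith) hb.le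
    _ = _ := by rw [hM]; field_simp

lemma splitFun_sub_sq_le {θ : ℝ} (h0 : 0 < θ) (h1 : θ < 1) {s q a : ℝ} (hs : 0 < s) (hq : 1 < q)
    (ha : a ∈ Icc (0:ℝ) 1) :
    s ^ (-2 * θ) * (a + (q * s) ^ 2 * (1 - a)) * (splitFun θ (q * s) a - splitFun θ s a) ^ 2 ≤
      normConst θ * q ^ 4 * Real.log q * interpWeight θ a *
        (splitFun θ (q * s) a - splitFun θ s a) := by
  have hN := normConst_pos h0 h1
  have hq0 : 0 < q := by linarith
  have ht : 0 < q * s := by positivity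
  have hst : s ≤ q * s := le_mul_of_one_le_left hs.le hq.le
  rcases ha.1.eq_or_lt with h | ha0
  · rw [← h, splitFun_zero_right h0 h1 hs, splitFun_zero_right h0 h1 ht]; simp
  rcases ha.2.eq_or_lt with h | ha1
  · rw [h, splitFun_one_right, splitFun_one_right]; simp
  have hw := interpWeight_nonneg (θ := θ) ha
  have hb : 0 < 1 - a := by linarith
  have hsw : 0 < a + s ^ 2 * (1 - a) := weight_pos hs ha
  set M := normConst θ * (q * s) ^ (2 * θ) * interpWeight θ a / (a + s ^ 2 * (1 - a)) with hM
  have hd : ∀ x : ℝ, 0 < x → HasDerivAt (fun x => splitFun θ x a - M * Real.log x)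
      (normConst θ * x ^ (2 * θ - 1) * interpWeight θ a / (a + x ^ 2 * (1 - a)) - M * x⁻¹) x :=
    fun x hx => (hasDerivAt_splitFun h0 h1 hx ⟨ha0, ha1⟩).sub
      ((Real.hasDerivAt_log hx.ne').const_mul M)
  have hanti : AntitoneOn (fun x => splitFun θ x a - M * Real.log x) (Icc s (q * s)) := by
    refine antitoneOn_of_deriv_nonpos (convex_Icc _ _) ?_ ?_ ?_
    · exact fun x hx => (hd x (hs.trans_le hx.1)).continuousAt.continuousWithinAt
    · intro x hx
      rw [interior_Icc] at hx
      exact (hd x (hs.trans hx.1)).differentiableAt.differentiableWithinAt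
    · intro x hx
      rw [interior_Icc] at hx
      have hx0 : 0 < x := hs.trans hx.1
      have e : x ^ (2 * θ - 1) = x ^ (2 * θ) * x⁻¹ := by
        rw [Real.rpow_sub_one hx0.ne', div_eq_mul_inv]
      rw [(hd x hx0).deriv, sub_nonpos, e,
        show normConst θ * (x ^ (2 * θ) * x⁻¹) * interpWeight θ a / (a + x ^ 2 * (1 - a)) =
          normConst θ * x ^ (2 * θ) * interpWeight θ a / (a + x ^ 2 * (1 - a)) * x⁻¹ by
            field_simp, hM]
      have hpow : x ^ (2 * θ) ≤ (q * s) ^ (2 * θ) :=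
        Real.rpow_le_rpow hx0.le hx.2.le (by positivity)
      have hsx : s ^ 2 ≤ x ^ 2 := pow_le_pow_left₀ hs.le hx.1.le 2
      gcongr
  have hmv := hanti (left_mem_Icc.2 hst) (right_mem_Icc.2 hst) hst
  simp only [Real.log_mul hq0.ne' hs.ne'] at hmv
  have hinc : 0 ≤ splitFun θ (q * s) a - splitFun θ s a := by
    have hmono : MonotoneOn (fun x => splitFun θ x a) (Icc s (q * s)) := by
      refine monotoneOn_of_deriv_nonneg (convex_Icc _ _)
        (continuous_splitFun_left h0 h1 ⟨ha0, ha1⟩).continuousOn ?_ ?_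
      · intro x hx
        rw [interior_Icc] at hx
        exact (hasDerivAt_splitFun h0 h1 (hs.trans hx.1)
          ⟨ha0, ha1⟩).differentiableAt.differentiableWithinAt
      · intro x hx
        rw [interior_Icc] at hx
        have hx0 : 0 < x := hs.trans hx.1
        rw [(hasDerivAt_splitFun h0 h1 hx0 ⟨ha0, ha1⟩).deriv]
        have := weight_pos hx0 ha
        have := Real.rpow_nonneg hx0.le (2 * θ - 1)
        positivity
    exact sub_nonneg.2 (hmono (left_mem_Icc.2 hst) (right_mem_Icc.2 hst) hst)
  have hlog : 0 < Real.log q := Real.log_pos hq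
  have hq2 : q ^ (2 * θ) ≤ q ^ 2 := by
    rw [← Real.rpow_natCast]
    exact Real.rpow_le_rpow_of_exponent_le hq.le (by push_cast; linarith)
  have hwle : a + (q * s) ^ 2 * (1 - a) ≤ q ^ 2 * (a + s ^ 2 * (1 - a)) := by
    have : 1 ≤ q ^ 2 := one_le_pow₀ hq.le
    nlinarith
  have hfac : s ^ (-2 * θ) * (a + (q * s) ^ 2 * (1 - a)) * M ≤
      normConst θ * q ^ 4 * interpWeight θ a := by
    have hsp := Real.rpow_pos_of_pos hs (2 * θ)
    have e : s ^ (-2 * θ) = (s ^ (2 * θ))⁻¹ := by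
      rw [← Real.rpow_neg hs.le]; congr 1; ring
    calc s ^ (-2 * θ) * (a + (q * s) ^ 2 * (1 - a)) * M
        ≤ s ^ (-2 * θ) * (q ^ 2 * (a + s ^ 2 * (1 - a))) * M := by
          have := Real.rpow_nonneg ht.le (2 * θ)
          have := Real.rpow_nonneg hs.le (-2 * θ)
          have : 0 ≤ M := by positivity
          gcongr
      _ = normConst θ * (q ^ (2 * θ) * q ^ 2) * interpWeight θ a := by
          rw [hM, e, Real.mul_rpow hq0.le hs.le]; field_simp
      _ ≤ normConst θ * (q ^ 2 * q ^ 2) * interpWeight θ a := by gcongr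
      _ = _ := by ring
  set d := splitFun θ (q * s) a - splitFun θ s a with hdd
  have hdle : d ≤ M * Real.log q := by rw [hdd]; linarith
  have hpre : 0 ≤ s ^ (-2 * θ) * (a + (q * s) ^ 2 * (1 - a)) :=
    mul_nonneg (Real.rpow_nonneg hs.le _) (weight_pos ht ha).le
  calc s ^ (-2 * θ) * (a + (q * s) ^ 2 * (1 - a)) * d ^ 2
      = (s ^ (-2 * θ) * (a + (q * s) ^ 2 * (1 - a))) * d * d := by ring
    _ ≤ (s ^ (-2 * θ) * (a + (q * s) ^ 2 * (1 - a))) * (M * Real.log q) * d := by gcongr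
    _ = (s ^ (-2 * θ) * (a + (q * s) ^ 2 * (1 - a)) * M) * Real.log q * d := by ring
    _ ≤ (normConst θ * q ^ 4 * interpWeight θ a) * Real.log q * d := by gcongr
    _ = _ := by ring

lemma lintegral_interpWeight_sq_div {θ : ℝ} (h0 : 0 < θ) (h1 : θ < 1) {a : ℝ}
    (ha : a ∈ Icc (0:ℝ) 1) :
    ∫⁻ t in Ioi (0:ℝ), ENNReal.ofReal
      (t ^ (2 * θ - 1) * (interpWeight θ a / (a + t ^ 2 * (1 - a)) * interpWeight θ a)) =
      ENNReal.ofReal ((normConst θ)⁻¹ * interpWeight θ a) := by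
  have hN := normConst_pos h0 h1
  rcases ha.1.eq_or_lt with h | ha0
  · rw [← h, interpWeight_zero_right h1]; simp
  rcases ha.2.eq_or_lt with h | ha1
  · rw [h, interpWeight_one_right h0]; simp
  have hw := interpWeight_nonneg (θ := θ) ha
  set M := (normConst θ)⁻¹ * interpWeight θ a with hM
  have hd : ∀ x ∈ Ioi (0:ℝ), HasDerivAt (fun x => M * splitFun θ x a)
      (x ^ (2 * θ - 1) * (interpWeight θ a / (a + x ^ 2 * (1 - a)) * interpWeight θ a)) x := by
    intro x hx
    refine ((hasDerivAt_splitFun h0 h1 hx ⟨ha0, ha1⟩).const_mul M).congr_deriv ?_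
    rw [hM]; field_simp
  have hnn : ∀ x ∈ Ioi (0:ℝ), 0 ≤
      x ^ (2 * θ - 1) * (interpWeight θ a / (a + x ^ 2 * (1 - a)) * interpWeight θ a) := by
    intro x hx
    have := Real.rpow_nonneg (le_of_lt hx) (2 * θ - 1)
    have := weight_pos hx ha
    positivity
  have hc : ContinuousWithinAt (fun x => M * splitFun θ x a) (Ici 0) 0 :=
    (continuous_const.mul (continuous_splitFun_left h0 h1 ⟨ha0, ha1⟩)).continuousWithinAt
  have hlim : Tendsto (fun x => M * splitFun θ x a) atTop (𝓝 (M * 1)) :=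
    tendsto_const_nhds.mul (tendsto_splitFun_atTop h0 h1 ha1)
  rw [← ofReal_integral_eq_lintegral_ofReal
    (integrableOn_Ioi_deriv_of_nonneg hc hd hnn hlim)
    ((ae_restrict_iff' measurableSet_Ioi).2 (Eventually.of_forall hnn)),
    integral_Ioi_of_hasDerivAt_of_nonneg hc hd hnn hlim]
  simp [splitFun_zero_left]

lemma lintegral_kernel {θ : ℝ} (h0 : 0 < θ) (h1 : θ < 1) {a : ℝ} (ha : a ∈ Icc (0:ℝ) 1) :
    ∫⁻ t in Ioi (0:ℝ), ENNReal.ofReal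
      (t ^ (-2 * θ - 1) * (t ^ 2 * (1 - a) / (a + t ^ 2 * (1 - a)) * a)) =
      ENNReal.ofReal ((normConst θ)⁻¹ * interpWeight θ a) := by
  rcases ha.1.eq_or_lt with h | ha0
  · rw [← h, interpWeight_zero_right h1]; simp
  rcases ha.2.eq_or_lt with h | ha1
  · rw [h, interpWeight_one_right h0]; simp
  have hb : 0 < 1 - a := by linarith
  have h0' : 0 < 1 - θ := by linarith
  have h1' : 1 - θ < 1 := by linarith
  have key := lintegral_interpWeight_sq_div h0' h1' ha
  set g := interpWeight (1 - θ) a with hg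
  have hgpos : 0 < g := by
    rw [hg, interpWeight]
    exact mul_pos (Real.rpow_pos_of_pos ha0 _) (Real.rpow_pos_of_pos hb _)
  have hprod : g * interpWeight θ a = a * (1 - a) := by
    rw [hg, interpWeight, interpWeight, mul_mul_mul_comm, ← Real.rpow_add ha0, ← Real.rpow_add hb]
    simp
  have hwt : interpWeight θ a = a * (1 - a) / g := by rw [← hprod]; field_simp
  have e : ∀ t ∈ Ioi (0:ℝ), ENNReal.ofReal
      (t ^ (-2 * θ - 1) * (t ^ 2 * (1 - a) / (a + t ^ 2 * (1 - a)) * a)) =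
      ENNReal.ofReal (a * (1 - a) / g ^ 2) *
        ENNReal.ofReal (t ^ (2 * (1 - θ) - 1) * (g / (a + t ^ 2 * (1 - a)) * g)) := by
    intro t ht
    have ht : 0 < t := ht
    rw [← ENNReal.ofReal_mul (by positivity)]
    congr 1
    rw [show 2 * (1 - θ) - 1 = (-2 * θ - 1) + (2:ℕ) by push_cast; ring, Real.rpow_add_natCast ht.ne']
    have := weight_pos ht ha
    field_simp
  rw [setLIntegral_congr_fun measurableSet_Ioi e, lintegral_const_mul', key,
    ← ENNReal.ofReal_mul (by positivity), normConst_one_sub, hwt]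
  · congr 1; field_simp
  · exact ENNReal.ofReal_ne_top

open ContinuousLinearMap CompactlySupported in
lemma exists_spectral_measure {E : Type*} [NormedAddCommGroup E] [InnerProductSpace ℂ E]
    [CompleteSpace E] (A : E →L[ℂ] E) (hA : IsSelfAdjoint A)
    (hs : spectrum ℝ A ⊆ Icc 0 1) (g : E) :
    ∃ μ : Measure ℝ, IsFiniteMeasure μ ∧ (∀ᵐ a ∂μ, a ∈ Icc (0:ℝ) 1) ∧
      ∀ F : ℝ → ℝ, ContinuousOn F (Icc 0 1) →
        (inner ℂ g (cfc F A g)).re = ∫ a, F a ∂μ := by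
  let L : C(spectrum ℝ A, ℝ) →ₗ[ℝ] ℝ :=
    { toFun := fun f => (inner ℂ g (cfcHom hA f g)).re
      map_add' := fun f h => by simp
      map_smul' := fun c f => by
        rw [map_smul, _root_.smul_apply]
        rw [inner_smul_right_eq_smul]
        simp }
  have hL : ∀ f : C(spectrum ℝ A, ℝ), 0 ≤ f → 0 ≤ L f := by
    intro f hf
    have h1 : 0 ≤ cfcHom hA f := cfcHom_nonneg_iff hA |>.2 hf
    have h2 := ((nonneg_iff_isPositive _).1 h1).inner_nonneg_right g
    exact (Complex.le_def.1 h2).1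
  let Λ : C_c(spectrum ℝ A, ℝ) →ₚ[ℝ] ℝ := PositiveLinearMap.mk₀
    { toFun := fun f => L f.toContinuousMap
      map_add' := fun f h => L.map_add _ _
      map_smul' := fun c f => L.map_smul _ _ }
    (fun f hf => hL _ hf)
  let ν := RealRMK.rieszMeasure Λ
  have hν : IsFiniteMeasure ν := inferInstance
  have hae : ∀ᵐ a ∂(ν.map Subtype.val), a ∈ Icc (0:ℝ) 1 :=
    (ae_map_iff measurable_subtype_coe.aemeasurable (p := fun a => a ∈ Icc (0:ℝ) 1)
      measurableSet_Icc).2 (Eventually.of_forall fun x => hs x.2)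
  refine ⟨ν.map Subtype.val, inferInstance, hae, ?_⟩
  intro F hF
  have hF' : ContinuousOn F (spectrum ℝ A) := hF.mono hs
  rw [cfc_apply F A hA hF']
  have := RealRMK.integral_rieszMeasure Λ
    ⟨⟨_, hF'.domRestrict⟩, HasCompactSupport.of_compactSpace _⟩
  rw [integral_map measurable_subtype_coe.aemeasurable]
  · exact this.symm
  · rw [← Measure.restrict_eq_self_of_ae_mem hae]
    exact hF.aestronglyMeasurable measurableSet_Icc

section

variable {E H0 H1 : Type*} [NormedAddCommGroup E] [InnerProductSpace ℂ E]
  [NormedAddCommGroup H0] [InnerProductSpace ℂ H0] [NormedAddCommGroup H1] [InnerProductSpace ℂ H1]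

lemma re_inner_add_re_inner {p0 : E →L[ℂ] H0} {p1 : E →L[ℂ] H1}
    (H : ∀ x, ‖p0 x‖ ^ 2 + ‖p1 x‖ ^ 2 = ‖x‖ ^ 2) (x y : E) :
    (inner ℂ (p0 x) (p0 y)).re + (inner ℂ (p1 x) (p1 y)).re = (inner ℂ x y).re := by
  have h0 := norm_add_sq (𝕜 := ℂ) (p0 x) (p0 y)
  have h1 := norm_add_sq (𝕜 := ℂ) (p1 x) (p1 y)
  have h := norm_add_sq (𝕜 := ℂ) x y
  have e := H (x + y)
  rw [map_add, map_add] at e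
  simp only [RCLike.re_to_complex] at h0 h1 h
  linarith [H x, H y]

lemma norm_le_of_sq_add {p0 : E →L[ℂ] H0} {p1 : E →L[ℂ] H1}
    (H : ∀ x, ‖p0 x‖ ^ 2 + ‖p1 x‖ ^ 2 = ‖x‖ ^ 2) (x : E) : ‖p0 x‖ ≤ ‖x‖ :=
  le_of_sq_le_sq (by linarith [H x, sq_nonneg ‖p1 x‖]) (norm_nonneg _)

end

/-- The functional calculus of `p† p`. -/
def normalCalc {E H : Type*} [NormedAddCommGroup E] [InnerProductSpace ℂ E] [CompleteSpace E]
    [NormedAddCommGroup H] [InnerProductSpace ℂ H] [CompleteSpace H]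
    (p : E →L[ℂ] H) (F : ℝ → ℝ) : E →L[ℂ] E :=
  cfc F (ContinuousLinearMap.adjoint p ∘L p)

section

variable {E H0 H1 : Type*} [NormedAddCommGroup E] [InnerProductSpace ℂ E] [CompleteSpace E]
  [NormedAddCommGroup H0] [InnerProductSpace ℂ H0] [CompleteSpace H0]
  [NormedAddCommGroup H1] [InnerProductSpace ℂ H1]

lemma isSelfAdjoint_adjoint_comp (p : E →L[ℂ] H0) :
    IsSelfAdjoint (ContinuousLinearMap.adjoint p ∘L p) :=
  (ContinuousLinearMap.isPositive_adjoint_comp_self p).isSelfAdjoint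

lemma spectrum_adjoint_comp_subset {p : E →L[ℂ] H0} (hp : ∀ x, ‖p x‖ ≤ ‖x‖) :
    spectrum ℝ (ContinuousLinearMap.adjoint p ∘L p) ⊆ Icc 0 1 := by
  intro r hr
  have hnt : Nontrivial (E →L[ℂ] E) := by
    by_contra h
    rw [not_nontrivial_iff_subsingleton] at h
    rw [spectrum.of_subsingleton] at hr
    exact hr
  refine ⟨?_, ?_⟩
  · exact spectrum_nonneg_of_nonneg ((ContinuousLinearMap.nonneg_iff_isPositive _).2
      (ContinuousLinearMap.isPositive_adjoint_comp_self p)) hr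
  · have h1 : ‖p‖ ≤ 1 := p.opNorm_le_bound zero_le_one (by simpa using hp)
    have h2 := spectrum.norm_le_norm_mul_of_mem hr
    have h3 : ‖(1 : E →L[ℂ] E)‖ ≤ 1 := ContinuousLinearMap.norm_id_le
    rw [ContinuousLinearMap.norm_adjoint_comp_self] at h2
    have h4 : ‖p‖ * ‖p‖ * ‖(1 : E →L[ℂ] E)‖ ≤ 1 := by
      have := mul_le_mul h1 h1 (norm_nonneg p) zero_le_one
      nlinarith [norm_nonneg (1 : E →L[ℂ] E), norm_nonneg p]
    exact (le_abs_self r).trans (h2.trans h4)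

section Calc

variable {p : E →L[ℂ] H0}

lemma normalCalc_mul (hp : ∀ x, ‖p x‖ ≤ ‖x‖) {F G : ℝ → ℝ} (hF : ContinuousOn F (Icc 0 1))
    (hG : ContinuousOn G (Icc 0 1)) (g : E) :
    normalCalc p (fun a => F a * G a) g = normalCalc p F (normalCalc p G g) := by
  have hs := spectrum_adjoint_comp_subset hp
  rw [normalCalc, cfc_mul F G _ (hF.mono hs) (hG.mono hs)]
  rfl

lemma normalCalc_sub (hp : ∀ x, ‖p x‖ ≤ ‖x‖) {F G : ℝ → ℝ} (hF : ContinuousOn F (Icc 0 1))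
    (hG : ContinuousOn G (Icc 0 1)) (g : E) :
    normalCalc p (fun a => F a - G a) g = normalCalc p F g - normalCalc p G g := by
  have hs := spectrum_adjoint_comp_subset hp
  rw [normalCalc, cfc_sub F G _ (hF.mono hs) (hG.mono hs)]
  rfl

lemma normalCalc_congr (hp : ∀ x, ‖p x‖ ≤ ‖x‖) {F G : ℝ → ℝ}
    (h : EqOn F G (Icc 0 1)) : normalCalc p F = normalCalc p G :=
  cfc_congr (h.mono (spectrum_adjoint_comp_subset hp))

lemma normalCalc_one (p : E →L[ℂ] H0) (g : E) : normalCalc p (fun _ => 1) g = g := by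
  rw [normalCalc, cfc_const_one ℝ _ (isSelfAdjoint_adjoint_comp p)]
  rfl

lemma inner_normalCalc_left (p : E →L[ℂ] H0) (F : ℝ → ℝ) (x y : E) :
    inner ℂ (normalCalc p F x) y = inner ℂ x (normalCalc p F y) := by
  have h : IsSelfAdjoint (normalCalc p F) := cfc_predicate F _
  rw [← ContinuousLinearMap.adjoint_inner_right]
  rw [h.adjoint_eq]

lemma inner_map_normalCalc (hp : ∀ x, ‖p x‖ ≤ ‖x‖) {F : ℝ → ℝ} (hF : ContinuousOn F (Icc 0 1))
    (x g : E) :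
    inner ℂ (p x) (p (normalCalc p F g)) = inner ℂ x (normalCalc p (fun a => a * F a) g) := by
  have h : normalCalc p (fun a => a) = ContinuousLinearMap.adjoint p ∘L p :=
    cfc_id' ℝ _ (isSelfAdjoint_adjoint_comp p)
  rw [normalCalc_mul hp (F := fun a => a) continuousOn_id hF, h]
  simp [ContinuousLinearMap.adjoint_inner_right]

end Calc

lemma re_inner_map_normalCalc {p0 : E →L[ℂ] H0} {p1 : E →L[ℂ] H1}
    (H : ∀ x, ‖p0 x‖ ^ 2 + ‖p1 x‖ ^ 2 = ‖x‖ ^ 2) {F : ℝ → ℝ} (hF : ContinuousOn F (Icc 0 1))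
    (x g : E) :
    (inner ℂ (p1 x) (p1 (normalCalc p0 F g))).re =
      (inner ℂ x (normalCalc p0 (fun a => (1 - a) * F a) g)).re := by
  have hp := norm_le_of_sq_add H
  have h1 := re_inner_add_re_inner H x (normalCalc p0 F g)
  rw [inner_map_normalCalc hp hF] at h1
  have h2 : normalCalc p0 (fun a => (1 - a) * F a) g =
      normalCalc p0 F g - normalCalc p0 (fun a => a * F a) g := by
    rw [← normalCalc_sub hp hF (by fun_prop)]
    congr 2
    ext a
    ring
  rw [h2, inner_sub_right, Complex.sub_re]
  linarith

/-- There is a finite measure on `[0,1]` representing the functional calculus at `g`. -/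
lemma exists_measure_normalCalc {p : E →L[ℂ] H0} (hp : ∀ x, ‖p x‖ ≤ ‖x‖) (g : E) :
    ∃ μ : Measure ℝ, IsFiniteMeasure μ ∧ (∀ᵐ a ∂μ, a ∈ Icc (0:ℝ) 1) ∧
      ∀ F : ℝ → ℝ, ContinuousOn F (Icc 0 1) →
        (inner ℂ g (normalCalc p F g)).re = ∫ a, F a ∂μ :=
  exists_spectral_measure _ (isSelfAdjoint_adjoint_comp p) (spectrum_adjoint_comp_subset hp) g

lemma integrable_of_continuousOn_Icc {μ : Measure ℝ} [IsFiniteMeasure μ]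
    (hμ : ∀ᵐ a ∂μ, a ∈ Icc (0:ℝ) 1) {F : ℝ → ℝ} (hF : ContinuousOn F (Icc 0 1)) :
    Integrable F μ := by
  have := hF.integrableOn_compact isCompact_Icc (μ := μ)
  rwa [IntegrableOn, Measure.restrict_eq_self_of_ae_mem hμ] at this

lemma re_inner_normalCalc_mono {p : E →L[ℂ] H0} (hp : ∀ x, ‖p x‖ ≤ ‖x‖) {F G : ℝ → ℝ}
    (hF : ContinuousOn F (Icc 0 1)) (hG : ContinuousOn G (Icc 0 1))
    (h : ∀ a ∈ Icc (0:ℝ) 1, F a ≤ G a) (g : E) :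
    (inner ℂ g (normalCalc p F g)).re ≤ (inner ℂ g (normalCalc p G g)).re := by
  obtain ⟨μ, _, hμ, hI⟩ := exists_measure_normalCalc hp g
  rw [hI F hF, hI G hG]
  exact integral_mono_ae (integrable_of_continuousOn_Icc hμ hF)
    (integrable_of_continuousOn_Icc hμ hG) (hμ.mono h)

lemma re_inner_normalCalc_const_mul {p : E →L[ℂ] H0} (hp : ∀ x, ‖p x‖ ≤ ‖x‖) {F : ℝ → ℝ}
    (hF : ContinuousOn F (Icc 0 1)) (c : ℝ) (g : E) :
    (inner ℂ g (normalCalc p (fun a => c * F a) g)).re =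
      c * (inner ℂ g (normalCalc p F g)).re := by
  obtain ⟨μ, _, hμ, hI⟩ := exists_measure_normalCalc hp g
  rw [hI F hF, hI _ (by fun_prop), integral_const_mul]

/-- Tonelli for the functional calculus. -/
lemma lintegral_re_inner_normalCalc {p : E →L[ℂ] H0} (hp : ∀ x, ‖p x‖ ≤ ‖x‖)
    {F : ℝ → ℝ → ℝ} {G : ℝ → ℝ} (hm : Measurable (Function.uncurry F))
    (hF : ∀ t, 0 < t → ContinuousOn (F t) (Icc 0 1))
    (hF0 : ∀ t, 0 < t → ∀ a ∈ Icc (0:ℝ) 1, 0 ≤ F t a)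
    (hG : ContinuousOn G (Icc 0 1)) (hG0 : ∀ a ∈ Icc (0:ℝ) 1, 0 ≤ G a)
    (h : ∀ a ∈ Icc (0:ℝ) 1, ∫⁻ t in Ioi (0:ℝ), ENNReal.ofReal (F t a) = ENNReal.ofReal (G a))
    (g : E) :
    ∫⁻ t in Ioi (0:ℝ), ENNReal.ofReal (inner ℂ g (normalCalc p (F t) g)).re =
      ENNReal.ofReal (inner ℂ g (normalCalc p G g)).re := by
  obtain ⟨μ, _, hμ, hI⟩ := exists_measure_normalCalc hp g
  rw [hI G hG, ofReal_integral_eq_lintegral_ofReal (integrable_of_continuousOn_Icc hμ hG)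
    (hμ.mono hG0)]
  calc _ = ∫⁻ t in Ioi (0:ℝ), ∫⁻ a, ENNReal.ofReal (F t a) ∂μ := by
        refine setLIntegral_congr_fun measurableSet_Ioi fun t ht => ?_
        rw [hI _ (hF t ht), ofReal_integral_eq_lintegral_ofReal
          (integrable_of_continuousOn_Icc hμ (hF t ht)) (hμ.mono (hF0 t ht))]
    _ = ∫⁻ a, (∫⁻ t in Ioi (0:ℝ), ENNReal.ofReal (F t a)) ∂μ :=
        lintegral_lintegral_swap hm.ennreal_ofReal.aemeasurable
    _ = _ := lintegral_congr_ae (hμ.mono h)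

lemma norm_map_normalCalc_sq {p : E →L[ℂ] H0} (hp : ∀ x, ‖p x‖ ≤ ‖x‖) {F : ℝ → ℝ}
    (hF : ContinuousOn F (Icc 0 1)) (g : E) :
    ‖p (normalCalc p F g)‖ ^ 2 = (inner ℂ g (normalCalc p (fun a => a * F a ^ 2) g)).re := by
  rw [← inner_self_eq_norm_sq (𝕜 := ℂ), inner_map_normalCalc hp hF, inner_normalCalc_left,
    ← normalCalc_mul hp hF (by fun_prop)]
  simp only [RCLike.re_to_complex]
  congr 5
  ext a
  ring

lemma norm_map_normalCalc_sq' {p0 : E →L[ℂ] H0} {p1 : E →L[ℂ] H1}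
    (H : ∀ x, ‖p0 x‖ ^ 2 + ‖p1 x‖ ^ 2 = ‖x‖ ^ 2) {F : ℝ → ℝ}
    (hF : ContinuousOn F (Icc 0 1)) (g : E) :
    ‖p1 (normalCalc p0 F g)‖ ^ 2 =
      (inner ℂ g (normalCalc p0 (fun a => (1 - a) * F a ^ 2) g)).re := by
  rw [← inner_self_eq_norm_sq (𝕜 := ℂ), RCLike.re_to_complex, re_inner_map_normalCalc H hF,
    inner_normalCalc_left, ← normalCalc_mul (norm_le_of_sq_add H) hF (by fun_prop)]
  congr 5
  ext a
  ring

end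

section

variable {E H0 H1 : Type*} [NormedAddCommGroup E] [InnerProductSpace ℂ E] [CompleteSpace E]
  [NormedAddCommGroup H0] [InnerProductSpace ℂ H0] [CompleteSpace H0]
  [NormedAddCommGroup H1] [InnerProductSpace ℂ H1]

/-- The quadratic form `⟪g, (p†p)^(1-θ) (1 - p†p)^θ g⟫`. -/
def interpForm (θ : ℝ) (p : E →L[ℂ] H0) (g : E) : ℝ :=
  (inner ℂ g (normalCalc p (interpWeight θ) g)).re

/-- The spectral expression for the square of the K-functional. -/
def kForm (p : E →L[ℂ] H0) (t : ℝ) (g : E) : ℝ :=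
  (inner ℂ g (normalCalc p (fun a => t ^ 2 * (1 - a) / (a + t ^ 2 * (1 - a)) * a) g)).re

lemma re_inner_normalCalc_nonneg {p : E →L[ℂ] H0} (hp : ∀ x, ‖p x‖ ≤ ‖x‖) {F : ℝ → ℝ}
    (hF : ContinuousOn F (Icc 0 1)) (h : ∀ a ∈ Icc (0:ℝ) 1, 0 ≤ F a) (g : E) :
    0 ≤ (inner ℂ g (normalCalc p F g)).re := by
  obtain ⟨μ, _, hμ, hI⟩ := exists_measure_normalCalc hp g
  rw [hI F hF]
  exact integral_nonneg_of_ae (hμ.mono h)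

lemma interpForm_nonneg {θ : ℝ} (h0 : 0 < θ) (h1 : θ < 1) {p : E →L[ℂ] H0}
    (hp : ∀ x, ‖p x‖ ≤ ‖x‖) (g : E) : 0 ≤ interpForm θ p g :=
  re_inner_normalCalc_nonneg hp (continuous_interpWeight h0 h1).continuousOn
    (fun _ => interpWeight_nonneg) g

lemma continuousOn_div_weight {t : ℝ} (ht : 0 < t) {F : ℝ → ℝ} (hF : ContinuousOn F (Icc 0 1)) :
    ContinuousOn (fun a => F a / (a + t ^ 2 * (1 - a))) (Icc 0 1) :=
  hF.div (by fun_prop) fun _ ha => (weight_pos ht ha).ne'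

lemma re_inner_map_add {p0 : E →L[ℂ] H0} {p1 : E →L[ℂ] H1}
    (H : ∀ x, ‖p0 x‖ ^ 2 + ‖p1 x‖ ^ 2 = ‖x‖ ^ 2) {t : ℝ} (ht : 0 < t) {F : ℝ → ℝ}
    (hF : ContinuousOn F (Icc 0 1)) (x g : E) :
    (inner ℂ (p0 x) (p0 (normalCalc p0 (fun a => F a / (a + t ^ 2 * (1 - a))) g))).re +
      t ^ 2 * (inner ℂ (p1 x)
        (p1 (normalCalc p0 (fun a => F a / (a + t ^ 2 * (1 - a))) g))).re =
      (inner ℂ x (normalCalc p0 F g)).re := by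
  have hp := norm_le_of_sq_add H
  have hc := continuousOn_div_weight ht hF
  have hd := re_inner_add_re_inner H x
    (normalCalc p0 (fun a => F a / (a + t ^ 2 * (1 - a))) g)
  rw [inner_map_normalCalc hp hc] at hd ⊢
  have e : normalCalc p0 F g = normalCalc p0 (fun a => a * (F a / (a + t ^ 2 * (1 - a)))) g -
      normalCalc p0 (fun a => (-t ^ 2) * ((1 - a) * (F a / (a + t ^ 2 * (1 - a))))) g := by
    rw [← normalCalc_sub hp (by fun_prop) (by fun_prop)]
    congr 1
    apply normalCalc_congr hp
    intro a ha
    have := (weight_pos ht ha).ne'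
    simp only
    field_simp
    ring
  have e2 : normalCalc p0
      (fun a => (-t ^ 2) * ((1 - a) * (F a / (a + t ^ 2 * (1 - a))))) g =
      ((-t ^ 2 : ℝ) : ℂ) • normalCalc p0 (fun a => (1 - a) * (F a / (a + t ^ 2 * (1 - a)))) g := by
    rw [normalCalc, cfc_const_mul _ _ _ ((by fun_prop : ContinuousOn _ (Icc (0:ℝ) 1)).mono
      (spectrum_adjoint_comp_subset hp))]
    rfl
  rw [e, e2, inner_sub_right, inner_smul_right, Complex.sub_re, Complex.re_ofReal_mul,
    re_inner_map_normalCalc H hc]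
  ring

lemma kForm_minimum {p0 : E →L[ℂ] H0} {p1 : E →L[ℂ] H1}
    (H : ∀ x, ‖p0 x‖ ^ 2 + ‖p1 x‖ ^ 2 = ‖x‖ ^ 2) {t : ℝ} (ht : 0 < t) (g : E) :
    ∃ x, ∀ y, ‖p0 (g - (x + y))‖ ^ 2 + t ^ 2 * ‖p1 (x + y)‖ ^ 2 =
      kForm p0 t g + (‖p0 y‖ ^ 2 + t ^ 2 * ‖p1 y‖ ^ 2) := by
  have hp := norm_le_of_sq_add H
  have hid : ContinuousOn (fun a : ℝ => a) (Icc 0 1) := continuousOn_id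
  have hc := continuousOn_div_weight ht hid
  set x := normalCalc p0 (fun a => a / (a + t ^ 2 * (1 - a))) g with hx
  have h1 : ∀ y, (inner ℂ (p0 y) (p0 x)).re + t ^ 2 * (inner ℂ (p1 y) (p1 x)).re =
      (inner ℂ (p0 y) (p0 g)).re := by
    intro y
    rw [re_inner_map_add H ht hid]
    conv_rhs => rw [← normalCalc_one p0 g, inner_map_normalCalc hp (by fun_prop)]
    simp
  have h2 : ‖p0 (g - x)‖ ^ 2 + t ^ 2 * ‖p1 x‖ ^ 2 = kForm p0 t g := by
    have e : g - x = normalCalc p0 (fun a => 1 - a / (a + t ^ 2 * (1 - a))) g := by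
      rw [normalCalc_sub hp (by fun_prop) (by fun_prop), normalCalc_one]
    rw [e, hx, norm_map_normalCalc_sq hp (by fun_prop), norm_map_normalCalc_sq' H (by fun_prop),
      ← re_inner_normalCalc_const_mul hp (by fun_prop)]
    obtain ⟨μ, _, hμ, hI⟩ := exists_measure_normalCalc hp g
    have hk : ContinuousOn (fun a => t ^ 2 * (1 - a) / (a + t ^ 2 * (1 - a)) * a) (Icc 0 1) :=
      (continuousOn_div_weight ht (by fun_prop)).mul hid
    rw [kForm, hI _ (by fun_prop), hI _ (by fun_prop), hI _ hk,
      ← integral_add (integrable_of_continuousOn_Icc hμ (by fun_prop))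
        (integrable_of_continuousOn_Icc hμ (by fun_prop))]
    refine integral_congr_ae (hμ.mono fun a ha => ?_)
    have := (weight_pos ht ha).ne'
    simp only
    field_simp
    ring
  refine ⟨x, fun y => ?_⟩
  have e0 := norm_sub_sq (𝕜 := ℂ) (p0 (g - x)) (p0 y)
  have e1 := norm_add_sq (𝕜 := ℂ) (p1 x) (p1 y)
  rw [← map_sub, sub_sub] at e0
  rw [← map_add] at e1
  have h3 := h1 y
  rw [inner_re_symm (𝕜 := ℂ)] at e0 e1
  have h4 : (inner ℂ (p0 y) (p0 (g - x))).re =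
      (inner ℂ (p0 y) (p0 g)).re - (inner ℂ (p0 y) (p0 x)).re := by
    rw [map_sub, inner_sub_right, Complex.sub_re]
  simp only [RCLike.re_to_complex] at e0 e1
  linear_combination e0 + t ^ 2 * e1 + h2 + 2 * h3 - 2 * h4

lemma kForm_nonneg {p : E →L[ℂ] H0} (hp : ∀ x, ‖p x‖ ≤ ‖x‖) {t : ℝ} (ht : 0 < t) (g : E) :
    0 ≤ kForm p t g :=
  re_inner_normalCalc_nonneg hp ((continuousOn_div_weight ht (by fun_prop)).mul continuousOn_id)
    (fun a ha => mul_nonneg (div_nonneg (mul_nonneg (sq_nonneg t) (sub_nonneg.2 ha.2))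
      (weight_pos ht ha).le) ha.1) g

lemma lintegral_kForm {θ : ℝ} (h0 : 0 < θ) (h1 : θ < 1) {p : E →L[ℂ] H0}
    (hp : ∀ x, ‖p x‖ ≤ ‖x‖) (g : E) :
    ∫⁻ t in Ioi (0:ℝ), ENNReal.ofReal (t ^ (-2 * θ - 1) * kForm p t g) =
      ENNReal.ofReal ((normConst θ)⁻¹ * interpForm θ p g) := by
  have hh := (continuous_interpWeight h0 h1)
  have hk : ∀ t : ℝ, 0 < t →
      ContinuousOn (fun a => t ^ 2 * (1 - a) / (a + t ^ 2 * (1 - a)) * a) (Icc 0 1) :=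
    fun t ht => (continuousOn_div_weight ht (by fun_prop)).mul continuousOn_id
  rw [interpForm, ← re_inner_normalCalc_const_mul hp hh.continuousOn,
    ← lintegral_re_inner_normalCalc hp (F := fun t a =>
      t ^ (-2 * θ - 1) * (t ^ 2 * (1 - a) / (a + t ^ 2 * (1 - a)) * a))]
  · refine setLIntegral_congr_fun measurableSet_Ioi fun t ht => ?_
    rw [re_inner_normalCalc_const_mul hp (hk t ht), kForm]
  · simp only [Function.uncurry_def]
    fun_prop
  · exact fun t ht => continuousOn_const.mul (hk t ht)
  · exact fun t ht a ha => mul_nonneg (Real.rpow_nonneg ht.le _)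
      (mul_nonneg (div_nonneg (mul_nonneg (sq_nonneg t) (sub_nonneg.2 ha.2))
      (weight_pos ht ha).le) ha.1)
  · exact continuousOn_const.mul hh.continuousOn
  · exact fun a ha => mul_nonneg (inv_nonneg.2 (normConst_pos h0 h1).le) (interpWeight_nonneg ha)
  · exact fun a ha => lintegral_kernel h0 h1 ha

lemma two_mul_re_inner_le {F : Type*} [NormedAddCommGroup F] [InnerProductSpace ℂ F] {l : ℝ}
    (hl : 0 < l) (x y : F) : 2 * (inner ℂ x y).re ≤ l * ‖x‖ ^ 2 + l⁻¹ * ‖y‖ ^ 2 := by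
  have h := re_inner_le_norm (𝕜 := ℂ) x y
  have h2 : l * ‖x‖ ^ 2 + l⁻¹ * ‖y‖ ^ 2 - 2 * (‖x‖ * ‖y‖) = l⁻¹ * (l * ‖x‖ - ‖y‖) ^ 2 := by
    field_simp
    ring
  have h3 : 0 ≤ l⁻¹ * (l * ‖x‖ - ‖y‖) ^ 2 := by positivity
  simp only [RCLike.re_to_complex] at h
  linarith

/-- The quadratic form dual to `x ↦ ‖p0 x‖² + t² ‖p1 x‖²` at `(p†p)^(1-θ) (1 - p†p)^θ g`. -/
def dualForm (θ : ℝ) (p : E →L[ℂ] H0) (t : ℝ) (g : E) : ℝ :=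
  (inner ℂ g (normalCalc p
    (fun a => interpWeight θ a / (a + t ^ 2 * (1 - a)) * interpWeight θ a) g)).re

lemma two_mul_re_inner_interpWeight_le {θ : ℝ} (h0 : 0 < θ) (h1 : θ < 1)
    {p0 : E →L[ℂ] H0} {p1 : E →L[ℂ] H1}
    (H : ∀ x, ‖p0 x‖ ^ 2 + ‖p1 x‖ ^ 2 = ‖x‖ ^ 2) {t l : ℝ} (ht : 0 < t) (hl : 0 < l) (g x : E) :
    2 * (inner ℂ x (normalCalc p0 (interpWeight θ) g)).re ≤
      l * (‖p0 x‖ ^ 2 + t ^ 2 * ‖p1 x‖ ^ 2) + l⁻¹ * dualForm θ p0 t g := by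
  have hp := norm_le_of_sq_add H
  have hh := (continuous_interpWeight h0 h1).continuousOn (s := Icc 0 1)
  have hc := continuousOn_div_weight ht hh
  rw [← re_inner_map_add H ht hh]
  set z := normalCalc p0 (fun a => interpWeight θ a / (a + t ^ 2 * (1 - a))) g with hz
  have hd : dualForm θ p0 t g = ‖p0 z‖ ^ 2 + t ^ 2 * ‖p1 z‖ ^ 2 := by
    have e := re_inner_map_add H ht hh z g
    rw [← hz, hz, inner_normalCalc_left, ← normalCalc_mul hp hc hh, ← hz] at e
    rw [dualForm, ← e, ← inner_self_eq_norm_sq (𝕜 := ℂ), ← inner_self_eq_norm_sq (𝕜 := ℂ)]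
    rfl
  have a0 := two_mul_re_inner_le hl (p0 x) (p0 z)
  have a1 := mul_le_mul_of_nonneg_left (two_mul_re_inner_le hl (p1 x) (p1 z)) (sq_nonneg t)
  rw [hd]
  linarith

lemma dualForm_nonneg {θ : ℝ} (h0 : 0 < θ) (h1 : θ < 1) {p : E →L[ℂ] H0}
    (hp : ∀ x, ‖p x‖ ≤ ‖x‖) {t : ℝ} (ht : 0 < t) (g : E) : 0 ≤ dualForm θ p t g :=
  re_inner_normalCalc_nonneg hp
    ((continuousOn_div_weight ht (continuous_interpWeight h0 h1).continuousOn).mul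
      (continuous_interpWeight h0 h1).continuousOn)
    (fun _ ha => mul_nonneg (div_nonneg (interpWeight_nonneg ha) (weight_pos ht ha).le)
      (interpWeight_nonneg ha)) g

lemma lintegral_dualForm {θ : ℝ} (h0 : 0 < θ) (h1 : θ < 1) {p : E →L[ℂ] H0}
    (hp : ∀ x, ‖p x‖ ≤ ‖x‖) (g : E) :
    ∫⁻ t in Ioi (0:ℝ), ENNReal.ofReal (t ^ (2 * θ - 1) * dualForm θ p t g) =
      ENNReal.ofReal ((normConst θ)⁻¹ * interpForm θ p g) := by
  have hh := (continuous_interpWeight h0 h1)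
  have hk : ∀ t : ℝ, 0 < t → ContinuousOn
      (fun a => interpWeight θ a / (a + t ^ 2 * (1 - a)) * interpWeight θ a) (Icc 0 1) :=
    fun t ht => (continuousOn_div_weight ht hh.continuousOn).mul hh.continuousOn
  rw [interpForm, ← re_inner_normalCalc_const_mul hp hh.continuousOn,
    ← lintegral_re_inner_normalCalc hp (F := fun t a =>
      t ^ (2 * θ - 1) * (interpWeight θ a / (a + t ^ 2 * (1 - a)) * interpWeight θ a))]
  · refine setLIntegral_congr_fun measurableSet_Ioi fun t ht => ?_
    rw [re_inner_normalCalc_const_mul hp (hk t ht), dualForm]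
  · have hm := hh.measurable
    simp only [Function.uncurry_def]
    fun_prop
  · exact fun t ht => continuousOn_const.mul (hk t ht)
  · exact fun t ht a ha => mul_nonneg (Real.rpow_nonneg ht.le _)
      (mul_nonneg (div_nonneg (interpWeight_nonneg ha) (weight_pos ht ha).le)
      (interpWeight_nonneg ha))
  · exact continuousOn_const.mul hh.continuousOn
  · exact fun a ha => mul_nonneg (inv_nonneg.2 (normConst_pos h0 h1).le) (interpWeight_nonneg ha)
  · exact fun a ha => lintegral_interpWeight_sq_div h0 h1 ha

lemma norm_map_splitFun_sq_le {θ : ℝ} (h0 : 0 < θ) (h1 : θ < 1) {p : E →L[ℂ] H0}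
    (hp : ∀ x, ‖p x‖ ≤ ‖x‖) {t : ℝ} (ht : 0 < t) (g : E) :
    ‖p (normalCalc p (splitFun θ t) g)‖ ^ 2 ≤
      normConst θ / (2 * θ) * t ^ (2 * θ) * interpForm θ p g := by
  have hh := (continuous_interpWeight h0 h1).continuousOn (s := Icc 0 1)
  have hc := continuousOn_splitFun h0 h1 ht
  rw [norm_map_normalCalc_sq hp hc, interpForm, ← re_inner_normalCalc_const_mul hp hh]
  exact re_inner_normalCalc_mono hp (by fun_prop) (by fun_prop)
    (fun a ha => mul_splitFun_sq_le h0 h1 ht ha) g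

lemma norm_map_sub_splitFun_sq_le {θ : ℝ} (h0 : 0 < θ) (h1 : θ < 1)
    {p0 : E →L[ℂ] H0} {p1 : E →L[ℂ] H1}
    (H : ∀ x, ‖p0 x‖ ^ 2 + ‖p1 x‖ ^ 2 = ‖x‖ ^ 2) {t : ℝ} (ht : 0 < t) (g : E) :
    ‖p1 (g - normalCalc p0 (splitFun θ t) g)‖ ^ 2 ≤
      normConst θ / (2 - 2 * θ) * t ^ (2 * θ - 2) * interpForm θ p0 g := by
  have hp := norm_le_of_sq_add H
  have hh := (continuous_interpWeight h0 h1).continuousOn (s := Icc 0 1)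
  have hc := continuousOn_splitFun h0 h1 ht
  have e : g - normalCalc p0 (splitFun θ t) g = normalCalc p0 (fun a => 1 - splitFun θ t a) g := by
    rw [normalCalc_sub hp (by fun_prop) hc, normalCalc_one]
  rw [e, norm_map_normalCalc_sq' H (by fun_prop), interpForm,
    ← re_inner_normalCalc_const_mul hp hh]
  exact re_inner_normalCalc_mono hp (by fun_prop) (by fun_prop)
    (fun a ha => mul_one_sub_splitFun_sq_le h0 h1 ht ha) g

lemma sum_splitFun_energy_le {θ : ℝ} (h0 : 0 < θ) (h1 : θ < 1)
    {p0 : E →L[ℂ] H0} {p1 : E →L[ℂ] H1}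
    (H : ∀ x, ‖p0 x‖ ^ 2 + ‖p1 x‖ ^ 2 = ‖x‖ ^ 2) {q : ℝ} (hq : 1 < q) (M : ℤ) (n : ℕ) (g : E) :
    ∑ j ∈ Finset.range n, (q ^ (M + j)) ^ (-2 * θ) *
      (‖p0 (normalCalc p0 (splitFun θ (q ^ (M + j + 1))) g -
          normalCalc p0 (splitFun θ (q ^ (M + j))) g)‖ ^ 2 +
        (q ^ (M + j + 1)) ^ 2 * ‖p1 (normalCalc p0 (splitFun θ (q ^ (M + j + 1))) g -
          normalCalc p0 (splitFun θ (q ^ (M + j))) g)‖ ^ 2) ≤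
      normConst θ * q ^ 4 * Real.log q * interpForm θ p0 g := by
  have hp := norm_le_of_sq_add H
  have hq0 : 0 < q := by linarith
  have hh := (continuous_interpWeight h0 h1).continuousOn (s := Icc 0 1)
  have hc : ∀ k : ℤ, ContinuousOn (splitFun θ (q ^ k)) (Icc 0 1) :=
    fun k => continuousOn_splitFun h0 h1 (by positivity)
  obtain ⟨μ, _, hμ, hI⟩ := exists_measure_normalCalc hp g
  have hterm : ∀ j : ℕ, (q ^ (M + j)) ^ (-2 * θ) *
      (‖p0 (normalCalc p0 (splitFun θ (q ^ (M + j + 1))) g -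
          normalCalc p0 (splitFun θ (q ^ (M + j))) g)‖ ^ 2 +
        (q ^ (M + j + 1)) ^ 2 * ‖p1 (normalCalc p0 (splitFun θ (q ^ (M + j + 1))) g -
          normalCalc p0 (splitFun θ (q ^ (M + j))) g)‖ ^ 2) ≤
      ∫ a, (normConst θ * q ^ 4 * Real.log q * interpWeight θ a) *
        (splitFun θ (q ^ (M + j + 1)) a - splitFun θ (q ^ (M + j)) a) ∂μ := by
    intro j
    have hc0 := hc (M + j)
    have hc1 := hc (M + j + 1)
    rw [← normalCalc_sub hp hc1 hc0, norm_map_normalCalc_sq hp (by fun_prop),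
      norm_map_normalCalc_sq' H (by fun_prop), hI _ (by fun_prop), hI _ (by fun_prop),
      ← integral_const_mul, ← integral_add
        (integrable_of_continuousOn_Icc hμ (by fun_prop))
        (integrable_of_continuousOn_Icc hμ (by fun_prop)), ← integral_const_mul]
    refine integral_mono_ae (integrable_of_continuousOn_Icc hμ (by fun_prop))
      (integrable_of_continuousOn_Icc hμ (by fun_prop)) (hμ.mono fun a ha => ?_)
    have h := splitFun_sub_sq_le (s := q ^ (M + j)) h0 h1 (by positivity) hq ha
    rw [← zpow_one_add₀ hq0.ne', add_comm 1 (M + (j:ℤ))] at h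
    refine le_trans (le_of_eq ?_) h
    simp only
    ring
  refine (Finset.sum_le_sum fun j _ => hterm j).trans ?_
  rw [interpForm, hI _ hh, ← integral_const_mul, ← integral_finsetSum]
  · refine integral_mono_ae ?_ (integrable_of_continuousOn_Icc hμ (by fun_prop))
      (hμ.mono fun a ha => ?_)
    · refine integrable_finsetSum _ fun j _ => integrable_of_continuousOn_Icc hμ ?_
      have hc0 := hc (M + j)
      have hc1 := hc (M + j + 1)
      fun_prop
    · simp only
      rw [← Finset.mul_sum]
      have ht := Finset.sum_range_sub (fun j : ℕ => splitFun θ (q ^ (M + j)) a) n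
      push_cast at ht
      simp only [add_assoc] at ht ⊢
      rw [ht]
      have c1 := (splitFun_mem h0 h1 (t := q ^ (M + n)) (by positivity) ha).2
      have c0 := (splitFun_mem h0 h1 (t := q ^ (M + 0)) (by positivity) ha).1
      refine mul_le_of_le_one_right ?_ (by linarith)
      have := (normConst_pos h0 h1).le
      have := interpWeight_nonneg (θ := θ) ha
      have := Real.log_pos hq
      positivity
  · intro j _
    have hc0 := hc (M + j)
    have hc1 := hc (M + j + 1)
    exact integrable_of_continuousOn_Icc hμ (by fun_prop)

end

/-- `thetaNormE` for exponent two, squared. -/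
lemma thetaNormE_two_sq (θ : ℝ) (F : ℝ → ℝ≥0∞) :
    thetaNormE θ 2 F ^ 2 = ∫⁻ t in Ioi (0:ℝ), ENNReal.ofReal (t ^ (-2 * θ - 1)) * F t ^ 2 := by
  have h2 : (2 : ℝ≥0∞) ≠ ⊤ := by simp
  rw [thetaNormE, if_neg h2, ← ENNReal.rpow_natCast, ← ENNReal.rpow_mul, logMeasure,
    lintegral_withDensity_eq_lintegral_mul_non_measurable₀ _ (by fun_prop)
      (Eventually.of_forall fun _ => ENNReal.ofReal_lt_top)]
  simp only [ENNReal.toReal_ofNat, Nat.cast_ofNat]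
  norm_num
  refine setLIntegral_congr_fun measurableSet_Ioi fun t (ht : 0 < t) => ?_
  simp only [mul_pow]
  rw [← mul_assoc, ← ENNReal.ofReal_pow (by positivity), ← ENNReal.ofReal_mul (by positivity)]
  congr 2
  rw [← Real.rpow_neg_one, ← Real.rpow_natCast, ← Real.rpow_mul ht.le, ← Real.rpow_add ht]
  congr 1
  push_cast
  ring

lemma sqrt_sq_add_le {t a b c d e f : ℝ} (ha : 0 ≤ a) (hb : 0 ≤ b) (h1 : a ≤ c + e)
    (h2 : b ≤ d + f) :
    √(a ^ 2 + t ^ 2 * b ^ 2) ≤ √(c ^ 2 + t ^ 2 * d ^ 2) + √(e ^ 2 + t ^ 2 * f ^ 2) := by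
  have key := norm_add_le (⟨c, t * d⟩ : ℂ) ⟨e, t * f⟩
  rw [Complex.norm_eq_sqrt_sq_add_sq, Complex.norm_eq_sqrt_sq_add_sq,
    Complex.norm_eq_sqrt_sq_add_sq] at key
  simp only [Complex.add_re, Complex.add_im] at key
  simp only [mul_pow] at key
  refine le_trans (Real.sqrt_le_sqrt ?_) key
  have h3 : (t * d + t * f) ^ 2 = t ^ 2 * (d + f) ^ 2 := by ring
  rw [h3]
  gcongr

namespace CompatiblePair

section

variable {V X0 X1 : Type*} [AddCommGroup V] [Module ℂ V]
  [NormedAddCommGroup X0] [NormedSpace ℂ X0] [CompleteSpace X0]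
  [NormedAddCommGroup X1] [NormedSpace ℂ X1] [CompleteSpace X1]
  (P : CompatiblePair V X0 X1)

lemma KfunE_le {x : V} {a : X0} {b : X1} (h : P.j0 a + P.j1 b = x) (t : ℝ) :
    P.KfunE t x ≤ ENNReal.ofReal (√(‖a‖ ^ 2 + t ^ 2 * ‖b‖ ^ 2)) :=
  sInf_le ⟨a, b, h, rfl⟩

lemma le_KfunE {x : V} {t : ℝ} {c : ℝ≥0∞} (h : ∀ a b, P.j0 a + P.j1 b = x →
    c ≤ ENNReal.ofReal (√(‖a‖ ^ 2 + t ^ 2 * ‖b‖ ^ 2))) : c ≤ P.KfunE t x := by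
  refine le_sInf ?_
  rintro _ ⟨a, b, hab, rfl⟩
  exact h a b hab

lemma exists_of_KfunE_lt {x : V} {t : ℝ} {c : ℝ≥0∞} (h : P.KfunE t x < c) :
    ∃ a b, P.j0 a + P.j1 b = x ∧ ENNReal.ofReal (√(‖a‖ ^ 2 + t ^ 2 * ‖b‖ ^ 2)) < c := by
  obtain ⟨_, ⟨a, b, hab, rfl⟩, hc⟩ := sInf_lt_iff.1 h
  exact ⟨a, b, hab, hc⟩

lemma KfunE_sq_le {x : V} {a : X0} {b : X1} (h : P.j0 a + P.j1 b = x) (t : ℝ) :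
    P.KfunE t x ^ 2 ≤ ENNReal.ofReal (‖a‖ ^ 2 + t ^ 2 * ‖b‖ ^ 2) := by
  refine (pow_le_pow_left' (P.KfunE_le h t) 2).trans (le_of_eq ?_)
  rw [← ENNReal.ofReal_pow (by positivity), Real.sq_sqrt (by positivity)]

lemma le_KfunE_sq {x : V} {t : ℝ} {c : ℝ} (hc : 0 ≤ c) (h : ∀ a b, P.j0 a + P.j1 b = x →
    c ≤ ‖a‖ ^ 2 + t ^ 2 * ‖b‖ ^ 2) : ENNReal.ofReal c ≤ P.KfunE t x ^ 2 := by
  have : ENNReal.ofReal (√c) ≤ P.KfunE t x :=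
    P.le_KfunE fun a b hab => ENNReal.ofReal_le_ofReal (Real.sqrt_le_sqrt (h a b hab))
  refine le_trans (le_of_eq ?_) (pow_le_pow_left' this 2)
  rw [← ENNReal.ofReal_pow (by positivity), Real.sq_sqrt hc]

lemma KfunE_add_le (t : ℝ) (x y : V) : P.KfunE t (x + y) ≤ P.KfunE t x + P.KfunE t y := by
  refine ENNReal.le_of_forall_pos_le_add fun ε hε hlt => ?_
  have hε' : (0 : ℝ≥0∞) < ε / 2 := by
    simpa using hε.ne'
  have hx : P.KfunE t x < P.KfunE t x + ε / 2 :=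
    ENNReal.lt_add_right (ne_top_of_le_ne_top hlt.ne le_self_add) hε'.ne'
  have hy : P.KfunE t y < P.KfunE t y + ε / 2 :=
    ENNReal.lt_add_right (ne_top_of_le_ne_top hlt.ne le_add_self) hε'.ne'
  obtain ⟨a, b, hab, h1⟩ := P.exists_of_KfunE_lt hx
  obtain ⟨a', b', hab', h1'⟩ := P.exists_of_KfunE_lt hy
  have hs : P.j0 (a + a') + P.j1 (b + b') = x + y := by
    rw [map_add, map_add, ← hab, ← hab']
    abel
  calc P.KfunE t (x + y) ≤ _ := P.KfunE_le hs t
    _ ≤ ENNReal.ofReal (√(‖a‖ ^ 2 + t ^ 2 * ‖b‖ ^ 2) + √(‖a'‖ ^ 2 + t ^ 2 * ‖b'‖ ^ 2)) :=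
        ENNReal.ofReal_le_ofReal (sqrt_sq_add_le (norm_nonneg _) (norm_nonneg _)
          (norm_add_le _ _) (norm_add_le _ _))
    _ = _ := ENNReal.ofReal_add (Real.sqrt_nonneg _) (Real.sqrt_nonneg _)
    _ ≤ (P.KfunE t x + ε / 2) + (P.KfunE t y + ε / 2) := add_le_add h1.le h1'.le
    _ = P.KfunE t x + P.KfunE t y + (ε / 2 + ε / 2) := by ring
    _ = _ := by rw [ENNReal.add_halves]

lemma KfunE_neg (t : ℝ) (x : V) : P.KfunE t (-x) = P.KfunE t x := by
  have h : ∀ x, P.KfunE t (-x) ≤ P.KfunE t x := fun x => P.le_KfunE fun a b hab => by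
    have := P.KfunE_le (x := -x) (a := -a) (b := -b) (by rw [map_neg, map_neg, ← hab]; abel) t
    simpa using this
  exact le_antisymm (h x) (by simpa using h (-x))

lemma KfunE_sub_le (t : ℝ) (x y : V) : P.KfunE t (x - y) ≤ P.KfunE t x + P.KfunE t y := by
  rw [sub_eq_add_neg]
  exact (P.KfunE_add_le t x (-y)).trans (by rw [KfunE_neg])

lemma KfunE_mono {s t : ℝ} (hs : 0 ≤ s) (hst : s ≤ t) (x : V) : P.KfunE s x ≤ P.KfunE t x :=
  P.le_KfunE fun a b hab => (P.KfunE_le hab s).trans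
    (ENNReal.ofReal_le_ofReal (Real.sqrt_le_sqrt (by gcongr)))

lemma KfunE_le_div_mul {s t : ℝ} (hs : 0 < s) (hst : s ≤ t) (x : V) :
    P.KfunE t x ≤ ENNReal.ofReal (t / s) * P.KfunE s x := by
  have hr : 0 < t / s := by have := hs.trans_le hst; positivity
  rw [mul_comm, ← ENNReal.div_le_iff (by simpa using hr) (by simp)]
  refine P.le_KfunE fun a b hab => ?_
  rw [ENNReal.div_le_iff (by simpa using hr) (by simp), ← ENNReal.ofReal_mul (by positivity)]
  refine (P.KfunE_le hab t).trans (ENNReal.ofReal_le_ofReal ?_)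
  rw [Real.sqrt_le_left (by positivity), mul_pow, Real.sq_sqrt (by positivity)]
  have h1 : 1 ≤ (t / s) ^ 2 := one_le_pow₀ ((one_le_div hs).2 hst)
  have h2 : (t / s) ^ 2 * s ^ 2 = t ^ 2 := by field_simp
  calc ‖a‖ ^ 2 + t ^ 2 * ‖b‖ ^ 2 ≤ (t / s) ^ 2 * ‖a‖ ^ 2 + t ^ 2 * ‖b‖ ^ 2 := by
        gcongr
        exact le_mul_of_one_le_left (sq_nonneg _) h1
    _ = _ := by rw [← h2]; ring

lemma KfunE_j0_le (t : ℝ) (a : X0) : P.KfunE t (P.j0 a) ≤ ENNReal.ofReal ‖a‖ := by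
  simpa using P.KfunE_le (x := P.j0 a) (a := a) (b := 0) (by simp) t

lemma KfunE_j1_le {t : ℝ} (ht : 0 ≤ t) (b : X1) :
    P.KfunE t (P.j1 b) ≤ ENNReal.ofReal (t * ‖b‖) := by
  have := P.KfunE_le (x := P.j1 b) (a := 0) (b := b) (by simp) t
  rwa [norm_zero, zero_pow two_ne_zero, zero_add, ← mul_pow, Real.sqrt_sq (by positivity)] at this

lemma KfunE_le_mul_normSigmaE {t : ℝ} (ht : 0 ≤ t) (x : V) :
    P.KfunE t x ≤ ENNReal.ofReal (max 1 t) * P.normSigmaE x := by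
  have hr : 0 < max 1 t := lt_max_of_lt_left one_pos
  rw [mul_comm, ← ENNReal.div_le_iff (by simp) (by simp)]
  refine le_sInf ?_
  rintro _ ⟨a, b, hab, rfl⟩
  rw [ENNReal.div_le_iff (by simp) (by simp), ← ENNReal.ofReal_mul (by positivity)]
  refine (P.KfunE_le hab t).trans (ENNReal.ofReal_le_ofReal ?_)
  rw [Real.sqrt_le_left (by positivity)]
  have h1 : (1:ℝ) ≤ max 1 t := le_max_left _ _
  have h2 : t ≤ max 1 t := le_max_right _ _
  have := norm_nonneg a
  have := norm_nonneg b
  calc ‖a‖ ^ 2 + t ^ 2 * ‖b‖ ^ 2 ≤ max 1 t ^ 2 * ‖a‖ ^ 2 + max 1 t ^ 2 * ‖b‖ ^ 2 := by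
        gcongr
        exact le_mul_of_one_le_left (sq_nonneg _) (one_le_pow₀ h1)
    _ ≤ ((‖a‖ + ‖b‖) * max 1 t) ^ 2 := by
        rw [← sub_nonneg]
        have : 0 ≤ 2 * max 1 t ^ 2 * ‖a‖ * ‖b‖ := by positivity
        linarith

lemma normSigmaE_le {x : V} {a : X0} {b : X1} (h : P.j0 a + P.j1 b = x) :
    P.normSigmaE x ≤ ENNReal.ofReal (‖a‖ + ‖b‖) := sInf_le ⟨a, b, h, rfl⟩

lemma aemeasurable_KfunE (x : V) :
    AEMeasurable (fun t => P.KfunE t x) (volume.restrict (Ioi 0)) :=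
  aemeasurable_restrict_of_monotoneOn measurableSet_Ioi
    fun _ hs _ _ hst => P.KfunE_mono (le_of_lt hs) hst x

lemma KfunE_lt_top_of_mem {x : V} (hx : x ∈ P.sigmaSet) (t : ℝ) : P.KfunE t x < ⊤ := by
  obtain ⟨a, b, hab⟩ := hx
  exact (P.KfunE_le hab t).trans_lt ENNReal.ofReal_lt_top

/-- The square of the unnormalised K-norm. -/
def kSq (θ : ℝ) (x : V) : ℝ≥0∞ :=
  ∫⁻ t in Ioi (0:ℝ), ENNReal.ofReal (t ^ (-2 * θ - 1)) * P.KfunE t x ^ 2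

lemma KquasinormE_two_sq (θ : ℝ) (x : V) : P.KquasinormE θ 2 x ^ 2 = P.kSq θ x :=
  thetaNormE_two_sq θ _

/-- The growth bound `K(t,x) ≤ C t^θ`, squared. -/
lemma KfunE_sq_le_rpow {θ : ℝ} (h0 : 0 < θ) {t : ℝ} (ht : 0 < t) (x : V) :
    P.KfunE t x ^ 2 ≤ ENNReal.ofReal (2 ^ (2 * θ + 1) * t ^ (2 * θ)) * P.kSq θ x := by
  have h1 : ENNReal.ofReal ((2 ^ (2 * θ + 1) * t ^ (2 * θ))⁻¹) * P.KfunE t x ^ 2 ≤ P.kSq θ x := by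
    calc _ = ∫⁻ s in Ioo t (2 * t), ENNReal.ofReal ((2 * t) ^ (-2 * θ - 1)) * P.KfunE t x ^ 2 := by
          rw [setLIntegral_const, Real.volume_Ioo, mul_right_comm,
            ← ENNReal.ofReal_mul (by positivity)]
          congr 2
          have e : (2 * t) ^ (-2 * θ - 1) = (2 * t) ^ (-(2 * θ + 1)) := by ring_nf
          rw [e, Real.rpow_neg (by positivity), Real.mul_rpow (by positivity) ht.le,
            Real.rpow_add_one ht.ne' (2 * θ)]
          field_simp
          ring
      _ ≤ ∫⁻ s in Ioo t (2 * t), ENNReal.ofReal (s ^ (-2 * θ - 1)) * P.KfunE s x ^ 2 := by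
          refine setLIntegral_mono' measurableSet_Ioo fun s hs => ?_
          have hs0 : 0 < s := ht.trans hs.1
          refine mul_le_mul' (ENNReal.ofReal_le_ofReal ?_)
            (pow_le_pow_left' (P.KfunE_mono ht.le hs.1.le x) 2)
          exact Real.rpow_le_rpow_of_nonpos hs0 hs.2.le (by linarith)
      _ ≤ _ := lintegral_mono_set fun s hs => ht.trans hs.1
  have hpos : 0 < 2 ^ (2 * θ + 1) * t ^ (2 * θ) := by positivity
  calc P.KfunE t x ^ 2 = ENNReal.ofReal (2 ^ (2 * θ + 1) * t ^ (2 * θ)) *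
        (ENNReal.ofReal ((2 ^ (2 * θ + 1) * t ^ (2 * θ))⁻¹) * P.KfunE t x ^ 2) := by
        rw [← mul_assoc, ← ENNReal.ofReal_mul hpos.le, mul_inv_cancel₀ hpos.ne']
        simp
    _ ≤ _ := by gcongr

end

end CompatiblePair

lemma ofReal_integral_le_lintegral {α : Type*} [MeasurableSpace α] {μ : Measure α} {g : α → ℝ}
    (hg : Integrable g μ) : ENNReal.ofReal (∫ x, g x ∂μ) ≤ ∫⁻ x, ENNReal.ofReal (g x) ∂μ := by
  have h1 : ∫ x, g x ∂μ ≤ ∫ x, max (g x) 0 ∂μ :=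
    integral_mono hg hg.pos_part fun x => le_max_left _ _
  refine (ENNReal.ofReal_le_ofReal h1).trans (le_of_eq ?_)
  rw [ofReal_integral_eq_lintegral_ofReal hg.pos_part
    (Eventually.of_forall fun x => le_max_right _ _)]
  simp

namespace CompatiblePair

lemma Jfun_sq {X0 X1 : Type*} [NormedAddCommGroup X0] [NormedAddCommGroup X1] (t : ℝ)
    (p : X0 × X1) : Jfun t p ^ 2 = ‖p.1‖ ^ 2 + t ^ 2 * ‖p.2‖ ^ 2 :=
  Real.sq_sqrt (by positivity)

/-- A Hilbert space completion of `Δ` for the norm `(‖·‖₀² + ‖·‖₁²)^{1/2}`, together with the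
extensions of the two embeddings. -/
structure DeltaCompletion {V H0 H1 : Type*} [AddCommGroup V] [Module ℂ V]
    [NormedAddCommGroup H0] [InnerProductSpace ℂ H0] [CompleteSpace H0]
    [NormedAddCommGroup H1] [InnerProductSpace ℂ H1] [CompleteSpace H1]
    (P : CompatiblePair V H0 H1) (E : Type*) [NormedAddCommGroup E] [InnerProductSpace ℂ E] where
  p0 : E →L[ℂ] H0
  p1 : E →L[ℂ] H1
  incl : P.deltaSub →L[ℂ] E
  norm_sq : ∀ x, ‖p0 x‖ ^ 2 + ‖p1 x‖ ^ 2 = ‖x‖ ^ 2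
  p0_incl : ∀ f, p0 (incl f) = (f : H0 × H1).1
  p1_incl : ∀ f, p1 (incl f) = (f : H0 × H1).2
  dense : DenseRange incl

section

variable {V H0 H1 : Type*} [AddCommGroup V] [Module ℂ V]
    [NormedAddCommGroup H0] [InnerProductSpace ℂ H0] [CompleteSpace H0]
    [NormedAddCommGroup H1] [InnerProductSpace ℂ H1] [CompleteSpace H1]
    {P : CompatiblePair V H0 H1} {E : Type*} [NormedAddCommGroup E] [InnerProductSpace ℂ E]

lemma DeltaCompletion.norm_p0_le (D : P.DeltaCompletion E) (x : E) : ‖D.p0 x‖ ≤ ‖x‖ :=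
  norm_le_of_sq_add D.norm_sq x

lemma DeltaCompletion.norm_p1_le (D : P.DeltaCompletion E) (x : E) : ‖D.p1 x‖ ≤ ‖x‖ :=
  le_of_sq_le_sq (by linarith [D.norm_sq x, sq_nonneg ‖D.p0 x‖]) (norm_nonneg _)

/-- The K-functional on the completion of `Δ`. -/
lemma DeltaCompletion.KfunE_sq [CompleteSpace E] (D : P.DeltaCompletion E) {t : ℝ} (ht : 0 < t)
    (g : E) : P.KfunE t (P.j0 (D.p0 g)) ^ 2 = ENNReal.ofReal (kForm D.p0 t g) := by
  obtain ⟨x, hx⟩ := kForm_minimum D.norm_sq ht g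
  have hk := kForm_nonneg (D.norm_p0_le) ht g
  apply le_antisymm
  · refine ENNReal.le_of_forall_pos_le_add fun ε hε _ => ?_
    have hc : 0 < ε / (1 + t ^ 2) := by positivity
    obtain ⟨d, hd⟩ := D.dense.exists_dist_lt x (Real.sqrt_pos.2 hc)
    have hdec : P.j0 (D.p0 (g - D.incl d)) + P.j1 (D.p1 (D.incl d)) = P.j0 (D.p0 g) := by
      have := d.2
      simp only [deltaSub] at this
      change P.j0 (d : H0 × H1).1 = P.j1 (d : H0 × H1).2 at this
      rw [D.p1_incl, ← this, map_sub, map_sub, D.p0_incl]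
      abel
    refine (P.KfunE_sq_le hdec t).trans ?_
    have e := hx (D.incl d - x)
    rw [add_sub_cancel] at e
    rw [e, ← ENNReal.ofReal_coe_nnreal, ← ENNReal.ofReal_add hk (by positivity)]
    apply ENNReal.ofReal_le_ofReal
    gcongr
    rw [dist_comm, dist_eq_norm] at hd
    have h1 : ‖D.incl d - x‖ ^ 2 ≤ ε / (1 + t ^ 2) := by
      rw [← Real.sq_sqrt hc.le]
      gcongr
    have h0 := D.norm_sq (D.incl d - x)
    have := sq_nonneg ‖D.p0 (D.incl d - x)‖
    rw [le_div_iff₀ (by positivity)] at h1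
    nlinarith [sq_nonneg ‖D.p1 (D.incl d - x)‖, sq_nonneg t, mul_nonneg (sq_nonneg t) this]
  · refine P.le_KfunE_sq hk fun a b hab => ?_
    have hmem : (D.p0 g - a, b) ∈ P.deltaSub := by
      change P.j0 (D.p0 g - a) = P.j1 b
      rw [map_sub, ← hab]
      abel
    have e := hx (D.incl ⟨_, hmem⟩ - x)
    rw [add_sub_cancel, D.p1_incl, map_sub, D.p0_incl] at e
    simp only [sub_sub_cancel] at e
    rw [e]
    have : 0 ≤ ‖D.p0 (D.incl ⟨_, hmem⟩ - x)‖ ^ 2 + t ^ 2 * ‖D.p1 (D.incl ⟨_, hmem⟩ - x)‖ ^ 2 := by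
      positivity
    linarith

lemma DeltaCompletion.kSq_eq [CompleteSpace E] (D : P.DeltaCompletion E) {θ : ℝ} (h0 : 0 < θ)
    (h1 : θ < 1) (g : E) :
    P.kSq θ (P.j0 (D.p0 g)) = ENNReal.ofReal ((normConst θ)⁻¹ * interpForm θ D.p0 g) := by
  rw [← lintegral_kForm h0 h1 D.norm_p0_le, kSq]
  refine setLIntegral_congr_fun measurableSet_Ioi fun t (ht : 0 < t) => ?_
  rw [D.KfunE_sq ht, ENNReal.ofReal_mul (by positivity)]

/-- The square of the J-functional norm of a function. -/
def jSq (θ : ℝ) (f : ℝ → P.deltaSub) : ℝ≥0∞ :=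
  ∫⁻ t in Ioi (0:ℝ), ENNReal.ofReal (t ^ (-2 * θ - 1) * Jfun t (f t : H0 × H1) ^ 2)

lemma thetaNormE_Jfun_sq (θ : ℝ) (f : ℝ → P.deltaSub) :
    thetaNormE θ 2 (fun t => ENNReal.ofReal (Jfun t (f t : H0 × H1))) ^ 2 = jSq θ f := by
  rw [thetaNormE_two_sq, jSq]
  refine setLIntegral_congr_fun measurableSet_Ioi fun t (ht : 0 < t) => ?_
  rw [← ENNReal.ofReal_pow (show 0 ≤ Jfun t (f t : H0 × H1) from Real.sqrt_nonneg _),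
    ENNReal.ofReal_mul (by positivity)]

lemma DeltaCompletion.integrableOn [CompleteSpace E] (D : P.DeltaCompletion E)
    {f : ℝ → P.deltaSub} {φ : V} (hf : P.IsJRep φ f) {α β : ℝ} (hα : 0 < α) (hαβ : α < β) :
    IntegrableOn (fun t => t⁻¹ • D.incl (f t)) (Ioo α β) := by
  have hsub : Ioo α β ⊆ Ioi 0 := fun t ht => hα.trans ht.1
  have hm : AEStronglyMeasurable f (volume.restrict (Ioo α β)) :=
    hf.meas.mono_measure (Measure.restrict_mono hsub le_rfl)
  refine ((hf.locInt α β hα hαβ).const_mul ‖D.incl‖).mono' ?_ ?_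
  · exact (measurable_inv.aestronglyMeasurable).smul
      (D.incl.continuous.comp_aestronglyMeasurable hm)
  · refine (ae_restrict_iff' measurableSet_Ioo).2 (Eventually.of_forall fun t ht => ?_)
    have ht0 : 0 < t := hsub ht
    rw [norm_smul, norm_inv, Real.norm_of_nonneg ht0.le]
    calc t⁻¹ * ‖D.incl (f t)‖ ≤ t⁻¹ * (‖D.incl‖ * ‖f t‖) := by
          gcongr
          exact D.incl.le_opNorm _
      _ = _ := by ring

/-- The interpolation form of a truncated J-integral is bounded by the J-norm. -/
lemma DeltaCompletion.interpForm_integral_le [CompleteSpace E] (D : P.DeltaCompletion E)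
    {θ : ℝ} (h0 : 0 < θ) (h1 : θ < 1)
    {f : ℝ → P.deltaSub} {φ : V} (hf : P.IsJRep φ f) {α β : ℝ} (hα : 0 < α) (hαβ : α < β) :
    ENNReal.ofReal (interpForm θ D.p0 (∫ t in Ioo α β, t⁻¹ • D.incl (f t))) ≤
      ENNReal.ofReal (normConst θ)⁻¹ * jSq θ f := by
  have hν := normConst_pos h0 h1
  have hint := D.integrableOn hf hα hαβ
  have hsub : Ioo α β ⊆ Ioi 0 := fun t ht => hα.trans ht.1
  set ψ := ∫ t in Ioo α β, t⁻¹ • D.incl (f t) with hψ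
  set z := normalCalc D.p0 (interpWeight θ) ψ with hz
  have e1 : interpForm θ D.p0 ψ = ∫ t in Ioo α β, (inner ℂ (t⁻¹ • D.incl (f t)) z).re := by
    have h2 := integral_inner (𝕜 := ℂ) hint z
    have h3 := integral_re (𝕜 := ℂ) (hint.const_inner z)
    rw [h2, ← hψ] at h3
    have h4 : interpForm θ D.p0 ψ = (inner ℂ z ψ).re := by
      rw [interpForm, ← hz]
      exact inner_re_symm (𝕜 := ℂ) _ _
    rw [h4]
    refine h3.symm.trans (integral_congr_ae (Eventually.of_forall fun t => ?_))
    exact inner_re_symm (𝕜 := ℂ) _ _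
  have hi2 : Integrable (fun t => 2 * (inner ℂ (t⁻¹ • D.incl (f t)) z).re)
      (volume.restrict (Ioo α β)) := (hint.inner_const (𝕜 := ℂ) z).re.const_mul 2
  have e2 : ENNReal.ofReal (2 * interpForm θ D.p0 ψ) ≤
      ENNReal.ofReal (normConst θ)⁻¹ * jSq θ f + ENNReal.ofReal (interpForm θ D.p0 ψ) := by
    calc _ ≤ ∫⁻ t in Ioo α β, ENNReal.ofReal (2 * (inner ℂ (t⁻¹ • D.incl (f t)) z).re) := by
          rw [e1, ← integral_const_mul]
          exact ofReal_integral_le_lintegral hi2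
      _ ≤ ∫⁻ t in Ioo α β, (ENNReal.ofReal ((normConst θ)⁻¹) *
            ENNReal.ofReal (t ^ (-2 * θ - 1) * Jfun t (f t : H0 × H1) ^ 2) +
          ENNReal.ofReal (normConst θ) *
            ENNReal.ofReal (t ^ (2 * θ - 1) * dualForm θ D.p0 t ψ)) := by
          refine setLIntegral_mono' measurableSet_Ioo fun t ht => ?_
          have ht0 : 0 < t := hsub ht
          have hd := dualForm_nonneg h0 h1 D.norm_p0_le ht0 ψ
          rw [← ENNReal.ofReal_mul (by positivity), ← ENNReal.ofReal_mul hν.le,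
            ← ENNReal.ofReal_add (by positivity) (by positivity)]
          apply ENNReal.ofReal_le_ofReal
          have h := two_mul_re_inner_interpWeight_le h0 h1 D.norm_sq ht0
            (l := (normConst θ)⁻¹ * t ^ (-2 * θ)) (by positivity) ψ (D.incl (f t))
          rw [← hz, D.p0_incl, D.p1_incl, ← Jfun_sq] at h
          have e : (inner ℂ (t⁻¹ • D.incl (f t)) z).re = t⁻¹ * (inner ℂ (D.incl (f t)) z).re := by
            rw [RCLike.real_smul_eq_coe_smul (K := ℂ), inner_smul_left]
            simp
          rw [e]
          have h' := mul_le_mul_of_nonneg_left h (inv_nonneg.2 ht0.le)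
          have r1 : t ^ (-2 * θ - 1) = t ^ (-2 * θ) * t⁻¹ := by
            rw [Real.rpow_sub_one ht0.ne', div_eq_mul_inv]
          have r2 : t ^ (2 * θ - 1) = (t ^ (-2 * θ))⁻¹ * t⁻¹ := by
            rw [Real.rpow_sub_one ht0.ne', div_eq_mul_inv, ← Real.rpow_neg ht0.le]
            ring_nf
          rw [r1, r2]
          calc _ = t⁻¹ * (2 * (inner ℂ (D.incl (f t)) z).re) := by ring
            _ ≤ _ := h'
            _ = _ := by rw [mul_inv, inv_inv]; ring
      _ ≤ ∫⁻ t in Ioi (0:ℝ), (ENNReal.ofReal ((normConst θ)⁻¹) *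
            ENNReal.ofReal (t ^ (-2 * θ - 1) * Jfun t (f t : H0 × H1) ^ 2) +
          ENNReal.ofReal (normConst θ) *
            ENNReal.ofReal (t ^ (2 * θ - 1) * dualForm θ D.p0 t ψ)) := lintegral_mono_set hsub
      _ = _ := by
          have hmJ : AEMeasurable (fun t => t ^ (-2 * θ - 1) * Jfun t (f t : H0 × H1) ^ 2)
              (volume.restrict (Ioi (0:ℝ))) := by
            simp only [Jfun_sq]
            have m0 : AEMeasurable (fun t => ‖(f t : H0 × H1).1‖) (volume.restrict (Ioi (0:ℝ))) :=
              ((continuous_fst.comp continuous_subtype_val).comp_aestronglyMeasurable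
                hf.meas).norm.aemeasurable
            have m1 : AEMeasurable (fun t => ‖(f t : H0 × H1).2‖) (volume.restrict (Ioi (0:ℝ))) :=
              ((continuous_snd.comp continuous_subtype_val).comp_aestronglyMeasurable
                hf.meas).norm.aemeasurable
            fun_prop
          rw [lintegral_add_left' (hmJ.ennreal_ofReal.const_mul _),
            lintegral_const_mul' _ _ ENNReal.ofReal_ne_top,
            lintegral_const_mul' _ _ ENNReal.ofReal_ne_top,
            lintegral_dualForm h0 h1 D.norm_p0_le, ← ENNReal.ofReal_mul hν.le,
            mul_inv_cancel_left₀ hν.ne', jSq]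
  have hQ := interpForm_nonneg h0 h1 D.norm_p0_le ψ
  rw [two_mul, ENNReal.ofReal_add hQ hQ] at e2
  exact (ENNReal.add_le_add_iff_right ENNReal.ofReal_ne_top).1 e2

end

end CompatiblePair

namespace CompatiblePair

section

variable {V X0 X1 : Type*} [AddCommGroup V] [Module ℂ V]
  [NormedAddCommGroup X0] [NormedSpace ℂ X0] [CompleteSpace X0]
  [NormedAddCommGroup X1] [NormedSpace ℂ X1] [CompleteSpace X1]
  (P : CompatiblePair V X0 X1)

lemma tendsto_KfunE {φ : V} {x : ℕ → V}
    (h : Tendsto (fun n => P.normSigmaE (φ - x n)) atTop (𝓝 0)) {t : ℝ} (ht : 0 ≤ t) :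
    Tendsto (fun n => P.KfunE t (x n)) atTop (𝓝 (P.KfunE t φ)) := by
  have h1 : Tendsto (fun n => P.KfunE t (φ - x n)) atTop (𝓝 0) := by
    have h2 := ENNReal.Tendsto.const_mul (a := ENNReal.ofReal (max 1 t)) h
      (Or.inr ENNReal.ofReal_ne_top)
    rw [mul_zero] at h2
    exact tendsto_of_tendsto_of_tendsto_of_le_of_le tendsto_const_nhds h2
      (fun _ => zero_le) fun n => P.KfunE_le_mul_normSigmaE ht _
  have l1 := ENNReal.Tendsto.sub (tendsto_const_nhds (x := P.KfunE t φ)) h1 (Or.inr (by simp))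
  have l2 := (tendsto_const_nhds (x := P.KfunE t φ)).add h1
  rw [tsub_zero] at l1
  rw [add_zero] at l2
  refine tendsto_of_tendsto_of_tendsto_of_le_of_le l1 l2 (fun n => ?_) fun n => ?_
  · rw [tsub_le_iff_right]
    have := P.KfunE_add_le t (x n) (φ - x n)
    rwa [add_sub_cancel] at this
  · have := P.KfunE_sub_le t φ (φ - x n)
    rwa [sub_sub_cancel] at this

/-- Lower semicontinuity of the K-norm with respect to convergence in `Σ`. -/
lemma kSq_le_of_tendsto {θ : ℝ} {φ : V} {x : ℕ → V} {C : ℝ≥0∞}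
    (h : Tendsto (fun n => P.normSigmaE (φ - x n)) atTop (𝓝 0)) (hC : ∀ n, P.kSq θ (x n) ≤ C) :
    P.kSq θ φ ≤ C := by
  have e : P.kSq θ φ = ∫⁻ t in Ioi (0:ℝ), liminf (fun n =>
      ENNReal.ofReal (t ^ (-2 * θ - 1)) * P.KfunE t (x n) ^ 2) atTop := by
    refine setLIntegral_congr_fun measurableSet_Ioi fun t (ht : 0 < t) => ?_
    exact (ENNReal.Tendsto.const_mul (ENNReal.Tendsto.pow (P.tendsto_KfunE h ht.le))
      (Or.inr ENNReal.ofReal_ne_top)).liminf_eq.symm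
  rw [e]
  refine (lintegral_liminf_le' fun n => ?_).trans ?_
  · have := P.aemeasurable_KfunE (x n)
    fun_prop
  · exact (liminf_le_liminf (Eventually.of_forall hC)).trans (by simp)

lemma mem_sigmaSet_of_normSigmaE_lt_top {φ x : V} (h : P.normSigmaE (φ - x) < ⊤)
    (hx : x ∈ P.sigmaSet) : φ ∈ P.sigmaSet := by
  obtain ⟨_, ⟨a, b, hab, -⟩, -⟩ := sInf_lt_iff.1 h
  obtain ⟨a', b', hab'⟩ := hx
  refine ⟨a + a', b + b', ?_⟩
  rw [map_add, map_add, add_add_add_comm, hab, hab', sub_add_cancel]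

variable {P} in
lemma IsJRep.tendsto_seq {f : ℝ → P.deltaSub} {φ : V} (hf : P.IsJRep φ f) :
    Tendsto (fun n : ℕ => P.normSigmaE (φ - P.j0 (∫ t in Ioo (1 / ((n : ℝ) + 1)) ((n : ℝ) + 2),
      t⁻¹ • ((f t : X0 × X1).1)))) atTop (𝓝 0) := by
  have h1 : Tendsto (fun n : ℕ => 1 / ((n : ℝ) + 1)) atTop (𝓝[>] 0) :=
    tendsto_nhdsWithin_iff.2 ⟨tendsto_one_div_add_atTop_nhds_zero_nat,
      Eventually.of_forall fun n => by simp only [mem_Ioi]; positivity⟩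
  have h2 : Tendsto (fun n : ℕ => (n : ℝ) + 2) atTop atTop :=
    tendsto_atTop_add_const_right _ _ tendsto_natCast_atTop_atTop
  have h3 : Tendsto (fun n : ℕ => (1 / ((n : ℝ) + 1), (n : ℝ) + 2)) atTop
      ((𝓝[>] (0:ℝ)) ×ˢ atTop) := h1.prodMk h2
  have h4 := hf.conv.comp h3
  simpa only [Function.comp_def] using h4

variable {P} in
lemma IsJRep.mem_sigmaSet {f : ℝ → P.deltaSub} {φ : V} (hf : P.IsJRep φ f) : φ ∈ P.sigmaSet := by
  obtain ⟨n, hn⟩ := (hf.tendsto_seq.eventually_lt_const ENNReal.zero_lt_top).exists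
  exact P.mem_sigmaSet_of_normSigmaE_lt_top hn 
    ⟨_, 0, (congrArg _ (map_zero P.j1)).trans (add_zero _)⟩

end

section

variable {V H0 H1 : Type*} [AddCommGroup V] [Module ℂ V]
    [NormedAddCommGroup H0] [InnerProductSpace ℂ H0] [CompleteSpace H0]
    [NormedAddCommGroup H1] [InnerProductSpace ℂ H1] [CompleteSpace H1]
    {P : CompatiblePair V H0 H1} {E : Type*} [NormedAddCommGroup E] [InnerProductSpace ℂ E]

/-- The K-norm is dominated by the J-norm. -/
lemma DeltaCompletion.kSq_le_jSq [CompleteSpace E] (D : P.DeltaCompletion E) {θ : ℝ} (h0 : 0 < θ)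
    (h1 : θ < 1) {f : ℝ → P.deltaSub} {φ : V} (hf : P.IsJRep φ f) :
    P.kSq θ φ ≤ ENNReal.ofReal ((normConst θ)⁻¹ ^ 2) * jSq θ f := by
  have hν := normConst_pos h0 h1
  refine P.kSq_le_of_tendsto hf.tendsto_seq fun n => ?_
  have hα : 0 < 1 / ((n : ℝ) + 1) := by positivity
  have hαβ : 1 / ((n : ℝ) + 1) < (n : ℝ) + 2 := by
    rw [div_lt_iff₀ (by positivity)]
    nlinarith [(Nat.cast_nonneg n : (0:ℝ) ≤ n)]
  have e : ∫ t in Ioo (1 / ((n : ℝ) + 1)) ((n : ℝ) + 2), t⁻¹ • ((f t : H0 × H1).1) =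
      D.p0 (∫ t in Ioo (1 / ((n : ℝ) + 1)) ((n : ℝ) + 2), t⁻¹ • D.incl (f t)) := by
    rw [← ContinuousLinearMap.integral_comp_comm _ (D.integrableOn hf hα hαβ)]
    refine integral_congr_ae (Eventually.of_forall fun t => ?_)
    change t⁻¹ • ((f t : H0 × H1).1) = D.p0 (t⁻¹ • D.incl (f t))
    rw [RCLike.real_smul_eq_coe_smul (K := ℂ) (t⁻¹) (D.incl (f t)), map_smul, D.p0_incl,
      RCLike.real_smul_eq_coe_smul (K := ℂ)]
  rw [e, D.kSq_eq h0 h1, ENNReal.ofReal_mul (by positivity), sq,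
    ENNReal.ofReal_mul (by positivity), mul_assoc]
  gcongr
  exact D.interpForm_integral_le h0 h1 hf hα hαβ

end

end CompatiblePair

namespace CompatiblePair

section

variable {V X0 X1 : Type*} [AddCommGroup V] [Module ℂ V]
  [NormedAddCommGroup X0] [NormedSpace ℂ X0] [CompleteSpace X0]
  [NormedAddCommGroup X1] [NormedSpace ℂ X1] [CompleteSpace X1]
  (P : CompatiblePair V X0 X1)

/-- A decomposition of `φ` which is optimal for `K(s,φ)` up to the factor `2`. -/
structure IsNearMin (s : ℝ) (φ : V) (a : X0) (b : X1) : Prop where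
  add_eq : P.j0 a + P.j1 b = φ
  le : ENNReal.ofReal (√(‖a‖ ^ 2 + s ^ 2 * ‖b‖ ^ 2)) ≤ 2 * P.KfunE s φ

lemma exists_isNearMin {s : ℝ} {φ : V} (hφ : φ ∈ P.sigmaSet) (hK : P.KfunE s φ ≠ 0) :
    ∃ a b, P.IsNearMin s φ a b := by
  have hlt : P.KfunE s φ < 2 * P.KfunE s φ := by
    rw [two_mul]
    exact ENNReal.lt_add_right (P.KfunE_lt_top_of_mem hφ s).ne hK
  obtain ⟨a, b, hab, h⟩ := P.exists_of_KfunE_lt hlt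
  exact ⟨a, b, hab, h.le⟩

variable {P}

lemma IsNearMin.norm_fst_le {s : ℝ} {φ : V} {a : X0} {b : X1} (h : P.IsNearMin s φ a b) :
    ENNReal.ofReal ‖a‖ ≤ 2 * P.KfunE s φ :=
  (ENNReal.ofReal_le_ofReal (Real.le_sqrt_of_sq_le (by nlinarith [sq_nonneg (s * ‖b‖)]))).trans h.le

lemma IsNearMin.norm_snd_le {s : ℝ} {φ : V} {a : X0} {b : X1} (h : P.IsNearMin s φ a b) :
    ENNReal.ofReal (s * ‖b‖) ≤ 2 * P.KfunE s φ :=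
  (ENNReal.ofReal_le_ofReal (Real.le_sqrt_of_sq_le (by nlinarith [sq_nonneg ‖a‖]))).trans h.le

lemma IsNearMin.mul_norm_snd_le {s t : ℝ} {φ : V} {a : X0} {b : X1} (h : P.IsNearMin s φ a b)
    (ht : 0 < t) (hts : t ≤ s) : ENNReal.ofReal (t * ‖b‖) ≤ 2 * P.KfunE t φ := by
  have hs : 0 < s := ht.trans_le hts
  calc ENNReal.ofReal (t * ‖b‖) = ENNReal.ofReal (t / s) * ENNReal.ofReal (s * ‖b‖) := by
        rw [← ENNReal.ofReal_mul (by positivity)]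
        congr 1
        field_simp
    _ ≤ ENNReal.ofReal (t / s) * (2 * (ENNReal.ofReal (s / t) * P.KfunE t φ)) := by
        gcongr
        exact h.norm_snd_le.trans (by gcongr; exact P.KfunE_le_div_mul ht hts φ)
    _ = ENNReal.ofReal (t / s) * ENNReal.ofReal (s / t) * (2 * P.KfunE t φ) := by ring
    _ = 2 * P.KfunE t φ := by
        rw [← ENNReal.ofReal_mul (by positivity), div_mul_div_cancel₀ hs.ne', div_self ht.ne',
          ENNReal.ofReal_one, one_mul]

lemma IsNearMin.KfunE_le {s t : ℝ} {φ : V} {a : X0} {b : X1} (h : P.IsNearMin s φ a b)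
    (hs : 0 < s) (ht : 0 < t) :
    P.KfunE t (P.j0 a) ≤ 3 * P.KfunE t φ ∧ P.KfunE t (P.j1 b) ≤ 3 * P.KfunE t φ := by
  have e3 : (3 : ℝ≥0∞) * P.KfunE t φ = P.KfunE t φ + 2 * P.KfunE t φ := by ring
  have ea : P.j0 a = φ - P.j1 b := by rw [← h.add_eq]; abel
  have eb : P.j1 b = φ - P.j0 a := by rw [← h.add_eq]; abel
  rcases le_total s t with hst | hts
  · have h1 : P.KfunE t (P.j0 a) ≤ 2 * P.KfunE t φ :=
      ((P.KfunE_j0_le t a).trans h.norm_fst_le).trans (by gcongr; exact P.KfunE_mono hs.le hst φ)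
    rw [e3]
    refine ⟨h1.trans le_add_self, ?_⟩
    rw [eb]
    exact (P.KfunE_sub_le t _ _).trans (by gcongr)
  · have h1 : P.KfunE t (P.j1 b) ≤ 2 * P.KfunE t φ :=
      (P.KfunE_j1_le ht.le b).trans (h.mul_norm_snd_le ht hts)
    rw [e3]
    refine ⟨?_, h1.trans le_add_self⟩
    rw [ea]
    exact (P.KfunE_sub_le t _ _).trans (by gcongr)

lemma IsNearMin.sq_le {θ s : ℝ} {φ : V} {a : X0} {b : X1} (h : P.IsNearMin s φ a b)
    (h0 : 0 < θ) (hs : 0 < s) (hk : P.kSq θ φ < ⊤) :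
    ‖a‖ ^ 2 + s ^ 2 * ‖b‖ ^ 2 ≤ 4 * 2 ^ (2 * θ + 1) * (P.kSq θ φ).toReal * s ^ (2 * θ) := by
  rw [← ENNReal.ofReal_le_ofReal_iff (by positivity)]
  calc _ = ENNReal.ofReal (√(‖a‖ ^ 2 + s ^ 2 * ‖b‖ ^ 2)) ^ 2 := by
        rw [← ENNReal.ofReal_pow (by positivity), Real.sq_sqrt (by positivity)]
    _ ≤ (2 * P.KfunE s φ) ^ 2 := pow_le_pow_left' h.le 2
    _ = 4 * P.KfunE s φ ^ 2 := by ring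
    _ ≤ 4 * (ENNReal.ofReal (2 ^ (2 * θ + 1) * s ^ (2 * θ)) * P.kSq θ φ) := by
        gcongr
        exact P.KfunE_sq_le_rpow h0 hs φ
    _ = _ := by
        rw [← ENNReal.ofReal_toReal hk.ne, ← ENNReal.ofReal_mul (by positivity),
          show (4 : ℝ≥0∞) = ENNReal.ofReal 4 by simp, ← ENNReal.ofReal_mul (by positivity),
          ENNReal.ofReal_toReal hk.ne]
        congr 1
        ring

variable (P)

/-- Elements of finite K-norm are approximated by elements of `Δ`. -/
lemma exists_delta_approx {θ : ℝ} (h0 : 0 < θ) (h1 : θ < 1) {φ : V} (hφ : φ ∈ P.sigmaSet)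
    (hk : P.kSq θ φ < ⊤) : ∃ (g : ℕ → P.deltaSub) (x : ℕ → X0) (y : ℕ → X1),
      (∀ n, P.j0 (x n) + P.j1 (y n) = φ - P.j0 (g n : X0 × X1).1) ∧
      Tendsto x atTop (𝓝 0) ∧ Tendsto y atTop (𝓝 0) ∧
      Tendsto (fun n => P.kSq θ (φ - P.j0 (g n : X0 × X1).1)) atTop (𝓝 0) ∧
      Tendsto (fun n => P.kSq θ (P.j0 (g n : X0 × X1).1)) atTop (𝓝 (P.kSq θ φ)) := by
  by_cases hK : ∃ s : ℝ, 0 < s ∧ P.KfunE s φ = 0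
  · obtain ⟨s, hs, hK⟩ := hK
    have hz : ∀ t : ℝ, 0 < t → P.KfunE t φ = 0 := fun t ht => by
      rcases le_total s t with h | h
      · simpa [hK] using P.KfunE_le_div_mul hs h φ
      · simpa [hK] using P.KfunE_mono ht.le h φ
    have hz' : ∀ n : ℕ, ∃ a b, P.j0 a + P.j1 b = φ ∧ ‖a‖ ≤ 1 / ((n : ℝ) + 1) ∧
        ‖b‖ ≤ 1 / ((n : ℝ) + 1) := fun n => by
      have hn : 0 < 1 / ((n : ℝ) + 1) := by positivity
      obtain ⟨a, b, hab, h⟩ := P.exists_of_KfunE_lt (x := φ) (t := 1)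
        (c := ENNReal.ofReal (1 / ((n : ℝ) + 1))) (by
          rw [hz 1 one_pos]; exact ENNReal.ofReal_pos.2 hn)
      have h := ((ENNReal.ofReal_lt_ofReal_iff hn).1 h).le
      exact ⟨a, b, hab, (Real.le_sqrt_of_sq_le (by nlinarith [sq_nonneg ‖b‖])).trans h,
        (Real.le_sqrt_of_sq_le (by nlinarith [sq_nonneg ‖a‖])).trans h⟩
    choose x y hxy hx hy using hz'
    have hk0 : P.kSq θ φ = 0 := by
      rw [kSq, setLIntegral_congr_fun measurableSet_Ioi
        (g := fun _ => 0) fun t ht => by simp [hz t ht], lintegral_zero]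
    have hk00 : P.kSq θ 0 = 0 := by
      rw [kSq, setLIntegral_congr_fun measurableSet_Ioi (g := fun _ => 0) fun t ht => ?_,
        lintegral_zero]
      have := P.KfunE_j0_le t 0
      rw [map_zero, norm_zero, ENNReal.ofReal_zero, nonpos_iff_eq_zero] at this
      simp [this]
    refine ⟨0, x, y, fun n => ?_, ?_, ?_, ?_, ?_⟩
    · simpa using hxy n
    · exact squeeze_zero_norm hx tendsto_one_div_add_atTop_nhds_zero_nat
    · exact squeeze_zero_norm hy tendsto_one_div_add_atTop_nhds_zero_nat
    · simp [hk0]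
    · simp [hk0, hk00]
  push Not at hK
  set s : ℕ → ℝ := fun n => ((n : ℝ) + 1)⁻¹
  set T : ℕ → ℝ := fun n => (n : ℝ) + 1
  have hs : ∀ n, 0 < s n := fun n => by positivity
  have hT : ∀ n, 0 < T n := fun n => by positivity
  have hT' : Tendsto T atTop atTop :=
    tendsto_atTop_add_const_right _ _ tendsto_natCast_atTop_atTop
  choose a b hab using fun n => P.exists_isNearMin hφ (hK (s n) (hs n))
  choose c d hcd using fun n => P.exists_isNearMin hφ (hK (T n) (hT n))
  have hg : ∀ n, (c n - a n, b n - d n) ∈ P.deltaSub := fun n => by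
    change P.j0 (c n - a n) = P.j1 (b n - d n)
    rw [map_sub, map_sub, sub_eq_sub_iff_add_eq_add, (hcd n).add_eq, add_comm, (hab n).add_eq]
  have hdec : ∀ n, P.j0 (a n) + P.j1 (d n) = φ - P.j0 (c n - a n) := fun n => by
    rw [map_sub, ← (hcd n).add_eq]
    abel
  set C := 4 * 2 ^ (2 * θ + 1) * (P.kSq θ φ).toReal with hC
  have ha : Tendsto a atTop (𝓝 0) := by
    have h2 : Tendsto (fun n => C * (T n) ^ (-(2 * θ))) atTop (𝓝 (C * 0)) :=
      ((tendsto_rpow_neg_atTop (by positivity)).comp hT').const_mul C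
    rw [mul_zero] at h2
    have h3 : Tendsto (fun n => ‖a n‖ ^ 2) atTop (𝓝 0) := by
      refine squeeze_zero (fun n => by positivity) (fun n => ?_) h2
      have h4 := (hab n).sq_le h0 (hs n) hk
      have h5 : s n ^ (2 * θ) = T n ^ (-(2 * θ)) := by
        rw [Real.rpow_neg (hT n).le, ← Real.inv_rpow (hT n).le]
      rw [← hC, h5] at h4
      nlinarith [sq_nonneg (s n * ‖b n‖)]
    rw [tendsto_zero_iff_norm_tendsto_zero]
    have := h3.sqrt
    simpa using this
  have hd : Tendsto d atTop (𝓝 0) := by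
    have h2 : Tendsto (fun n => C * (T n) ^ (-(2 - 2 * θ))) atTop (𝓝 (C * 0)) :=
      ((tendsto_rpow_neg_atTop (by linarith)).comp hT').const_mul C
    rw [mul_zero] at h2
    have h3 : Tendsto (fun n => ‖d n‖ ^ 2) atTop (𝓝 0) := by
      refine squeeze_zero (fun n => by positivity) (fun n => ?_) h2
      have h4 := (hcd n).sq_le h0 (hT n) hk
      have h5 : T n ^ (-(2 - 2 * θ)) = T n ^ (2 * θ) / T n ^ 2 := by
        rw [show -(2 - 2 * θ) = 2 * θ - (2:ℕ) by push_cast; ring, Real.rpow_sub_natCast (hT n).ne']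
      rw [← hC] at h4
      rw [h5, ← mul_div_assoc, le_div_iff₀ (by have := hT n; positivity)]
      nlinarith [sq_nonneg ‖c n‖]
    rw [tendsto_zero_iff_norm_tendsto_zero]
    have := h3.sqrt
    simpa using this
  have hKle : ∀ n t, 0 < t → P.KfunE t (φ - P.j0 (c n - a n)) ≤ 6 * P.KfunE t φ :=
    fun n t ht => by
      rw [← hdec n]
      refine (P.KfunE_add_le t _ _).trans ?_
      rw [show (6 : ℝ≥0∞) = 3 + 3 by norm_num, add_mul]
      exact add_le_add ((hab n).KfunE_le (hs n) ht).1 ((hcd n).KfunE_le (hT n) ht).2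
  have hKle' : ∀ n t, 0 < t → P.KfunE t (P.j0 (c n - a n)) ≤ 7 * P.KfunE t φ :=
    fun n t ht => by
      have := P.KfunE_sub_le t φ (φ - P.j0 (c n - a n))
      rw [sub_sub_cancel] at this
      rw [show (7 : ℝ≥0∞) = 1 + 6 by norm_num, add_mul, one_mul]
      exact this.trans (by gcongr; exact hKle n t ht)
  have hsig : Tendsto (fun n => P.normSigmaE (φ - P.j0 (c n - a n))) atTop (𝓝 0) := by
    have h2 : Tendsto (fun n => ENNReal.ofReal (‖a n‖ + ‖d n‖)) atTop (𝓝 0) := by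
      have := ENNReal.tendsto_ofReal (ha.norm.add hd.norm)
      simpa using this
    exact tendsto_of_tendsto_of_tendsto_of_le_of_le tendsto_const_nhds h2
      (fun _ => zero_le) fun n => P.normSigmaE_le (hdec n)
  have hbd : ∀ N : ℝ≥0∞, N ≠ ⊤ → ∫⁻ t in Ioi (0:ℝ), ENNReal.ofReal (t ^ (-2 * θ - 1)) *
      (N * P.KfunE t φ) ^ 2 ≠ ⊤ := fun N hN => by
    have : ∀ t, ENNReal.ofReal (t ^ (-2 * θ - 1)) * (N * P.KfunE t φ) ^ 2 =
        N ^ 2 * (ENNReal.ofReal (t ^ (-2 * θ - 1)) * P.KfunE t φ ^ 2) := fun t => by ring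
    simp only [this]
    rw [lintegral_const_mul' _ _ (by simp [hN])]
    exact ENNReal.mul_ne_top (by simp [hN]) hk.ne
  refine ⟨fun n => ⟨_, hg n⟩, a, d, hdec, ha, hd, ?_, ?_⟩
  · have := tendsto_lintegral_of_dominated_convergence' (μ := volume.restrict (Ioi (0:ℝ)))
      (F := fun n t => ENNReal.ofReal (t ^ (-2 * θ - 1)) *
        P.KfunE t (φ - P.j0 (c n - a n)) ^ 2) (f := fun _ => 0)
      (fun t => ENNReal.ofReal (t ^ (-2 * θ - 1)) * (6 * P.KfunE t φ) ^ 2)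
      (fun n => by
        have := P.aemeasurable_KfunE (φ - P.j0 (c n - a n))
        fun_prop)
      (fun n => (ae_restrict_iff' measurableSet_Ioi).2 (Eventually.of_forall fun t ht => by
        dsimp only
        gcongr
        exact hKle n t ht))
      (hbd 6 (by simp))
      ((ae_restrict_iff' measurableSet_Ioi).2 (Eventually.of_forall fun t ht => by
        have h2 : Tendsto (fun n => P.KfunE t (φ - P.j0 (c n - a n))) atTop (𝓝 0) := by
          have h3 := ENNReal.Tendsto.const_mul (a := ENNReal.ofReal (max 1 t)) hsig
            (Or.inr ENNReal.ofReal_ne_top)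
          rw [mul_zero] at h3
          exact tendsto_of_tendsto_of_tendsto_of_le_of_le tendsto_const_nhds h3
            (fun _ => zero_le) fun n => P.KfunE_le_mul_normSigmaE (le_of_lt ht) _
        have h3 := ENNReal.Tendsto.const_mul (a := ENNReal.ofReal (t ^ (-2 * θ - 1)))
          (ENNReal.Tendsto.pow (n := 2) h2) (Or.inr ENNReal.ofReal_ne_top)
        simpa using h3))
    simpa [kSq] using this
  · exact tendsto_lintegral_of_dominated_convergence' (μ := volume.restrict (Ioi (0:ℝ)))
      (fun t => ENNReal.ofReal (t ^ (-2 * θ - 1)) * (7 * P.KfunE t φ) ^ 2)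
      (fun n => by
        have := P.aemeasurable_KfunE (P.j0 (c n - a n))
        fun_prop)
      (fun n => (ae_restrict_iff' measurableSet_Ioi).2 (Eventually.of_forall fun t ht => by
        dsimp only
        gcongr
        exact hKle' n t ht))
      (hbd 7 (by simp))
      ((ae_restrict_iff' measurableSet_Ioi).2 (Eventually.of_forall fun t ht =>
        ENNReal.Tendsto.const_mul (ENNReal.Tendsto.pow (P.tendsto_KfunE hsig (le_of_lt ht)))
          (Or.inr ENNReal.ofReal_ne_top)))

end

end CompatiblePair

lemma exists_tendsto_of_norm_sub_sq_le {F : Type*} [NormedAddCommGroup F] [CompleteSpace F]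
    {u : ℕ → F} {c : ℝ} {e : ℕ → ℝ} (he : Tendsto e atTop (𝓝 0))
    (h : ∀ n m, ‖u n - u m‖ ^ 2 ≤ c * (e n + e m)) : ∃ A, Tendsto u atTop (𝓝 A) := by
  refine cauchySeq_tendsto_of_complete (Metric.cauchySeq_iff'.2 fun ε hε => ?_)
  have h1 : Tendsto (fun n => c * e n) atTop (𝓝 0) := by simpa using he.const_mul c
  obtain ⟨N, hN⟩ := eventually_atTop.1 (h1.eventually_lt_const (show 0 < ε ^ 2 / 2 by positivity))
  refine ⟨N, fun n hn => ?_⟩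
  rw [dist_eq_norm]
  refine lt_of_pow_lt_pow_left₀ 2 hε.le ((h n N).trans_lt ?_)
  linarith [hN n hn, hN N le_rfl]

namespace CompatiblePair

lemma kSq_sub_le {V X0 X1 : Type*} [AddCommGroup V] [Module ℂ V]
    [NormedAddCommGroup X0] [NormedSpace ℂ X0] [CompleteSpace X0]
    [NormedAddCommGroup X1] [NormedSpace ℂ X1] [CompleteSpace X1]
    (P : CompatiblePair V X0 X1) (θ : ℝ) (x y : V) :
    P.kSq θ (x - y) ≤ 2 * (P.kSq θ x + P.kSq θ y) := by
  have hx := P.aemeasurable_KfunE x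
  have hy := P.aemeasurable_KfunE y
  rw [kSq, kSq, kSq, ← lintegral_add_left' (by fun_prop), ← lintegral_const_mul' _ _ (by simp)]
  refine lintegral_mono fun t => ?_
  calc _ ≤ ENNReal.ofReal (t ^ (-2 * θ - 1)) * (P.KfunE t x + P.KfunE t y) ^ 2 := by
        gcongr
        exact P.KfunE_sub_le t x y
    _ ≤ ENNReal.ofReal (t ^ (-2 * θ - 1)) * (2 * (P.KfunE t x ^ 2 + P.KfunE t y ^ 2)) := by
        gcongr
        have := ENNReal.rpow_add_le_mul_rpow_add_rpow (P.KfunE t x) (P.KfunE t y) one_le_two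
        rwa [show (2:ℝ) - 1 = 1 by norm_num, ENNReal.rpow_one, ENNReal.rpow_two,
          ENNReal.rpow_two, ENNReal.rpow_two] at this
    _ = _ := by ring

variable {V H0 H1 : Type*} [AddCommGroup V] [Module ℂ V]
    [NormedAddCommGroup H0] [InnerProductSpace ℂ H0] [CompleteSpace H0]
    [NormedAddCommGroup H1] [InnerProductSpace ℂ H1] [CompleteSpace H1]
    {P : CompatiblePair V H0 H1} {E : Type*} [NormedAddCommGroup E] [InnerProductSpace ℂ E]

lemma DeltaCompletion.interpForm_eq [CompleteSpace E] (D : P.DeltaCompletion E) {θ : ℝ}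
    (h0 : 0 < θ) (h1 : θ < 1) (g : E) :
    interpForm θ D.p0 g = normConst θ * (P.kSq θ (P.j0 (D.p0 g))).toReal := by
  have hν := normConst_pos h0 h1
  rw [D.kSq_eq h0 h1, ENNReal.toReal_ofReal
    (mul_nonneg (by positivity) (interpForm_nonneg h0 h1 D.norm_p0_le g)),
    mul_inv_cancel_left₀ hν.ne']

/-- An element of finite K-norm has approximate decompositions along a geometric progression
whose energy is controlled by the K-norm. -/
lemma DeltaCompletion.exists_decomposition [CompleteSpace E] (D : P.DeltaCompletion E) {θ : ℝ}
    (h0 : 0 < θ) (h1 : θ < 1) {q : ℝ} (hq : 1 < q) {φ : V} (hφ : φ ∈ P.sigmaSet)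
    (hk : P.kSq θ φ < ⊤) :
    ∃ (A : ℤ → H0) (B : ℤ → H1) (C : ℝ),
      (∀ k, ‖A k‖ ^ 2 ≤ C * (q ^ k) ^ (2 * θ)) ∧ (∀ k, ‖B k‖ ^ 2 ≤ C * (q ^ k) ^ (2 * θ - 2)) ∧
      (∀ (M : ℤ) (n : ℕ), ∑ j ∈ Finset.range n, (q ^ (M + j)) ^ (-2 * θ) *
        (‖A (M + j + 1) - A (M + j)‖ ^ 2 +
          (q ^ (M + j + 1)) ^ 2 * ‖B (M + j) - B (M + j + 1)‖ ^ 2) ≤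
        normConst θ ^ 2 * q ^ 4 * Real.log q * (P.kSq θ φ).toReal) ∧
      ∀ k, ∀ δ : ℝ, 0 < δ → ∃ a b, P.j0 a + P.j1 b = φ ∧ ‖a - A k‖ < δ ∧ ‖b - B k‖ < δ := by
  have hν := normConst_pos h0 h1
  have hq0 : 0 < q := by linarith
  obtain ⟨g, x, y, hxy, hx, hy, he, hg⟩ := P.exists_delta_approx h0 h1 hφ hk
  set ψ : ℕ → E := fun n => D.incl (g n) with hψ
  set Q : E → ℝ := interpForm θ D.p0 with hQ
  have hQ0 : ∀ z, 0 ≤ Q z := interpForm_nonneg h0 h1 D.norm_p0_le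
  have hψ0 : ∀ n, P.j0 (D.p0 (ψ n)) = P.j0 (g n : H0 × H1).1 := fun n => by
    rw [hψ, D.p0_incl]
  have hQlim : Tendsto (fun n => Q (ψ n)) atTop (𝓝 (normConst θ * (P.kSq θ φ).toReal)) := by
    have := ((ENNReal.tendsto_toReal hk.ne).comp hg).const_mul (normConst θ)
    refine this.congr fun n => ?_
    rw [hQ, D.interpForm_eq h0 h1, hψ0]
    rfl
  set M0 := normConst θ * (P.kSq θ φ).toReal with hM0
  -- finiteness of the errors holds eventually, and the sequence is shifted accordingly
  obtain ⟨N, hN⟩ := eventually_atTop.1 (he.eventually_lt_const ENNReal.zero_lt_top)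
  set e : ℕ → ℝ := fun n => 2 * normConst θ * (P.kSq θ (φ - P.j0 (g (N + n) : H0 × H1).1)).toReal
    with hedef
  have hadd : Tendsto (fun n : ℕ => N + n) atTop atTop := by
    simpa only [add_comm] using tendsto_add_atTop_nat N
  have he0 : Tendsto e atTop (𝓝 0) := by
    have := ((ENNReal.tendsto_toReal ENNReal.zero_ne_top).comp (he.comp hadd)).const_mul
      (2 * normConst θ)
    simpa [hedef] using this
  have hQsub : ∀ n m, Q (ψ (N + n) - ψ (N + m)) ≤ e n + e m := fun n m => by
    have e1 : P.j0 (D.p0 (ψ (N + n) - ψ (N + m))) =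
        (φ - P.j0 (g (N + m) : H0 × H1).1) - (φ - P.j0 (g (N + n) : H0 × H1).1) := by
      rw [map_sub, map_sub, hψ0, hψ0]
      abel
    have h2 := P.kSq_sub_le θ (φ - P.j0 (g (N + m) : H0 × H1).1)
      (φ - P.j0 (g (N + n) : H0 × H1).1)
    have fm := hN (N + m) (by omega)
    have fn := hN (N + n) (by omega)
    have h3 := ENNReal.toReal_mono (ENNReal.mul_ne_top (by simp) (ENNReal.add_ne_top.2
      ⟨fm.ne, fn.ne⟩)) h2
    rw [ENNReal.toReal_mul, ENNReal.toReal_add fm.ne fn.ne] at h3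
    rw [hQ, D.interpForm_eq h0 h1, e1]
    simp only [hedef]
    calc _ ≤ normConst θ * _ := mul_le_mul_of_nonneg_left h3 hν.le
      _ = _ := by simp; ring
  set T : ℤ → E →L[ℂ] E := fun k => normalCalc D.p0 (splitFun θ (q ^ k)) with hT
  have hqk : ∀ k : ℤ, 0 < q ^ k := fun k => by positivity
  have bA : ∀ k z, ‖D.p0 (T k z)‖ ^ 2 ≤ normConst θ / (2 * θ) * (q ^ k) ^ (2 * θ) * Q z :=
    fun k z => norm_map_splitFun_sq_le h0 h1 D.norm_p0_le (hqk k) z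
  have bB : ∀ k z, ‖D.p1 (z - T k z)‖ ^ 2 ≤
      normConst θ / (2 - 2 * θ) * (q ^ k) ^ (2 * θ - 2) * Q z :=
    fun k z => norm_map_sub_splitFun_sq_le h0 h1 D.norm_sq (hqk k) z
  have h2θ : 0 < 2 - 2 * θ := by linarith
  have exA : ∀ k, ∃ a, Tendsto (fun n => D.p0 (T k (ψ (N + n)))) atTop (𝓝 a) := fun k =>
    exists_tendsto_of_norm_sub_sq_le (c := normConst θ / (2 * θ) * (q ^ k) ^ (2 * θ)) he0
      fun n m => by
        rw [← map_sub, ← map_sub]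
        exact (bA k _).trans (mul_le_mul_of_nonneg_left (hQsub n m) (by have := hqk k; positivity))
  have exB : ∀ k, ∃ b, Tendsto (fun n => D.p1 (ψ (N + n) - T k (ψ (N + n)))) atTop (𝓝 b) :=
    fun k => exists_tendsto_of_norm_sub_sq_le
      (c := normConst θ / (2 - 2 * θ) * (q ^ k) ^ (2 * θ - 2)) he0
      fun n m => by
        rw [← map_sub, sub_sub_sub_comm, ← map_sub (T k)]
        exact (bB k _).trans (mul_le_mul_of_nonneg_left (hQsub n m) (by have := hqk k; positivity))
  choose A hA using exA
  choose B hB using exB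
  have hQl := hQlim.comp hadd
  have hM00 : 0 ≤ M0 := by positivity
  refine ⟨A, B, normConst θ / (2 * θ) * M0 + normConst θ / (2 - 2 * θ) * M0, fun k => ?_,
    fun k => ?_, fun M n => ?_, fun k δ hδ => ?_⟩
  · refine (le_of_tendsto_of_tendsto' ((hA k).norm.pow 2) (hQl.const_mul _)
      fun n => bA k _).trans ?_
    have h3 : 0 ≤ normConst θ / (2 - 2 * θ) * M0 * (q ^ k) ^ (2 * θ) := by
      have := hqk k
      positivity
    linarith
  · refine (le_of_tendsto_of_tendsto' ((hB k).norm.pow 2) (hQl.const_mul _)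
      fun n => bB k _).trans ?_
    have h3 : 0 ≤ normConst θ / (2 * θ) * M0 * (q ^ k) ^ (2 * θ - 2) := by
      have := hqk k
      positivity
    linarith
  · have l1 := hQl.const_mul (normConst θ * q ^ 4 * Real.log q)
    have l2 : Tendsto (fun n' => ∑ j ∈ Finset.range n, (q ^ (M + j)) ^ (-2 * θ) *
        (‖D.p0 (T (M + j + 1) (ψ (N + n'))) - D.p0 (T (M + j) (ψ (N + n')))‖ ^ 2 +
          (q ^ (M + j + 1)) ^ 2 * ‖D.p1 (ψ (N + n') - T (M + j) (ψ (N + n'))) -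
            D.p1 (ψ (N + n') - T (M + j + 1) (ψ (N + n')))‖ ^ 2)) atTop
        (𝓝 (∑ j ∈ Finset.range n, (q ^ (M + j)) ^ (-2 * θ) *
        (‖A (M + j + 1) - A (M + j)‖ ^ 2 +
          (q ^ (M + j + 1)) ^ 2 * ‖B (M + j) - B (M + j + 1)‖ ^ 2))) :=
      tendsto_finsetSum _ fun j _ => ((((hA _).sub (hA _)).norm.pow 2).add
        ((((hB _).sub (hB _)).norm.pow 2).const_mul _)).const_mul _
    refine (le_of_tendsto_of_tendsto' l2 l1 fun n' => ?_).trans (le_of_eq ?_)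
    · have := sum_splitFun_energy_le h0 h1 D.norm_sq hq M n (ψ (N + n'))
      simp only [← map_sub, sub_sub_sub_cancel_left]
      simpa only [hT, hQ, Function.comp_def] using this
    · rw [hM0]
      ring
  · have hδ3 : 0 < δ / 3 := by positivity
    have v1 := (hA k).eventually (Metric.ball_mem_nhds _ hδ3)
    have v2 := (hB k).eventually (Metric.ball_mem_nhds _ hδ3)
    have v3 := (hx.comp hadd).eventually (Metric.ball_mem_nhds _ hδ3)
    have v4 := (hy.comp hadd).eventually (Metric.ball_mem_nhds _ hδ3)
    obtain ⟨n, ⟨w1, w2⟩, w3, w4⟩ := ((v1.and v2).and (v3.and v4)).exists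
    simp only [dist_eq_norm, Function.comp_apply, sub_zero] at w1 w2 w3 w4
    set z := ψ (N + n) with hz
    obtain ⟨d, hd⟩ := D.dense.exists_dist_lt (T k z) hδ3
    rw [dist_eq_norm] at hd
    have d2 : P.j0 (d : H0 × H1).1 = P.j1 (d : H0 × H1).2 := d.2
    have g2 : P.j0 (g (N + n) : H0 × H1).1 = P.j1 (g (N + n) : H0 × H1).2 := (g (N + n)).2
    refine ⟨(d : H0 × H1).1 + x (N + n),
      (g (N + n) : H0 × H1).2 - (d : H0 × H1).2 + y (N + n), ?_, ?_, ?_⟩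
    · rw [map_add, map_add, map_sub, ← d2, ← g2, add_add_add_comm, hxy]
      abel
    · have e1 : (d : H0 × H1).1 + x (N + n) - A k =
          -D.p0 (T k z - D.incl d) + (D.p0 (T k z) - A k) + x (N + n) := by
        rw [map_sub, D.p0_incl]
        abel
      rw [e1]
      refine (norm_add₃_le).trans_lt ?_
      rw [norm_neg]
      linarith [D.norm_p0_le (T k z - D.incl d)]
    · have e1 : (g (N + n) : H0 × H1).2 - (d : H0 × H1).2 + y (N + n) - B k =
          D.p1 (T k z - D.incl d) + (D.p1 (z - T k z) - B k) + y (N + n) := by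
        rw [map_sub, map_sub, D.p1_incl, hz, hψ, D.p1_incl]
        abel
      rw [e1]
      refine (norm_add₃_le).trans_lt ?_
      linarith [D.norm_p1_le (T k z - D.incl d)]

end CompatiblePair

/-- The index `k` of the interval `[q^k, q^(k+1))` containing `t`. -/
def logIdx (q t : ℝ) : ℤ := ⌊Real.log t / Real.log q⌋

lemma logIdx_eq_iff {q t : ℝ} (hq : 1 < q) (ht : 0 < t) (k : ℤ) :
    logIdx q t = k ↔ t ∈ Ico (q ^ k) (q ^ (k + 1)) := by
  have hq0 : 0 < q := by linarith
  have hL := Real.log_pos hq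
  rw [logIdx, Int.floor_eq_iff, mem_Ico, le_div_iff₀ hL, div_lt_iff₀ hL,
    ← Real.log_le_log_iff (by positivity) ht, ← Real.log_lt_log_iff ht (by positivity),
    Real.log_zpow, Real.log_zpow]
  push_cast
  rfl

lemma measurable_logIdx (q : ℝ) : Measurable (logIdx q) :=
  Int.measurable_floor.comp (Real.measurable_log.div_const _)

lemma lintegral_logIdx {q : ℝ} (hq : 1 < q) (G : ℤ → ℝ≥0∞) :
    ∫⁻ t in Ioi (0:ℝ), G (logIdx q t) * ENNReal.ofReal t⁻¹ =
      ∑' k, G k * ENNReal.ofReal (Real.log q) := by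
  have hq0 : 0 < q := by linarith
  have hU : Ioi (0:ℝ) = ⋃ k : ℤ, Ico (q ^ k) (q ^ (k + 1)) := by
    ext t
    simp only [mem_Ioi, mem_iUnion]
    refine ⟨fun ht => ⟨_, (logIdx_eq_iff hq ht _).1 rfl⟩, fun ⟨k, hk⟩ => ?_⟩
    have := zpow_pos hq0 k
    exact this.trans_le hk.1
  have hd : Pairwise (Function.onFun Disjoint fun k : ℤ => Ico (q ^ k) (q ^ (k + 1))) := by
    intro k l hkl
    refine Set.disjoint_left.2 fun t hk hl => hkl ?_
    have ht : 0 < t := (zpow_pos hq0 k).trans_le hk.1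
    rw [← (logIdx_eq_iff hq ht k).2 hk, ← (logIdx_eq_iff hq ht l).2 hl]
  rw [hU, lintegral_iUnion (fun _ => measurableSet_Ico) hd]
  congr 1
  ext k
  have hk := zpow_pos hq0 k
  have hk1 : q ^ k ≤ q ^ (k + 1) := zpow_le_zpow_right₀ hq.le (by omega)
  rw [setLIntegral_congr_fun measurableSet_Ico (g := fun t => G k * ENNReal.ofReal t⁻¹)
    fun t ht => by rw [(logIdx_eq_iff hq (hk.trans_le ht.1) k).2 ht],
    lintegral_const_mul _ (by fun_prop), restrict_Ico_eq_restrict_Ioc]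
  congr 1
  have hint : IntervalIntegrable (fun t : ℝ => t⁻¹) volume (q ^ k) (q ^ (k + 1)) :=
    intervalIntegral.intervalIntegrable_inv (fun t ht => by
      rw [uIcc_of_le hk1] at ht
      exact (hk.trans_le ht.1).ne') continuousOn_id
  rw [← ofReal_integral_eq_lintegral_ofReal ((intervalIntegrable_iff_integrableOn_Ioc_of_le hk1).1
      hint) ((ae_restrict_iff' measurableSet_Ioc).2 (Eventually.of_forall fun t ht =>
        inv_nonneg.2 (hk.trans ht.1).le)), ← intervalIntegral.integral_of_le hk1,
    integral_inv_of_pos hk (hk.trans_le hk1), zpow_add_one₀ hq0.ne', mul_div_cancel_left₀ _ hk.ne']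

section Interp

variable {F : Type*} [NormedAddCommGroup F] [NormedSpace ℝ F]

/-- The piecewise affine interpolation of a sequence indexed by `ℤ`. -/
def affInterp (a : ℤ → F) (s : ℝ) : F := a ⌊s⌋ + (s - ⌊s⌋) • (a (⌊s⌋ + 1) - a ⌊s⌋)

lemma affInterp_eq (a : ℤ → F) {s : ℝ} {m : ℤ} (hs : s ∈ Icc (m : ℝ) (m + 1)) :
    affInterp a s = a m + (s - m) • (a (m + 1) - a m) := by
  rcases hs.2.lt_or_eq with h | h
  · rw [affInterp, Int.floor_eq_iff.2 ⟨hs.1, h⟩]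
  · have : ⌊s⌋ = m + 1 := by rw [h]; simp
    rw [affInterp, this, h]
    simp

lemma continuous_affInterp (a : ℤ → F) : Continuous (affInterp a) := by
  have hc : ∀ m : ℤ, Continuous fun s : ℝ => a m + (s - m) • (a (m + 1) - a m) :=
    fun m => by fun_prop
  rw [continuous_iff_continuousAt]
  intro s
  rw [continuousAt_iff_continuous_left_right]
  constructor
  · set m : ℤ := ⌈s⌉ - 1
    have h1 : (m : ℝ) < s := by have := Int.ceil_lt_add_one s; simp [m]; linarith
    have h2 : s ≤ m + 1 := by have := Int.le_ceil s; simpa [m]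
    refine (hc m).continuousWithinAt.congr_of_eventuallyEq ?_ (affInterp_eq a ⟨h1.le, h2⟩)
    filter_upwards [self_mem_nhdsWithin, mem_nhdsWithin_of_mem_nhds (Ioi_mem_nhds h1)] with x hx hx'
    exact affInterp_eq a ⟨le_of_lt hx', le_trans hx h2⟩
  · refine (hc ⌊s⌋).continuousWithinAt.congr_of_eventuallyEq ?_ rfl
    filter_upwards [self_mem_nhdsWithin,
      mem_nhdsWithin_of_mem_nhds (Iio_mem_nhds (Int.lt_floor_add_one s))] with x hx hx'
    exact affInterp_eq a ⟨(Int.floor_le s).trans hx, le_of_lt hx'⟩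

lemma hasDerivWithinAt_affInterp (a : ℤ → F) (s : ℝ) :
    HasDerivWithinAt (affInterp a) (a (⌊s⌋ + 1) - a ⌊s⌋) (Ici s) s := by
  have h1 : HasDerivAt (fun x : ℝ => a ⌊s⌋ + (x - ⌊s⌋) • (a (⌊s⌋ + 1) - a ⌊s⌋))
      ((1:ℝ) • (a (⌊s⌋ + 1) - a ⌊s⌋)) s :=
    (((hasDerivAt_id s).sub_const _).smul_const _).const_add _
  rw [one_smul] at h1
  refine h1.hasDerivWithinAt.congr_of_eventuallyEq ?_ rfl
  filter_upwards [self_mem_nhdsWithin,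
    mem_nhdsWithin_of_mem_nhds (Iio_mem_nhds (Int.lt_floor_add_one s))] with x hx hx'
  exact affInterp_eq a ⟨(Int.floor_le s).trans hx, le_of_lt hx'⟩

lemma norm_affInterp_le (a : ℤ → F) (s : ℝ) :
    ‖affInterp a s‖ ≤ ‖a ⌊s⌋‖ + ‖a (⌊s⌋ + 1) - a ⌊s⌋‖ := by
  refine (norm_add_le _ _).trans ?_
  rw [norm_smul, Real.norm_of_nonneg (by linarith [Int.floor_le s])]
  gcongr
  exact mul_le_of_le_one_left (norm_nonneg _) (by linarith [Int.lt_floor_add_one s])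

lemma integral_logIdx [CompleteSpace F] {q : ℝ} (hq : 1 < q) (a : ℤ → F) {α β : ℝ} (hα : 0 < α)
    (hαβ : α ≤ β) (hint : IntegrableOn
      (fun t => t⁻¹ • (Real.log q)⁻¹ • (a (logIdx q t + 1) - a (logIdx q t))) (Ioo α β)) :
    ∫ t in Ioo α β, t⁻¹ • (Real.log q)⁻¹ • (a (logIdx q t + 1) - a (logIdx q t)) =
      affInterp a (Real.log β / Real.log q) - affInterp a (Real.log α / Real.log q) := by
  have hL := Real.log_pos hq
  rw [← integral_Ioc_eq_integral_Ioo, ← intervalIntegral.integral_of_le hαβ]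
  refine intervalIntegral.integral_eq_sub_of_hasDeriv_right_of_le hαβ
    (f := fun t => affInterp a (Real.log t / Real.log q)) ?_ (fun t ht => ?_) ?_
  · refine (continuous_affInterp a).comp_continuousOn ?_
    exact (Real.continuousOn_log.mono fun t ht => (hα.trans_le ht.1).ne').div_const _
  · have ht0 : 0 < t := hα.trans ht.1
    have h1 : HasDerivWithinAt (fun t => Real.log t / Real.log q) (t⁻¹ / Real.log q) (Ioi t) t :=
      ((Real.hasDerivAt_log ht0.ne').div_const _).hasDerivWithinAt
    have h2 := (hasDerivWithinAt_affInterp a (Real.log t / Real.log q)).scomp t h1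
      (fun x (hx : t < x) => by
        simp only [mem_Ici]
        gcongr)
    rw [smul_smul, ← div_eq_mul_inv]
    exact h2
  · rw [intervalIntegrable_iff_integrableOn_Ioc_of_le hαβ]
    rwa [integrableOn_Ioc_iff_integrableOn_Ioo]

end Interp

namespace CompatiblePair

variable {V X0 X1 : Type*} [AddCommGroup V] [Module ℂ V]
  [NormedAddCommGroup X0] [NormedSpace ℂ X0] [CompleteSpace X0]
  [NormedAddCommGroup X1] [NormedSpace ℂ X1] [CompleteSpace X1]
  (P : CompatiblePair V X0 X1)

/-- A family of decompositions of `φ` along the geometric progression `q^k`, with the growth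
required of elements of an interpolation space. -/
structure DiscreteDecomp (θ q C : ℝ) (φ : V) (a : ℤ → X0) (b : ℤ → X1) : Prop where
  add_eq : ∀ k, P.j0 (a k) + P.j1 (b k) = φ
  norm_fst_le : ∀ k, ‖a k‖ ≤ C * (q ^ k) ^ θ
  norm_snd_le : ∀ k, ‖b k‖ ≤ C * (q ^ k) ^ (θ - 1)

variable {P} {θ q C : ℝ} {φ : V} {a : ℤ → X0} {b : ℤ → X1}

namespace DiscreteDecomp

/-- The increments of a discrete decomposition, as elements of `Δ`. -/
def increment (h : P.DiscreteDecomp θ q C φ a b) (k : ℤ) : P.deltaSub :=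
  ⟨(a (k + 1) - a k, b k - b (k + 1)), by
    change P.j0 (a (k + 1) - a k) = P.j1 (b k - b (k + 1))
    rw [map_sub, map_sub, sub_eq_sub_iff_add_eq_add, h.add_eq, add_comm, h.add_eq]⟩

/-- The piecewise constant function representing `φ`. -/
def step (h : P.DiscreteDecomp θ q C φ a b) (t : ℝ) : P.deltaSub :=
  (Real.log q)⁻¹ • h.increment (logIdx q t)

lemma step_fst (h : P.DiscreteDecomp θ q C φ a b) (t : ℝ) : (h.step t : X0 × X1).1 =
    (Real.log q)⁻¹ • (a (logIdx q t + 1) - a (logIdx q t)) := rfl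

lemma step_snd (h : P.DiscreteDecomp θ q C φ a b) (t : ℝ) : (h.step t : X0 × X1).2 =
    (Real.log q)⁻¹ • (b (logIdx q t) - b (logIdx q t + 1)) := rfl

lemma stronglyMeasurable_step (h : P.DiscreteDecomp θ q C φ a b) : StronglyMeasurable h.step :=
  (StronglyMeasurable.of_discrete (f := fun k => (Real.log q)⁻¹ • h.increment k)).comp_measurable
    (measurable_logIdx q)

lemma zero_le (h : P.DiscreteDecomp θ q C φ a b) : 0 ≤ C := by
  simpa using (norm_nonneg _).trans (h.norm_fst_le 0)

lemma norm_sub_fst_le (h : P.DiscreteDecomp θ q C φ a b) (hq : 0 < q) (k : ℤ) :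
    ‖a (k + 1) - a k‖ ≤ C * (q ^ θ + 1) * (q ^ k) ^ θ := by
  have h1 := h.norm_fst_le (k + 1)
  rw [zpow_add_one₀ hq.ne', Real.mul_rpow (by positivity) hq.le] at h1
  linarith [norm_sub_le (a (k + 1)) (a k), h.norm_fst_le k]

lemma norm_sub_snd_le (h : P.DiscreteDecomp θ q C φ a b) (hq : 0 < q) (k : ℤ) :
    ‖b (k + 1) - b k‖ ≤ C * (q ^ (θ - 1) + 1) * (q ^ k) ^ (θ - 1) := by
  have h1 := h.norm_snd_le (k + 1)
  rw [zpow_add_one₀ hq.ne', Real.mul_rpow (by positivity) hq.le] at h1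
  linarith [norm_sub_le (b (k + 1)) (b k), h.norm_snd_le k]

lemma locInt_step (h : P.DiscreteDecomp θ q C φ a b) (hq : 1 < q) {α β : ℝ} (hα : 0 < α) :
    ∃ R, ∀ t ∈ Ioo α β, ‖h.step t‖ ≤ R := by
  have hL := Real.log_pos hq
  refine ⟨∑ k ∈ Finset.Icc (logIdx q α) (logIdx q β), ‖(Real.log q)⁻¹ • h.increment k‖,
    fun t ht => ?_⟩
  have ht0 := hα.trans ht.1
  refine Finset.single_le_sum (f := fun k => ‖(Real.log q)⁻¹ • h.increment k‖)
    (fun k _ => norm_nonneg _) (Finset.mem_Icc.2 ⟨?_, ?_⟩)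
  · exact Int.floor_le_floor (by gcongr; exact ht.1.le)
  · exact Int.floor_le_floor (by gcongr; exact ht.2.le)

lemma integrableOn_step (h : P.DiscreteDecomp θ q C φ a b) (hq : 1 < q) {α β : ℝ} (hα : 0 < α) :
    IntegrableOn (fun t => ‖h.step t‖ / t) (Ioo α β) ∧
      IntegrableOn (fun t => t⁻¹ • (h.step t : X0 × X1).1) (Ioo α β) := by
  obtain ⟨R, hR⟩ := h.locInt_step hq hα (β := β)
  have hm := h.stronglyMeasurable_step
  have hm1 : StronglyMeasurable fun t => (h.step t : X0 × X1).1 :=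
    (continuous_fst.comp continuous_subtype_val).comp_stronglyMeasurable hm
  constructor
  · refine Measure.integrableOn_of_bounded (M := R / α) (by simp) ?_ ?_
    · exact (hm.norm.measurable.div measurable_id).aestronglyMeasurable
    · refine (ae_restrict_iff' measurableSet_Ioo).2 (Eventually.of_forall fun t ht => ?_)
      have ht0 := hα.trans ht.1
      rw [norm_div, norm_norm, Real.norm_of_nonneg ht0.le]
      have := (norm_nonneg _).trans (hR t ht)
      gcongr
      · exact hR t ht
      · exact ht.1.le
  · refine Measure.integrableOn_of_bounded (M := α⁻¹ * R) (by simp) ?_ ?_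
    · exact (measurable_inv.stronglyMeasurable.smul hm1).aestronglyMeasurable
    · refine (ae_restrict_iff' measurableSet_Ioo).2 (Eventually.of_forall fun t ht => ?_)
      have ht0 := hα.trans ht.1
      rw [norm_smul, norm_inv, Real.norm_of_nonneg ht0.le]
      have := (norm_nonneg _).trans (hR t ht)
      gcongr
      · exact ht.1.le
      · exact (_root_.norm_fst_le _).trans (hR t ht)

lemma summable_min (h0 : 0 < θ) (h1 : θ < 1) (hq : 1 < q) :
    Summable fun k : ℤ => min ((q ^ k) ^ θ) ((q ^ k) ^ (θ - 1)) := by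
  have hq0 : 0 < q := by linarith
  have e1 : ∀ (n : ℕ) (s : ℝ), (q ^ n) ^ s = (q ^ s) ^ n := fun n s => by
    rw [← Real.rpow_natCast, ← Real.rpow_natCast, ← Real.rpow_mul hq0.le, ← Real.rpow_mul hq0.le,
      mul_comm]
  refine Summable.of_nat_of_neg ?_ ?_
  · refine Summable.of_nonneg_of_le (fun n => le_min (by positivity) (by positivity))
      (fun n => min_le_right _ _) ?_
    simp only [zpow_natCast, e1]
    exact summable_geometric_of_lt_one (by positivity)
      (Real.rpow_lt_one_of_one_lt_of_neg hq (by linarith))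
  · refine Summable.of_nonneg_of_le (fun n => le_min (by positivity) (by positivity))
      (fun n => min_le_left _ _) ?_
    have e2 : ∀ n : ℕ, (q ^ (-(n:ℤ))) ^ θ = ((q ^ θ)⁻¹) ^ n := fun n => by
      rw [zpow_neg, zpow_natCast, Real.inv_rpow (by positivity), e1, inv_pow]
    simp only [e2]
    exact summable_geometric_of_lt_one (by positivity)
      (inv_lt_one_of_one_lt₀ (Real.one_lt_rpow hq h0))

lemma sigmaInt_step (h : P.DiscreteDecomp θ q C φ a b) (h0 : 0 < θ) (h1 : θ < 1) (hq : 1 < q) :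
    ∫⁻ t in Ioi (0:ℝ), P.normSigmaE (P.j0 ((h.step t : X0 × X1).1)) * ENNReal.ofReal t⁻¹ < ⊤ := by
  have hq0 : 0 < q := by linarith
  have hL := Real.log_pos hq
  have hC := h.zero_le
  have e := lintegral_logIdx hq fun k =>
    P.normSigmaE (P.j0 ((Real.log q)⁻¹ • (a (k + 1) - a k)))
  rw [ENNReal.tsum_mul_right] at e
  refine lt_of_eq_of_lt e ?_
  refine ENNReal.mul_lt_top ?_ ENNReal.ofReal_lt_top
  set D := (Real.log q)⁻¹ * (C * (q ^ θ + 1) + C * (q ^ (θ - 1) + 1)) with hD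
  refine lt_of_le_of_lt (ENNReal.tsum_le_tsum (g := fun k : ℤ =>
    ENNReal.ofReal (D * min ((q ^ k) ^ θ) ((q ^ k) ^ (θ - 1)))) fun k => ?_)
    ((summable_min h0 h1 hq).mul_left D).tsum_ofReal_lt_top
  have e0 : P.j0 ((Real.log q)⁻¹ • (a (k + 1) - a k)) =
      P.j1 ((Real.log q)⁻¹ • (b k - b (k + 1))) := ((Real.log q)⁻¹ • h.increment k).2
  rw [mul_min_of_nonneg _ _ (by positivity), ENNReal.ofReal_min]
  refine le_min ?_ ?_
  · refine (P.normSigmaE_le (a := (Real.log q)⁻¹ • (a (k + 1) - a k)) (b := 0) (by simp)).trans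
      (ENNReal.ofReal_le_ofReal ?_)
    rw [norm_zero, add_zero, norm_smul, Real.norm_of_nonneg (by positivity), hD, mul_assoc]
    gcongr
    refine (h.norm_sub_fst_le hq0 k).trans ?_
    gcongr
    exact le_add_of_nonneg_right (by positivity)
  · refine (P.normSigmaE_le (a := 0) (b := (Real.log q)⁻¹ • (b k - b (k + 1)))
      (by rw [e0, map_zero, zero_add])).trans (ENNReal.ofReal_le_ofReal ?_)
    rw [norm_zero, zero_add, norm_smul, Real.norm_of_nonneg (by positivity), hD, mul_assoc,
      norm_sub_rev]
    gcongr
    refine (h.norm_sub_snd_le hq0 k).trans ?_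
    gcongr
    exact le_add_of_nonneg_left (by positivity)

lemma affInterp_add_eq (h : P.DiscreteDecomp θ q C φ a b) (s : ℝ) :
    P.j0 (affInterp a s) + P.j1 (affInterp b s) = φ := by
  have e : ∀ k, P.j1 (b k) = φ - P.j0 (a k) := fun k => by rw [← h.add_eq k]; abel
  simp only [affInterp, RCLike.real_smul_eq_coe_smul (K := ℂ), map_add, map_smul, map_sub, e]
  rw [sub_sub_sub_cancel_left, ← neg_sub (P.j0 (a (⌊s⌋ + 1))), smul_neg]
  abel

lemma norm_affInterp_fst_le (h : P.DiscreteDecomp θ q C φ a b) (h0 : 0 < θ) (hq : 1 < q) {t : ℝ}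
    (ht : 0 < t) :
    ‖affInterp a (Real.log t / Real.log q)‖ ≤ (C + C * (q ^ θ + 1)) * t ^ θ := by
  have hq0 : 0 < q := by linarith
  have hC := h.zero_le
  have hk := ((logIdx_eq_iff hq ht _).1 rfl).1
  refine (norm_affInterp_le _ _).trans ?_
  change ‖a (logIdx q t)‖ + ‖a (logIdx q t + 1) - a (logIdx q t)‖ ≤ _
  calc _ ≤ (C + C * (q ^ θ + 1)) * (q ^ logIdx q t) ^ θ := by
        linarith [h.norm_fst_le (logIdx q t), h.norm_sub_fst_le hq0 (logIdx q t)]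
    _ ≤ _ := by gcongr

lemma norm_affInterp_snd_le (h : P.DiscreteDecomp θ q C φ a b) (h1 : θ < 1) (hq : 1 < q) {t : ℝ}
    (ht : 0 < t) : ‖affInterp b (Real.log t / Real.log q)‖ ≤
      (C + C * (q ^ (θ - 1) + 1)) * q ^ (1 - θ) * t ^ (θ - 1) := by
  have hq0 : 0 < q := by linarith
  have hC := h.zero_le
  have hk := ((logIdx_eq_iff hq ht _).1 rfl).2
  refine (norm_affInterp_le _ _).trans ?_
  change ‖b (logIdx q t)‖ + ‖b (logIdx q t + 1) - b (logIdx q t)‖ ≤ _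
  calc _ ≤ (C + C * (q ^ (θ - 1) + 1)) * (q ^ logIdx q t) ^ (θ - 1) := by
        linarith [h.norm_snd_le (logIdx q t), h.norm_sub_snd_le hq0 (logIdx q t)]
    _ ≤ (C + C * (q ^ (θ - 1) + 1)) * (t / q) ^ (θ - 1) := by
        gcongr ?_ * ?_
        refine Real.rpow_le_rpow_of_nonpos (by positivity) ?_ (by linarith)
        rw [div_le_iff₀ hq0, ← zpow_add_one₀ hq0.ne']
        exact hk.le
    _ = _ := by
        rw [Real.div_rpow ht.le hq0.le, mul_assoc, ← neg_sub θ 1, Real.rpow_neg hq0.le]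
        ring

/-- The piecewise constant function attached to a discrete decomposition is a J-representation. -/
lemma isJRep_step (h : P.DiscreteDecomp θ q C φ a b) (h0 : 0 < θ) (h1 : θ < 1) (hq : 1 < q) :
    P.IsJRep φ h.step where
  meas := h.stronglyMeasurable_step.aestronglyMeasurable
  locInt α β hα _ := (h.integrableOn_step hq hα).1
  sigmaInt := h.sigmaInt_step h0 h1 hq
  conv := by
    set C0 := C + C * (q ^ θ + 1)
    set C1 := (C + C * (q ^ (θ - 1) + 1)) * q ^ (1 - θ)
    have l0 : Tendsto (fun t : ℝ => C0 * t ^ θ) (𝓝[>] 0) (𝓝 0) := by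
      have := ((Real.continuousAt_rpow_const 0 θ (Or.inr h0.le)).tendsto.mono_left
        (nhdsWithin_le_nhds (s := Ioi 0))).const_mul C0
      rwa [Real.zero_rpow h0.ne', mul_zero] at this
    have l1 : Tendsto (fun t : ℝ => C1 * t ^ (θ - 1)) atTop (𝓝 0) := by
      have := (tendsto_rpow_neg_atTop (y := 1 - θ) (by linarith)).const_mul C1
      rwa [mul_zero, neg_sub] at this
    have l : Tendsto (fun p : ℝ × ℝ => ENNReal.ofReal (C0 * p.1 ^ θ + C1 * p.2 ^ (θ - 1)))
        ((𝓝[>] (0:ℝ)) ×ˢ atTop) (𝓝 0) := by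
      have := ENNReal.tendsto_ofReal ((l0.comp tendsto_fst).add (l1.comp tendsto_snd))
      rw [add_zero, ENNReal.ofReal_zero] at this
      exact this
    refine tendsto_of_tendsto_of_tendsto_of_le_of_le' tendsto_const_nhds l
      (Eventually.of_forall fun _ => _root_.zero_le) ?_
    have m1 : ∀ᶠ x : ℝ in 𝓝[>] 0, x ∈ Ioo (0:ℝ) 1 := Ioo_mem_nhdsGT one_pos
    filter_upwards [m1.prod_mk (eventually_gt_atTop (1:ℝ))] with p hp
    obtain ⟨⟨hα, hα1⟩, hβ⟩ := hp
    have hint := (h.integrableOn_step hq hα (β := p.2)).2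
    have e : ∫ t in Ioo p.1 p.2, t⁻¹ • (h.step t : X0 × X1).1 =
        affInterp a (Real.log p.2 / Real.log q) - affInterp a (Real.log p.1 / Real.log q) :=
      integral_logIdx hq a hα (hα1.trans hβ).le hint
    rw [e]
    refine (P.normSigmaE_le (a := affInterp a (Real.log p.1 / Real.log q))
      (b := affInterp b (Real.log p.2 / Real.log q)) ?_).trans (ENNReal.ofReal_le_ofReal ?_)
    · rw [map_sub, ← h.affInterp_add_eq (Real.log p.2 / Real.log q)]
      abel
    · exact add_le_add (h.norm_affInterp_fst_le h0 hq hα)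
        (h.norm_affInterp_snd_le h1 hq (one_pos.trans hβ))

end DiscreteDecomp

end CompatiblePair

lemma ENNReal.tsum_int_le {u : ℤ → ℝ≥0∞} {c : ℝ≥0∞}
    (h : ∀ (M : ℤ) (n : ℕ), ∑ j ∈ Finset.range n, u (M + j) ≤ c) : ∑' k, u k ≤ c := by
  rw [ENNReal.tsum_eq_iSup_sum]
  refine iSup_le fun s => ?_
  set N := s.sup Int.natAbs
  refine le_trans ?_ (h (-N) (2 * N + 1))
  rw [← Finset.sum_image (s := Finset.range (2 * N + 1)) (g := fun j : ℕ => -(N : ℤ) + j)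
    fun i _ j _ hij => by simpa using hij]
  refine Finset.sum_le_sum_of_subset fun k hk => ?_
  have : k.natAbs ≤ N := Finset.le_sup (f := Int.natAbs) hk
  rw [Finset.mem_image]
  exact ⟨(k + N).toNat, by rw [Finset.mem_range]; omega, by omega⟩

lemma norm_sq_le_of_norm_sub_le {F : Type*} [SeminormedAddCommGroup F] {x y : F} {d η : ℝ}
    (hη : 0 < η) (h : ‖x - y‖ ≤ d) : ‖x‖ ^ 2 ≤ (1 + η) * ‖y‖ ^ 2 + (1 + η⁻¹) * d ^ 2 := by
  have h1 : ‖x‖ ≤ ‖y‖ + d := by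
    have := norm_add_le y (x - y)
    rw [add_sub_cancel] at this
    linarith
  have h2 : ‖x‖ ^ 2 ≤ (‖y‖ + d) ^ 2 := by gcongr
  have h3 : 0 ≤ η⁻¹ * (η * ‖y‖ - d) ^ 2 := by positivity
  have h4 : η⁻¹ * (η * ‖y‖ - d) ^ 2 = η * ‖y‖ ^ 2 - 2 * ‖y‖ * d + η⁻¹ * d ^ 2 := by
    field_simp
    ring
  nlinarith

namespace CompatiblePair

variable {V H0 H1 : Type*} [AddCommGroup V] [Module ℂ V]
    [NormedAddCommGroup H0] [InnerProductSpace ℂ H0] [CompleteSpace H0]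
    [NormedAddCommGroup H1] [InnerProductSpace ℂ H1] [CompleteSpace H1]
    {P : CompatiblePair V H0 H1} {E : Type*} [NormedAddCommGroup E] [InnerProductSpace ℂ E]
    {θ q C : ℝ} {φ : V} {a : ℤ → H0} {b : ℤ → H1}

lemma DiscreteDecomp.jSq_step_le (h : P.DiscreteDecomp θ q C φ a b) (h0 : 0 < θ) (hq : 1 < q) :
    jSq θ h.step ≤ ∑' k : ℤ, ENNReal.ofReal ((Real.log q)⁻¹ * ((q ^ k) ^ (-2 * θ) *
      (‖a (k + 1) - a k‖ ^ 2 + (q ^ (k + 1)) ^ 2 * ‖b k - b (k + 1)‖ ^ 2))) := by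
  have hq0 : 0 < q := by linarith
  have hL := Real.log_pos hq
  set W : ℤ → ℝ := fun k => (q ^ k) ^ (-2 * θ) *
      (‖a (k + 1) - a k‖ ^ 2 + (q ^ (k + 1)) ^ 2 * ‖b k - b (k + 1)‖ ^ 2) with hW
  have e := lintegral_logIdx hq fun k => ENNReal.ofReal ((Real.log q)⁻¹ ^ 2 * W k)
  refine (le_trans ?_ e.le).trans (le_of_eq (tsum_congr fun k => ?_))
  · refine setLIntegral_mono' measurableSet_Ioi fun t (ht : 0 < t) => ?_
    rw [← ENNReal.ofReal_mul' (by positivity)]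
    apply ENNReal.ofReal_le_ofReal
    have hk := (logIdx_eq_iff hq ht _).1 rfl
    have hqk := zpow_pos hq0 (logIdx q t)
    rw [Jfun_sq, h.step_fst, h.step_snd, norm_smul, norm_smul, Real.norm_of_nonneg (by positivity),
      Real.rpow_sub_one ht.ne', hW]
    dsimp only
    set k := logIdx q t
    have h1 : t ^ (-2 * θ) ≤ (q ^ k) ^ (-2 * θ) :=
      Real.rpow_le_rpow_of_nonpos hqk hk.1 (by linarith)
    have h2 : t ^ 2 ≤ (q ^ (k + 1)) ^ 2 := by
      have := hk.2.le
      gcongr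
    calc _ = t ^ (-2 * θ) * ((Real.log q)⁻¹ ^ 2 *
          (‖a (k + 1) - a k‖ ^ 2 + t ^ 2 * ‖b k - b (k + 1)‖ ^ 2)) * t⁻¹ := by ring
      _ ≤ (q ^ k) ^ (-2 * θ) * ((Real.log q)⁻¹ ^ 2 *
          (‖a (k + 1) - a k‖ ^ 2 + (q ^ (k + 1)) ^ 2 * ‖b k - b (k + 1)‖ ^ 2)) * t⁻¹ := by
        gcongr
      _ = _ := by ring
  · rw [← ENNReal.ofReal_mul' hL.le]
    congr 1
    change _ = (Real.log q)⁻¹ * W k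
    generalize W k = w
    field_simp

/-- Perturbation of an exact energy estimate to one along genuine decompositions. -/
lemma DeltaCompletion.exists_isJRep_le [CompleteSpace E] (D : P.DeltaCompletion E)
    (h0 : 0 < θ) (h1 : θ < 1) (hq : 1 < q) (hφ : φ ∈ P.sigmaSet) (hk : P.kSq θ φ < ⊤) {η : ℝ}
    (hη : 0 < η) : ∃ f, P.IsJRep φ f ∧ jSq θ f ≤ ENNReal.ofReal
      ((1 + η) * (normConst θ ^ 2 * q ^ 4 * (P.kSq θ φ).toReal) + η / Real.log q) := by
  have hq0 : 0 < q := by linarith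
  have hL := Real.log_pos hq
  obtain ⟨A, B, C, hA, hB, hE, hap⟩ := D.exists_decomposition h0 h1 hq hφ hk
  obtain ⟨s, hs, hsum⟩ := ENNReal.exists_pos_sum_of_countable
    (ε := ENNReal.ofReal η) (by simpa using hη) ℤ
  have hqk : ∀ k : ℤ, 0 < q ^ k := fun k => zpow_pos hq0 k
  set m : ℤ → ℝ := fun k => (q ^ k) ^ (-2 * θ) * (1 + (q ^ (k + 1)) ^ 2) with hm
  have hm0 : ∀ k, 0 < m k := fun k => by have := hqk k; positivity
  set e : ℤ → ℝ := fun k => min (min ((q ^ k) ^ θ) ((q ^ k) ^ (θ - 1)))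
    (√(s k / (4 * (1 + η⁻¹) * m k))) with he
  have he0 : ∀ k, 0 < e k := fun k => by
    have := hqk k
    have := hm0 k
    have : 0 < (s k : ℝ) := hs k
    exact lt_min (lt_min (by positivity) (by positivity)) (by positivity)
  have hes : ∀ k, (1 + η⁻¹) * (m k * (2 * e k) ^ 2) ≤ s k := fun k => by
    have h3 := hm0 k
    have h4 : e k ^ 2 ≤ s k / (4 * (1 + η⁻¹) * m k) := by
      rw [← Real.sq_sqrt (show 0 ≤ s k / (4 * (1 + η⁻¹) * m k) by positivity)]
      exact pow_le_pow_left₀ (he0 k).le (min_le_right _ _) 2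
    rw [le_div_iff₀ (by positivity)] at h4
    linarith
  choose a b hab ha hb using fun k => hap k (min (e k) (e (k - 1))) (lt_min (he0 _) (he0 _))
  have ha0 : ∀ k, ‖a k - A k‖ ≤ e k := fun k => (ha k).le.trans (min_le_left _ _)
  have hb0 : ∀ k, ‖b k - B k‖ ≤ e k := fun k => (hb k).le.trans (min_le_left _ _)
  have ha1 : ∀ k, ‖a (k + 1) - A (k + 1)‖ ≤ e k := fun k => by
    have := (ha (k + 1)).le.trans (min_le_right _ _)
    rwa [add_sub_cancel_right] at this
  have hb1 : ∀ k, ‖b (k + 1) - B (k + 1)‖ ≤ e k := fun k => by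
    have := (hb (k + 1)).le.trans (min_le_right _ _)
    rwa [add_sub_cancel_right] at this
  have hsq : ∀ {x y c : ℝ}, 0 ≤ y → x ^ 2 ≤ c * y ^ 2 → x ≤ √c * y := fun {x y c} hy h => by
    have := Real.le_sqrt_of_sq_le h
    rwa [Real.sqrt_mul' _ (sq_nonneg _), Real.sqrt_sq hy] at this
  have hd : P.DiscreteDecomp θ q (√C + 1) φ a b := by
    refine ⟨hab, fun k => ?_, fun k => ?_⟩
    · have := hqk k
      have h3 : ‖A k‖ ≤ √C * (q ^ k) ^ θ := hsq (by positivity) (by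
        rw [← Real.rpow_mul_natCast this.le, mul_comm θ]
        exact_mod_cast hA k)
      have h4 : ‖a k - A k‖ ≤ (q ^ k) ^ θ :=
        (ha0 k).trans ((min_le_left _ _).trans (min_le_left _ _))
      linarith [norm_le_norm_add_norm_sub' (a k) (A k)]
    · have := hqk k
      have h3 : ‖B k‖ ≤ √C * (q ^ k) ^ (θ - 1) := hsq (by positivity) (by
        rw [← Real.rpow_mul_natCast this.le,
          show (θ - 1) * ((2:ℕ):ℝ) = 2 * θ - 2 by push_cast; ring]
        exact hB k)
      have h4 : ‖b k - B k‖ ≤ (q ^ k) ^ (θ - 1) :=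
        (hb0 k).trans ((min_le_left _ _).trans (min_le_right _ _))
      linarith [norm_le_norm_add_norm_sub' (b k) (B k)]
  set W : ℤ → ℝ := fun k => (q ^ k) ^ (-2 * θ) *
      (‖A (k + 1) - A k‖ ^ 2 + (q ^ (k + 1)) ^ 2 * ‖B k - B (k + 1)‖ ^ 2) with hW
  have hW0 : ∀ k, 0 ≤ W k := fun k => by have := hqk k; positivity
  have hstep : ∀ k, (q ^ k) ^ (-2 * θ) *
      (‖a (k + 1) - a k‖ ^ 2 + (q ^ (k + 1)) ^ 2 * ‖b k - b (k + 1)‖ ^ 2) ≤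
      (1 + η) * W k + s k := fun k => by
    have h3 : ‖(a (k + 1) - a k) - (A (k + 1) - A k)‖ ≤ 2 * e k := by
      rw [sub_sub_sub_comm]
      linarith [norm_sub_le (a (k + 1) - A (k + 1)) (a k - A k), ha0 k, ha1 k]
    have h4 : ‖(b k - b (k + 1)) - (B k - B (k + 1))‖ ≤ 2 * e k := by
      rw [sub_sub_sub_comm]
      linarith [norm_sub_le (b k - B k) (b (k + 1) - B (k + 1)), hb0 k, hb1 k]
    have := hqk k
    calc _ ≤ (q ^ k) ^ (-2 * θ) *
        (((1 + η) * ‖A (k + 1) - A k‖ ^ 2 + (1 + η⁻¹) * (2 * e k) ^ 2) + (q ^ (k + 1)) ^ 2 *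
          ((1 + η) * ‖B k - B (k + 1)‖ ^ 2 + (1 + η⁻¹) * (2 * e k) ^ 2)) := by
          gcongr
          · exact norm_sq_le_of_norm_sub_le hη h3
          · exact norm_sq_le_of_norm_sub_le hη h4
      _ = (1 + η) * W k + (1 + η⁻¹) * (m k * (2 * e k) ^ 2) := by
          rw [hW, hm]
          ring
      _ ≤ _ := by linarith [hes k]
  have hWsum : ∑' k, ENNReal.ofReal (W k) ≤
      ENNReal.ofReal (normConst θ ^ 2 * q ^ 4 * Real.log q * (P.kSq θ φ).toReal) := by
    refine ENNReal.tsum_int_le fun M n => ?_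
    rw [← ENNReal.ofReal_sum_of_nonneg fun j _ => hW0 _]
    exact ENNReal.ofReal_le_ofReal (hE M n)
  refine ⟨_, hd.isJRep_step h0 h1 hq, (hd.jSq_step_le h0 hq).trans ?_⟩
  calc _ ≤ ∑' k : ℤ, (ENNReal.ofReal ((Real.log q)⁻¹ * (1 + η)) * ENNReal.ofReal (W k) +
        ENNReal.ofReal (Real.log q)⁻¹ * s k) := by
        refine ENNReal.tsum_le_tsum fun k => ?_
        rw [← ENNReal.ofReal_mul (by positivity), ← ENNReal.ofReal_coe_nnreal (p := s k),
          ← ENNReal.ofReal_mul (by positivity),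
          ← ENNReal.ofReal_add (by have := hW0 k; positivity) (by positivity)]
        apply ENNReal.ofReal_le_ofReal
        have := mul_le_mul_of_nonneg_left (hstep k) (inv_nonneg.2 hL.le)
        linarith
    _ ≤ ENNReal.ofReal ((Real.log q)⁻¹ * (1 + η)) *
          ENNReal.ofReal (normConst θ ^ 2 * q ^ 4 * Real.log q * (P.kSq θ φ).toReal) +
        ENNReal.ofReal (Real.log q)⁻¹ * ENNReal.ofReal η := by
        rw [ENNReal.tsum_add, ENNReal.tsum_mul_left, ENNReal.tsum_mul_left]
        gcongr
    _ = _ := by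
        rw [← ENNReal.ofReal_mul (by positivity), ← ENNReal.ofReal_mul (by positivity),
          ← ENNReal.ofReal_add (by positivity) (by positivity)]
        congr 1
        field_simp

lemma DeltaCompletion.exists_isJRep_le_add [CompleteSpace E] (D : P.DeltaCompletion E)
    (h0 : 0 < θ) (h1 : θ < 1) (hφ : φ ∈ P.sigmaSet) (hk : P.kSq θ φ < ⊤) {ε : ℝ}
    (hε : 0 < ε) : ∃ f, P.IsJRep φ f ∧ jSq θ f ≤ ENNReal.ofReal
      (normConst θ ^ 2 * (P.kSq θ φ).toReal + ε) := by
  set K := normConst θ ^ 2 * (P.kSq θ φ).toReal with hK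
  have hK0 : 0 ≤ K := by positivity
  have hc : Tendsto (fun q : ℝ => q ^ 4 * K) (𝓝[>] 1) (𝓝 (1 ^ 4 * K)) :=
    (Continuous.tendsto (by fun_prop) 1).mono_left nhdsWithin_le_nhds
  obtain ⟨q, hqK, hq⟩ := ((hc.eventually_lt_const (u := K + ε / 2) (by linarith)).and
    self_mem_nhdsWithin).exists
  have hq : 1 < q := hq
  have hL := Real.log_pos hq
  have hq0 : 0 < q := by linarith
  have hR : 0 < q ^ 4 * K + (Real.log q)⁻¹ := by positivity
  obtain ⟨f, hf, hle⟩ := D.exists_isJRep_le h0 h1 hq hφ hk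
    (η := ε / 2 / (q ^ 4 * K + (Real.log q)⁻¹)) (by positivity)
  refine ⟨f, hf, hle.trans (ENNReal.ofReal_le_ofReal ?_)⟩
  set η := ε / 2 / (q ^ 4 * K + (Real.log q)⁻¹) with hη
  have e : η * (q ^ 4 * K + (Real.log q)⁻¹) = ε / 2 := div_mul_cancel₀ _ hR.ne'
  calc _ = q ^ 4 * K + η * (q ^ 4 * K + (Real.log q)⁻¹) := by rw [hK]; ring
    _ ≤ _ := by linarith

/-- On the K-space, the two unnormalised norms differ by the factor `(2/π) sin (πθ)`. -/
lemma DeltaCompletion.JinfE_eq [CompleteSpace E] (D : P.DeltaCompletion E)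
    (h0 : 0 < θ) (h1 : θ < 1) (hφ : φ ∈ P.Kmem θ 2) :
    P.JinfE θ 2 φ = ENNReal.ofReal (normConst θ) * P.KquasinormE θ 2 φ := by
  have hν := normConst_pos h0 h1
  have hk : P.kSq θ φ < ⊤ := by
    rw [← P.KquasinormE_two_sq]
    exact ENNReal.pow_lt_top hφ.2
  have hsq : (ENNReal.ofReal (normConst θ) * P.KquasinormE θ 2 φ) ^ 2 =
      ENNReal.ofReal (normConst θ ^ 2) * P.kSq θ φ := by
    rw [mul_pow, P.KquasinormE_two_sq, ENNReal.ofReal_pow hν.le]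
  apply le_antisymm
  · rw [← ENNReal.pow_le_pow_left_iff two_ne_zero, hsq]
    refine ENNReal.le_of_forall_pos_le_add fun ε hε _ => ?_
    obtain ⟨f, hf, hle⟩ := D.exists_isJRep_le_add h0 h1 hφ.1 hk (ε := ε) hε
    calc _ ≤ thetaNormE θ 2 (fun t => ENNReal.ofReal (Jfun t (f t : H0 × H1))) ^ 2 :=
          pow_le_pow_left' (iInf₂_le f hf) 2
      _ ≤ _ := by
          rw [thetaNormE_Jfun_sq]
          refine hle.trans (le_of_eq ?_)
          rw [ENNReal.ofReal_add (by positivity) ε.coe_nonneg, ENNReal.ofReal_mul (by positivity),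
            ENNReal.ofReal_toReal hk.ne, ENNReal.ofReal_coe_nnreal]
  · refine le_iInf₂ fun f hf => ?_
    rw [← ENNReal.pow_le_pow_left_iff two_ne_zero, hsq, thetaNormE_Jfun_sq]
    calc _ ≤ ENNReal.ofReal (normConst θ ^ 2) *
          (ENNReal.ofReal ((normConst θ)⁻¹ ^ 2) * jSq θ f) := by
          gcongr
          exact D.kSq_le_jSq h0 h1 hf
      _ = _ := by
          rw [← mul_assoc, ← ENNReal.ofReal_mul (by positivity), ← mul_pow,
            mul_inv_cancel₀ hν.ne', one_pow, ENNReal.ofReal_one, one_mul]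

lemma DeltaCompletion.Kmem_eq [CompleteSpace E] (D : P.DeltaCompletion E)
    (h0 : 0 < θ) (h1 : θ < 1) : P.Kmem θ 2 = P.Jmem θ 2 := by
  ext φ
  constructor
  · intro hφ
    change P.JinfE θ 2 φ < ⊤
    rw [D.JinfE_eq h0 h1 hφ]
    exact ENNReal.mul_lt_top ENNReal.ofReal_lt_top hφ.2
  · intro hφ
    obtain ⟨f, hlt⟩ := iInf_lt_iff.1 (show P.JinfE θ 2 φ < ⊤ from hφ)
    obtain ⟨hf, hlt⟩ := iInf_lt_iff.1 hlt
    refine ⟨hf.mem_sigmaSet, ?_⟩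
    replace hlt := ENNReal.pow_lt_top hlt (n := 2)
    rw [thetaNormE_Jfun_sq] at hlt
    refine (ENNReal.pow_lt_top_iff.1 (?_ : P.KquasinormE θ 2 φ ^ 2 < ⊤)).resolve_right two_ne_zero
    rw [P.KquasinormE_two_sq]
    exact (D.kSq_le_jSq h0 h1 hf).trans_lt (ENNReal.mul_lt_top ENNReal.ofReal_lt_top hlt)

/-- The completion of `Δ`, realised as the closure of the diagonal in the Hilbert sum. -/
def deltaCompletion (P : CompatiblePair V H0 H1) : P.DeltaCompletion
    (P.deltaSub.comap (WithLp.prodContinuousLinearEquiv 2 ℂ H0 H1 :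
      WithLp 2 (H0 × H1) →ₗ[ℂ] H0 × H1)).topologicalClosure where
  p0 := (WithLp.fstL 2 ℂ H0 H1).comp (Submodule.subtypeL _)
  p1 := (WithLp.sndL 2 ℂ H0 H1).comp (Submodule.subtypeL _)
  incl := (((WithLp.prodContinuousLinearEquiv 2 ℂ H0 H1).symm :
    H0 × H1 →L[ℂ] WithLp 2 (H0 × H1)).comp P.deltaSub.subtypeL).codRestrict _ fun f =>
      Submodule.le_topologicalClosure _ f.2
  norm_sq x := (WithLp.prod_norm_sq_eq_of_L2 (x : WithLp 2 (H0 × H1))).symm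
  p0_incl _ := rfl
  p1_incl _ := rfl
  dense := by
    intro x
    rw [closure_subtype]
    refine closure_mono ?_ x.2
    intro y hy
    exact ⟨_, ⟨⟨_, hy⟩, rfl⟩, rfl⟩

end CompatiblePair

/-- For a compatible pair of complex Hilbert spaces `H̄ = (H0,H1)` and
`0 < θ < 1`, with the normalisation `N_{θ,2} = ((2/π) sin (πθ))^{1/2}` in both definitions,
the K- and J-interpolation spaces coincide: `K_{θ,2}(H̄) = J_{θ,2}(H̄)` as sets, and
`‖φ‖_{K_{θ,2}(H̄)} = ‖φ‖_{J_{θ,2}(H̄)}` for every `φ ∈ K_{θ,2}(H̄)`. -/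
theorem statement10
    {V H0 H1 : Type*} [AddCommGroup V] [Module ℂ V]
    [NormedAddCommGroup H0] [InnerProductSpace ℂ H0] [CompleteSpace H0]
    [NormedAddCommGroup H1] [InnerProductSpace ℂ H1] [CompleteSpace H1]
    (P : CompatiblePair V H0 H1)
    (θ : ℝ) (hθ0 : 0 < θ) (hθ1 : θ < 1) :
    P.Kmem θ 2 = P.Jmem θ 2 ∧
    ∀ φ ∈ P.Kmem θ 2, P.Knorm2E θ φ = P.Jnorm2E θ φ := by
  refine ⟨P.deltaCompletion.Kmem_eq hθ0 hθ1, fun φ hφ => ?_⟩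
  have hν : 0 < 2 / Real.pi * Real.sin (Real.pi * θ) := normConst_pos hθ0 hθ1
  have hs : ENNReal.ofReal (√(2 / Real.pi * Real.sin (Real.pi * θ))) ≠ 0 := by
    simpa using hν
  rw [CompatiblePair.Knorm2E, CompatiblePair.Jnorm2E, P.deltaCompletion.JinfE_eq hθ0 hθ1 hφ,
    ← mul_assoc, normConst]
  congr 1
  rw [show ENNReal.ofReal (2 / Real.pi * Real.sin (Real.pi * θ)) = _ * _ from by
      rw [← Real.mul_self_sqrt hν.le, ENNReal.ofReal_mul (Real.sqrt_nonneg _)],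
    ← mul_assoc, ENNReal.inv_mul_cancel hs ENNReal.ofReal_ne_top, one_mul]
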